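/- Fix η∈(0,1). There exist constants 0<c≤C<∞ depending only on η such that for all N,p∈ℕ with p≤N: c·exp(−CN/p) ≤ P₀(cap(X̄_{B(N)}) ≤ cap(ℛ_{N,p})); moreover P₀(cap(X̄_{B(N)}) ≤ cap(ℛ_{N,p})) ≤ C·exp(−(cN/p)^{1−η}) when d=3, and P₀(cap(X̄_{B(N)}) ≤ cap(ℛ_{N,p})) ≤ C·exp(−cN/(p·max(1,log p)²)) when d=4. -/

import Mathlib

open MeasureTheory Set Filter
open scoped ENNReal Topology Classical

noncomputable section

namespace Paper

/-- The lattice `ℤ^d`. -/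
abbrev Zd (d : ℕ) := Fin d → ℤ

/-- Nearest-neighbour adjacency on `ℤ^d`. -/
def adjZ {d : ℕ} (x y : Zd d) : Prop := (∑ i, |x i - y i|) = 1

/-- The Euclidean distance on `ℤ^d`. -/
def ddZ {d : ℕ} (x y : Zd d) : ℝ := Real.sqrt (∑ i, ((x i - y i : ℤ) : ℝ) ^ 2)

/-- The Euclidean ball `B(x,r)` in `ℤ^d`. -/
def ballZ {d : ℕ} (x : Zd d) (r : ℝ) : Set (Zd d) := {y | ddZ x y ≤ r}

/-- Trajectories that never return to `A` after time `0`, i.e. `H̃_A = ∞`. -/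
def avoidSet {V : Type} (A : Set V) : Set (ℕ → V) := {ω | ∀ k, 1 ≤ k → ω k ∉ A}

/-- The set `X̄_A` of points visited by a trajectory strictly before exiting `A`. -/
def visited {V : Type} (A : Set V) (ω : ℕ → V) : Set V :=
  {v | ∃ k : ℕ, (∀ n ≤ k, ω n ∈ A) ∧ ω k = v}

/-- Capacity on `ℤ^d`: `cap(A) = ∑_{x∈A} 2d · P_x(H̃_A = ∞)`. -/
def capZ {d : ℕ} (P : Zd d → Measure (ℕ → Zd d)) (A : Set (Zd d)) : ℝ :=
  ∑' x : A, (2 * d : ℝ) * (P x (avoidSet A)).toReal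

/-- `P` is the family of laws of the simple random walk on `ℤ^d`. -/
structure WalkLaw (d : ℕ) (P : Zd d → Measure (ℕ → Zd d)) : Prop where
  prob : ∀ x, IsProbabilityMeasure (P x)
  start : ∀ x, P x {ω | ω 0 = x} = 1
  step : ∀ x y : Zd d,
    P x {ω | ω 1 = y} = ENNReal.ofReal (if adjZ x y then 1 / (2 * d) else 0)
  markov : ∀ (x y : Zd d) (k : ℕ) (S : Set (ℕ → Zd d)), MeasurableSet S →
    P x ({ω | ω k = y} ∩ {ω | (fun n => ω (k + n)) ∈ S}) = P x {ω | ω k = y} * P y S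

/-- `a` and `b` are joined by a nearest-neighbour path inside `S ⊆ ℤ^d`. -/
def connInZ {d : ℕ} (S : Set (Zd d)) (a b : Zd d) : Prop :=
  ∃ (m : ℕ) (γ : ℕ → Zd d), γ 0 = a ∧ γ m = b ∧ (∀ i ≤ m, γ i ∈ S) ∧
    ∀ i < m, adjZ (γ i) (γ (i + 1))

/-- The tube `ℛ_{N,p} = ([0,N] × [-p,p]^{d-1}) ∩ ℤ^d`. -/
def tube (d : ℕ) (N p : ℤ) : Set (Zd d) :=
  {x | ∀ i : Fin d, if (i : ℕ) = 0 then 0 ≤ x i ∧ x i ≤ N else |x i| ≤ p}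

section

variable {d : ℕ}

/-- The average of `f` over the neighbours of `x`. -/
def avg (f : Zd d → ℝ) (x : Zd d) : ℝ :=
  (∑ i : Fin d, (f (x + Pi.single i 1) + f (x - Pi.single i 1))) / (2 * d)

lemma avg_mono {f g : Zd d → ℝ} (h : ∀ x, f x ≤ g x) (x : Zd d) : avg f x ≤ avg g x := by
  unfold avg
  gcongr <;> apply h

lemma avg_add (f g : Zd d → ℝ) : avg (fun x => f x + g x) = fun x => avg f x + avg g x := by
  funext x
  unfold avg
  rw [← add_div, ← Finset.sum_add_distrib]
  congr 1
  exact Finset.sum_congr rfl fun i _ => by ring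

lemma avg_const_mul (c : ℝ) (f : Zd d → ℝ) : avg (fun x => c * f x) = fun x => c * avg f x := by
  funext x
  unfold avg
  rw [mul_div_assoc', Finset.mul_sum]
  congr 1
  exact Finset.sum_congr rfl fun i _ => by ring

lemma avg_sub (f g : Zd d → ℝ) : avg (fun x => f x - g x) = fun x => avg f x - avg g x := by
  funext x
  unfold avg
  rw [← sub_div, ← Finset.sum_sub_distrib]
  congr 1
  exact Finset.sum_congr rfl fun i _ => by ring

lemma avg_const (hd : 0 < d) (c : ℝ) : avg (fun _ : Zd d => c) = fun _ => c := by
  funext x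
  unfold avg
  have : (d : ℝ) ≠ 0 := by positivity
  simp
  field_simp
  ring

lemma avg_sum {ι : Type*} (s : Finset ι) (f : ι → Zd d → ℝ) :
    avg (fun x => ∑ i ∈ s, f i x) = fun x => ∑ i ∈ s, avg (f i) x := by
  funext x
  unfold avg
  rw [← Finset.sum_div, Finset.sum_comm]
  congr 1
  exact Finset.sum_congr rfl fun i _ => by rw [Finset.sum_add_distrib]

lemma avg_translate (f : Zd d → ℝ) (v : Zd d) :
    avg (fun x => f (x + v)) = fun x => avg f (x + v) := by
  funext x
  unfold avg
  congr 1
  exact Finset.sum_congr rfl fun i _ => by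
    simp only [add_right_comm x _ v, sub_add_eq_add_sub]

lemma avg_reflect (f : Zd d → ℝ) (v : Zd d) :
    avg (fun x => f (v - x)) = fun x => avg f (v - x) := by
  funext x
  unfold avg
  congr 1
  exact Finset.sum_congr rfl fun i _ => by
    rw [add_comm (f _), sub_add, sub_sub]

lemma avgN_mono {f g : Zd d → ℝ} (h : ∀ x, f x ≤ g x) (n : ℕ) (x : Zd d) :
    avg^[n] f x ≤ avg^[n] g x := by
  induction n generalizing f g x with
  | zero => exact h x
  | succ n ih => exact ih (avg_mono h) x

lemma avgN_succ (f : Zd d → ℝ) (n : ℕ) (x : Zd d) : avg^[n+1] f x = avg (avg^[n] f) x := by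
  rw [Function.iterate_succ_apply']

lemma avgN_const (hd : 0 < d) (n : ℕ) (c : ℝ) : avg^[n] (fun _ : Zd d => c) = fun _ => c := by
  induction n with
  | zero => rfl
  | succ n ih => rw [Function.iterate_succ_apply', ih, avg_const hd]

lemma avgN_nonneg (hd : 0 < d) {f : Zd d → ℝ} (h : ∀ x, 0 ≤ f x) (n : ℕ) (x : Zd d) :
    0 ≤ avg^[n] f x := by
  have := avgN_mono h n x
  rwa [avgN_const hd] at this

lemma avgN_add (n : ℕ) (f g : Zd d → ℝ) :
    avg^[n] (fun x => f x + g x) = fun x => avg^[n] f x + avg^[n] g x := by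
  induction n with
  | zero => rfl
  | succ n ih => simp_rw [Function.iterate_succ_apply', ih, avg_add]

lemma avgN_sub (n : ℕ) (f g : Zd d → ℝ) :
    avg^[n] (fun x => f x - g x) = fun x => avg^[n] f x - avg^[n] g x := by
  induction n with
  | zero => rfl
  | succ n ih => simp_rw [Function.iterate_succ_apply', ih, avg_sub]

lemma avgN_const_mul (n : ℕ) (c : ℝ) (f : Zd d → ℝ) :
    avg^[n] (fun x => c * f x) = fun x => c * avg^[n] f x := by
  induction n with
  | zero => rfl
  | succ n ih => simp_rw [Function.iterate_succ_apply', ih, avg_const_mul]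

lemma avgN_sum {ι : Type*} (n : ℕ) (s : Finset ι) (f : ι → Zd d → ℝ) :
    avg^[n] (fun x => ∑ i ∈ s, f i x) = fun x => ∑ i ∈ s, avg^[n] (f i) x := by
  induction n with
  | zero => rfl
  | succ n ih => simp_rw [Function.iterate_succ_apply', ih, avg_sum]

lemma avgN_translate (n : ℕ) (f : Zd d → ℝ) (v : Zd d) :
    avg^[n] (fun x => f (x + v)) = fun x => avg^[n] f (x + v) := by
  induction n with
  | zero => rfl
  | succ n ih => simp_rw [Function.iterate_succ_apply', ih, avg_translate]

lemma avgN_reflect (n : ℕ) (f : Zd d → ℝ) (v : Zd d) :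
    avg^[n] (fun x => f (v - x)) = fun x => avg^[n] f (v - x) := by
  induction n with
  | zero => rfl
  | succ n ih => simp_rw [Function.iterate_succ_apply', ih, avg_reflect]

/-- Transition probabilities of the walk. -/
def pn (n : ℕ) (x y : Zd d) : ℝ := avg^[n] (fun z => if z = y then 1 else 0) x

lemma pn_nonneg (hd : 0 < d) (n : ℕ) (x y : Zd d) : 0 ≤ pn n x y :=
  avgN_nonneg hd (fun z => by split_ifs <;> norm_num) n x

lemma pn_translate (n : ℕ) (x y v : Zd d) : pn n (x + v) (y + v) = pn n x y := by
  unfold pn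
  rw [← congrFun (avgN_translate n (fun z => if z = y + v then (1:ℝ) else 0) v) x]
  simp

lemma pn_symm (n : ℕ) (x y : Zd d) : pn n x y = pn n y x := by
  have h := congrFun (avgN_reflect n (fun z => if z = x then (1:ℝ) else 0) (x + y)) x
  unfold pn
  simp only [add_sub_cancel_left] at h
  rw [← h]
  have h' : ∀ z, z = y ↔ x + y - z = x := fun z =>
    ⟨by rintro rfl; simp, fun h => by simpa using congrArg (fun w => x + y - w) h⟩
  simp only [h']

/-- Prepend the point `x` to a trajectory. -/
def cons {V : Type} (x : V) (ω : ℕ → V) : ℕ → V := fun n => if n = 0 then x else ω (n - 1)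

@[simp] lemma cons_zero {V : Type} (x : V) (ω : ℕ → V) : cons x ω 0 = x := rfl

@[simp] lemma cons_succ {V : Type} (x : V) (ω : ℕ → V) (n : ℕ) : cons x ω (n + 1) = ω n := by
  simp [cons]

lemma measurable_cons (x : Zd d) : Measurable (cons x) := by
  refine measurable_pi_lambda _ fun n => ?_
  rcases n with _ | n
  · exact measurable_const
  · simpa using measurable_pi_apply n

lemma measurableSet_eval_eq (n : ℕ) (y : Zd d) : MeasurableSet {ω : ℕ → Zd d | ω n = y} :=
  measurableSet_eq_fun (measurable_pi_apply n) measurable_const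

lemma measurable_shift (n : ℕ) : Measurable (fun (ω : ℕ → Zd d) m => ω (n + m)) :=
  measurable_pi_lambda _ fun _ => measurable_pi_apply _

/-- The unit neighbour vectors of `ℤ^d`. -/
def nbr (q : Fin d × Bool) : Zd d := if q.2 then Pi.single q.1 1 else - Pi.single q.1 1

lemma nbr_injective : Function.Injective (nbr (d := d)) := by
  rintro ⟨i, a⟩ ⟨j, b⟩ h
  have h1 := congrFun h i
  have h2 := congrFun h j
  by_cases hij : i = j
  · subst hij
    cases a <;> cases b <;> simp [nbr] at h1 ⊢
  · exfalso
    cases a <;> cases b <;> simp [nbr, hij] at h1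

lemma adjZ_iff (x y : Zd d) : adjZ x y ↔ ∃ q, x + nbr q = y := by
  constructor
  · intro h
    unfold adjZ at h
    have hex : ∃ i, x i - y i ≠ 0 := by
      by_contra hcon
      push Not at hcon
      simp [hcon] at h
    obtain ⟨i, hi⟩ := hex
    have hs := Finset.add_sum_erase Finset.univ (fun i => |x i - y i|) (Finset.mem_univ i)
    have hnn : 0 ≤ ∑ j ∈ Finset.univ.erase i, |x j - y j| :=
      Finset.sum_nonneg fun _ _ => abs_nonneg _
    have h1 : 1 ≤ |x i - y i| := Int.one_le_abs hi
    have h0 : ∑ j ∈ Finset.univ.erase i, |x j - y j| = 0 := by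
      omega
    have hi1 : |x i - y i| = 1 := by omega
    have hz : ∀ j, j ≠ i → x j = y j := fun j hj => by
      have := (Finset.sum_eq_zero_iff_of_nonneg (fun _ _ => abs_nonneg _)).1 h0 j (by simp [hj])
      rw [abs_eq_zero] at this
      omega
    rcases (abs_eq (by norm_num)).1 hi1 with h' | h'
    · refine ⟨(i, false), ?_⟩
      funext j
      by_cases hj : j = i
      · subst hj; simp [nbr]; omega
      · simp [nbr, hj, hz j hj]
    · refine ⟨(i, true), ?_⟩
      funext j
      by_cases hj : j = i
      · subst hj; simp [nbr]; omega
      · simp [nbr, hj, hz j hj]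
  · rintro ⟨⟨i, b⟩, rfl⟩
    unfold adjZ
    rw [Finset.sum_eq_single i]
    · cases b <;> simp [nbr]
    · intro j _ hj
      cases b <;> simp [nbr, hj]
    · simp

section Law

variable {P : Zd d → Measure (ℕ → Zd d)}

lemma WalkLaw.ae_start (hW : WalkLaw d P) (x : Zd d) : ∀ᵐ ω ∂(P x), ω 0 = x := by
  have := hW.prob x
  have hm : MeasurableSet {ω : ℕ → Zd d | ω 0 = x} := measurableSet_eval_eq 0 x
  exact (prob_compl_eq_zero_iff hm).2 (hW.start x)

lemma WalkLaw.law_eq (hW : WalkLaw d P) (hd : 0 < d) (x : Zd d) :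
    P x = ∑ q : Fin d × Bool, (2 * d : ℝ≥0∞)⁻¹ • (P (x + nbr q)).map (cons x) := by
  ext S hS
  set S' : Set (ℕ → Zd d) := cons x ⁻¹' S with hS'
  have hS'm : MeasurableSet S' := measurable_cons x hS
  have h1 : P x S = P x {ω | (fun n => ω (1 + n)) ∈ S'} := by
    apply measure_congr
    filter_upwards [hW.ae_start x] with ω hω
    have : cons x (fun n => ω (1 + n)) = ω := by
      funext n
      rcases n with _ | n
      · simp [hω]
      · simp [add_comm]
    apply propext
    show ω ∈ S ↔ cons x (fun n => ω (1 + n)) ∈ S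
    rw [this]
  have h2 : {ω : ℕ → Zd d | (fun n => ω (1 + n)) ∈ S'}
      = ⋃ y : Zd d, ({ω | ω 1 = y} ∩ {ω | (fun n => ω (1 + n)) ∈ S'}) := by
    ext ω; simp
  have hm1 : ∀ y : Zd d, MeasurableSet {ω : ℕ → Zd d | ω 1 = y} := fun y =>
    measurableSet_eval_eq 1 y
  rw [h1, h2, measure_iUnion]
  · simp_rw [hW.markov x _ 1 S' hS'm, hW.step]
    have hinj : Function.Injective (fun q : Fin d × Bool => x + nbr q) :=
      (add_right_injective x).comp nbr_injective
    rw [← hinj.tsum_eq, tsum_fintype, Measure.finsetSum_apply]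
    · refine Finset.sum_congr rfl fun q _ => ?_
      rw [if_pos ((adjZ_iff _ _).2 ⟨q, rfl⟩), Measure.smul_apply,
        Measure.map_apply (measurable_cons x) hS, smul_eq_mul]
      congr 1
      rw [one_div, ENNReal.ofReal_inv_of_pos (by positivity), ENNReal.ofReal_mul (by norm_num)]
      simp
    · intro y hy
      simp only [Function.mem_support, ne_eq, mul_eq_zero, not_or] at hy
      by_contra hcon
      apply hy.1
      rw [if_neg]
      · simp
      · intro hadj
        obtain ⟨q, hq⟩ := (adjZ_iff _ _).1 hadj
        exact hcon ⟨q, hq⟩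
  · intro y z hyz
    refine Set.disjoint_left.2 ?_
    rintro ω ⟨h, _⟩ ⟨h', _⟩
    exact hyz (h.symm.trans h')
  · intro y
    exact (hm1 y).inter (measurable_shift 1 hS'm)

lemma sum_nbr {M : Type*} [AddCommMonoid M] (F : Zd d → M) (x : Zd d) :
    ∑ q : Fin d × Bool, F (x + nbr q)
      = ∑ i : Fin d, (F (x + Pi.single i 1) + F (x - Pi.single i 1)) := by
  rw [Fintype.sum_prod_type]
  refine Finset.sum_congr rfl fun i _ => ?_
  simp [nbr, sub_eq_add_neg]

lemma avg_eq_sum_nbr (f : Zd d → ℝ) (x : Zd d) :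
    avg f x = ∑ q : Fin d × Bool, (2 * d : ℝ)⁻¹ * f (x + nbr q) := by
  rw [← Finset.mul_sum, sum_nbr, avg, div_eq_inv_mul]

lemma WalkLaw.real_one_step (hW : WalkLaw d P) (hd : 0 < d) (x : Zd d) {S : Set (ℕ → Zd d)}
    (hS : MeasurableSet S) :
    (P x).real S = avg (fun y => (P y).real (cons x ⁻¹' S)) x := by
  have := hW.prob
  rw [avg_eq_sum_nbr]
  unfold Measure.real
  conv_lhs => rw [hW.law_eq hd x]
  rw [Measure.finsetSum_apply, ENNReal.toReal_sum]
  · refine Finset.sum_congr rfl fun q _ => ?_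
    rw [Measure.smul_apply, Measure.map_apply (measurable_cons x) hS, smul_eq_mul,
      ENNReal.toReal_mul]
    simp
  · intro q _
    rw [Measure.smul_apply, Measure.map_apply (measurable_cons x) hS, smul_eq_mul]
    refine ENNReal.mul_ne_top (ENNReal.inv_ne_top.2 ?_) (measure_ne_top _ _)
    simp; omega

lemma WalkLaw.lintegral_one_step (hW : WalkLaw d P) (hd : 0 < d) (x : Zd d)
    {F : (ℕ → Zd d) → ℝ≥0∞} (hF : Measurable F) :
    ∫⁻ ω, F ω ∂(P x)
      = ∑ q : Fin d × Bool, (2 * d : ℝ≥0∞)⁻¹ * ∫⁻ ω, F (cons x ω) ∂(P (x + nbr q)) := by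
  conv_lhs => rw [hW.law_eq hd x]
  rw [lintegral_finsetSum_measure]
  refine Finset.sum_congr rfl fun q _ => ?_
  rw [lintegral_smul_measure, lintegral_map hF (measurable_cons x), smul_eq_mul]

lemma measurable_eval_fun {β : Type*} [MeasurableSpace β] (F : Zd d → β) (n : ℕ) :
    Measurable fun ω : ℕ → Zd d => F (ω n) :=
  (measurable_of_countable F).comp (measurable_pi_apply n)

lemma WalkLaw.lintegral_eval (hW : WalkLaw d P) (hd : 0 < d) {φ : Zd d → ℝ} (hφ : ∀ x, 0 ≤ φ x)
    (n : ℕ) (x : Zd d) :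
    ∫⁻ ω, ENNReal.ofReal (φ (ω n)) ∂(P x) = ENNReal.ofReal (avg^[n] φ x) := by
  have := hW.prob
  induction n generalizing x with
  | zero =>
    rw [lintegral_congr_ae (g := fun _ => ENNReal.ofReal (φ x))]
    · simp
    · filter_upwards [hW.ae_start x] with ω hω
      rw [hω]
  | succ n ih =>
    rw [hW.lintegral_one_step hd x (measurable_eval_fun (fun y => ENNReal.ofReal (φ y)) (n+1))]
    simp_rw [cons_succ, ih]
    rw [avgN_succ, avg_eq_sum_nbr, ENNReal.ofReal_sum_of_nonneg]
    · refine Finset.sum_congr rfl fun q _ => ?_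
      rw [ENNReal.ofReal_mul (by positivity), ENNReal.ofReal_inv_of_pos (by positivity),
        ENNReal.ofReal_mul (by norm_num)]
      simp
    · intro q _
      have := avgN_nonneg hd hφ n (x + nbr q)
      positivity

lemma WalkLaw.prob_eval (hW : WalkLaw d P) (hd : 0 < d) (n : ℕ) (x y : Zd d) :
    P x {ω | ω n = y} = ENNReal.ofReal (pn n x y) := by
  unfold pn
  rw [← hW.lintegral_eval hd (fun z => by split_ifs <;> norm_num)]
  rw [← lintegral_indicator_one (measurableSet_eval_eq n y)]
  refine lintegral_congr fun ω => ?_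
  by_cases h : ω n = y <;> simp [Set.indicator, h]

/-- The event `F` depends only on the trajectory up to time `n`. -/
def DetBy {V : Type} (n : ℕ) (F : Set (ℕ → V)) : Prop :=
  ∀ ω ω' : ℕ → V, (∀ i ≤ n, ω i = ω' i) → (ω ∈ F ↔ ω' ∈ F)

lemma DetBy.measurableSet {n : ℕ} {F : Set (ℕ → Zd d)} (h : DetBy n F) : MeasurableSet F := by
  let r : (ℕ → Zd d) → (Fin (n + 1) → Zd d) := fun ω i => ω i
  have hr : Measurable r := measurable_pi_lambda _ fun _ => measurable_pi_apply _
  have : F = r ⁻¹' (r '' F) := by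
    ext ω
    constructor
    · intro hω; exact ⟨ω, hω, rfl⟩
    · rintro ⟨ω', hω', he⟩
      refine (h ω' ω fun i hi => ?_).1 hω'
      exact congrFun he ⟨i, by omega⟩
  rw [this]
  exact hr (Set.to_countable _).measurableSet

lemma measurableSet_shift_mem (n : ℕ) {V : Zd d → Set (ℕ → Zd d)}
    (hV : ∀ z, MeasurableSet (V z)) :
    MeasurableSet {ω : ℕ → Zd d | (fun m => ω (n + m)) ∈ V (ω n)} := by
  have : {ω : ℕ → Zd d | (fun m => ω (n + m)) ∈ V (ω n)}
      = ⋃ z, ({ω | ω n = z} ∩ {ω | (fun m => ω (n + m)) ∈ V z}) := by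
    ext ω; simp
  rw [this]
  exact MeasurableSet.iUnion fun z =>
    (measurableSet_eval_eq n z).inter (measurable_shift n (hV z))

lemma WalkLaw.markov_past_le (hW : WalkLaw d P) (hd : 0 < d) {V : Zd d → Set (ℕ → Zd d)}
    (hV : ∀ z, MeasurableSet (V z)) {ε : ℝ} (hε : 0 ≤ ε) (hVε : ∀ z, (P z).real (V z) ≤ ε) (n : ℕ)
    {F : Set (ℕ → Zd d)} (hF : DetBy n F) (x : Zd d) :
    (P x).real (F ∩ {ω | (fun m => ω (n + m)) ∈ V (ω n)}) ≤ ε * (P x).real F := by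
  have := hW.prob
  induction n generalizing F x with
  | zero =>
    by_cases hx : (fun _ => x) ∈ F
    · have h1 : (P x).real F = 1 := by
        rw [← probReal_univ (μ := P x)]
        apply measureReal_congr
        filter_upwards [hW.ae_start x] with ω hω
        apply propext
        exact ⟨fun _ => trivial, fun _ => (hF (fun _ => x) ω (by simp [hω])).1 hx⟩
      rw [h1, mul_one]
      refine le_trans ?_ (hVε x)
      unfold Measure.real
      refine ENNReal.toReal_mono (measure_ne_top _ _) (measure_mono_ae ?_)
      filter_upwards [hW.ae_start x] with ω hω
      rintro ⟨_, h⟩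
      have h' : (fun m => ω (0 + m)) ∈ V (ω 0) := h
      simp only [hω, zero_add] at h'
      exact h'
    · have h1 : (P x).real (F ∩ {ω | (fun m => ω (0 + m)) ∈ V (ω 0)}) = 0 := by
        unfold Measure.real
        rw [measure_eq_zero_iff_ae_notMem.2, ENNReal.toReal_zero]
        filter_upwards [hW.ae_start x] with ω hω
        rintro ⟨h, _⟩
        exact hx ((hF (fun _ => x) ω (by simp [hω])).2 h)
      rw [h1]
      positivity
  | succ n ih =>
    have hmF := hF.measurableSet
    rw [hW.real_one_step hd x (hmF.inter (measurableSet_shift_mem _ hV)),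
      hW.real_one_step hd x hmF, ← congrFun (avg_const_mul ε _) x]
    refine avg_mono (fun y => ?_) x
    have hF' : DetBy n (cons x ⁻¹' F) := by
      intro ω ω' h
      refine hF _ _ fun i hi => ?_
      rcases i with _ | i
      · rfl
      · simpa using h i (by omega)
    refine le_trans (le_of_eq ?_) (ih hF' y)
    congr 1
    ext ω
    simp only [Set.mem_preimage, Set.mem_inter_iff, Set.mem_ofPred_eq]
    have : (fun m => cons x ω (n + 1 + m)) = fun m => ω (n + m) := by
      funext m
      rw [show n + 1 + m = (n + m) + 1 by ring, cons_succ]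
    rw [this, cons_succ]

end Law

/-- The squared Euclidean norm. -/
def nsq (x : Zd d) : ℝ := ∑ i, (x i : ℝ) ^ 2

lemma nsq_nonneg (x : Zd d) : 0 ≤ nsq x := Finset.sum_nonneg fun _ _ => sq_nonneg _

@[simp] lemma nsq_zero : nsq (0 : Zd d) = 0 := by simp [nsq]

lemma nsq_add_single (x : Zd d) (i : Fin d) :
    nsq (x + Pi.single i 1) = nsq x + 1 + 2 * x i := by
  unfold nsq
  rw [← Finset.add_sum_erase _ _ (Finset.mem_univ i),
    ← Finset.add_sum_erase _ (fun i => (x i : ℝ) ^ 2) (Finset.mem_univ i)]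
  rw [Finset.sum_congr rfl (g := fun j => (x j : ℝ) ^ 2)]
  · simp; ring
  · intro j hj
    simp [Finset.ne_of_mem_erase hj]

lemma nsq_sub_single (x : Zd d) (i : Fin d) :
    nsq (x - Pi.single i 1) = nsq x + 1 - 2 * x i := by
  unfold nsq
  rw [← Finset.add_sum_erase _ _ (Finset.mem_univ i),
    ← Finset.add_sum_erase _ (fun i => (x i : ℝ) ^ 2) (Finset.mem_univ i)]
  rw [Finset.sum_congr rfl (g := fun j => (x j : ℝ) ^ 2)]
  · simp; ring
  · intro j hj
    simp [Finset.ne_of_mem_erase hj]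

lemma avg_radial (φ : ℝ → ℝ) (x : Zd d) :
    avg (fun y => φ (nsq y)) x
      = (∑ i : Fin d, (φ (nsq x + 1 + 2 * x i) + φ (nsq x + 1 - 2 * x i))) / (2 * d) := by
  unfold avg
  simp_rw [nsq_add_single, nsq_sub_single]

/-- The regularised squared norm. -/
def reg (x : Zd d) : ℝ := nsq x + 2000

lemma le_reg (x : Zd d) : 2000 ≤ reg x := by unfold reg; linarith [nsq_nonneg x]

lemma reg_pos (x : Zd d) : 0 < reg x := by linarith [le_reg x]

/-- Radial averages are controlled by fourth order Taylor polynomials. -/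
lemma avg_taylor_le (hd : 0 < d) {Φ : ℝ → ℝ} {c₀ c₁ c₂ c₃ c₄ : ℝ} (hc : 0 ≤ c₄)
    (h : ∀ z, |z| ≤ 1 / 4 → Φ z ≤ c₀ + c₁ * z + c₂ * z ^ 2 + c₃ * z ^ 3 + c₄ * z ^ 4) (x : Zd d) :
    (∑ i : Fin d, (Φ ((1 + 2 * x i) / reg x) + Φ ((1 - 2 * x i) / reg x))) / (2 * d)
      ≤ c₀ + c₁ / reg x + c₂ * (1 + 4 * nsq x / d) / reg x ^ 2
        + c₃ * (1 + 12 * nsq x / d) / reg x ^ 3 + c₄ * (136 / reg x ^ 2) := by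
  have hu := le_reg x
  have hu0 := reg_pos x
  have hd' : (0 : ℝ) < d := by exact_mod_cast hd
  set u := reg x with hudef
  have hxi : ∀ i, ((x i : ℝ)) ^ 2 ≤ u := fun i => by
    have : (x i : ℝ) ^ 2 ≤ nsq x :=
      Finset.single_le_sum (f := fun i => (x i : ℝ) ^ 2) (fun _ _ => sq_nonneg _) (Finset.mem_univ i)
    rw [hudef, reg]; linarith
  have hb : ∀ b : ℝ, b ^ 2 ≤ 4 * u → |(1 + b) / u| ≤ 1 / 4 := fun b hb => by
    rw [abs_div, abs_of_pos hu0, div_le_iff₀ hu0]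
    apply abs_le_of_sq_le_sq' _ (by positivity) |> abs_le.2
    nlinarith [sq_nonneg (b - u / 100)]
  have h4 : ∀ b : ℝ, b ^ 2 ≤ 4 * u → ((1 + b) / u) ^ 4 ≤ 136 / u ^ 2 := fun b hb => by
    rw [div_pow, div_le_div_iff₀ (by positivity) (by positivity)]
    have h1 : (1 + b) ^ 2 ≤ 2 * (1 + b ^ 2) := by nlinarith [sq_nonneg (1 - b)]
    have h2 : (1 + b) ^ 2 ≤ 11 * u := by nlinarith
    have h3 : (1 + b) ^ 4 ≤ 136 * u ^ 2 := by
      have := pow_le_pow_left₀ (sq_nonneg (1 + b)) h2 2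
      nlinarith
    calc (1 + b) ^ 4 * u ^ 2 ≤ 136 * u ^ 2 * u ^ 2 := by gcongr
      _ = 136 * u ^ 4 := by ring
  have hpt : ∀ b : ℝ, b ^ 2 ≤ 4 * u → Φ ((1 + b) / u) ≤
      c₀ + c₁ * ((1 + b) / u) + c₂ * ((1 + b) / u) ^ 2 + c₃ * ((1 + b) / u) ^ 3
        + c₄ * (136 / u ^ 2) := fun b hb' => by
    have := h _ (hb b hb')
    have := mul_le_mul_of_nonneg_left (h4 b hb') hc
    linarith
  have hsum : ∀ i ∈ Finset.univ, Φ ((1 + 2 * x i) / u) + Φ ((1 - 2 * x i) / u) ≤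
      (2 * c₀ + 2 * c₁ / u + 2 * c₂ / u ^ 2 + 2 * c₃ / u ^ 3 + 2 * c₄ * (136 / u ^ 2))
        + (8 * c₂ / u ^ 2 + 24 * c₃ / u ^ 3) * (x i : ℝ) ^ 2 := fun i _ => by
    have h1 := hpt (2 * x i) (by nlinarith [hxi i])
    have h2 := hpt (-(2 * x i)) (by nlinarith [hxi i])
    rw [← sub_eq_add_neg] at h2
    refine (add_le_add h1 h2).trans (le_of_eq ?_)
    field_simp
    ring
  rw [div_le_iff₀ (by positivity)]
  refine (Finset.sum_le_sum hsum).trans (le_of_eq ?_)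
  rw [Finset.sum_add_distrib, ← Finset.mul_sum]
  change _ + _ * nsq x = _
  simp only [Finset.sum_const, Finset.card_univ, Fintype.card_fin, nsmul_eq_mul]
  field_simp
  ring

lemma le_avg_taylor (hd : 0 < d) {Φ : ℝ → ℝ} {c₀ c₁ c₂ c₃ c₄ : ℝ} (hc : 0 ≤ c₄)
    (h : ∀ z, |z| ≤ 1 / 4 → c₀ + c₁ * z + c₂ * z ^ 2 + c₃ * z ^ 3 - c₄ * z ^ 4 ≤ Φ z) (x : Zd d) :
    c₀ + c₁ / reg x + c₂ * (1 + 4 * nsq x / d) / reg x ^ 2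
        + c₃ * (1 + 12 * nsq x / d) / reg x ^ 3 - c₄ * (136 / reg x ^ 2) ≤
    (∑ i : Fin d, (Φ ((1 + 2 * x i) / reg x) + Φ ((1 - 2 * x i) / reg x))) / (2 * d) := by
  have := avg_taylor_le hd (Φ := fun z => - Φ z) (c₀ := -c₀) (c₁ := -c₁) (c₂ := -c₂) (c₃ := -c₃)
    hc (fun z hz => by linarith [h z hz]) x
  simp_rw [← neg_add, Finset.sum_neg_distrib, neg_div, neg_mul, neg_div] at this
  linarith

lemma reg_split (x : Zd d) (b : ℝ) :
    nsq x + 1 + b + 2000 = reg x * (1 + (1 + b) / reg x) := by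
  have := reg_pos x
  field_simp
  rw [reg]; ring

lemma abs_one_add_pos {z : ℝ} (hz : |z| ≤ 1 / 4) : 3 / 4 ≤ 1 + z ∧ 1 + z ≤ 5 / 4 := by
  rw [abs_le] at hz; constructor <;> linarith

lemma avg_scaled {g : ℝ → ℝ} (hg : ∀ a b, 0 < a → g (a * b) = g a * g b) (x : Zd d) :
    avg (fun y => g (reg y)) x
      = g (reg x) * ((∑ i : Fin d, (g (1 + (1 + 2 * x i) / reg x) + g (1 + (1 - 2 * x i) / reg x)))
          / (2 * d)) := by
  have := avg_radial (fun v => g (v + 2000)) x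
  change avg (fun y => g (nsq y + 2000)) x = _
  rw [this, ← mul_div_assoc, Finset.mul_sum]
  congr 1
  refine Finset.sum_congr rfl fun i _ => ?_
  rw [reg_split, sub_eq_add_neg, reg_split, hg _ _ (reg_pos x), hg _ _ (reg_pos x), mul_add,
    ← sub_eq_add_neg]

/-- `|x|⁻¹`, regularised at the origin. -/
def f3 (x : Zd d) : ℝ := (Real.sqrt (reg x))⁻¹

/-- `|x|⁻²`, regularised at the origin. -/
def f4 (x : Zd d) : ℝ := (reg x)⁻¹

lemma f3_pos (x : Zd d) : 0 < f3 x := inv_pos.2 (Real.sqrt_pos.2 (reg_pos x))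

lemma f4_pos (x : Zd d) : 0 < f4 x := inv_pos.2 (reg_pos x)

lemma inv_sqrt_bounds {z : ℝ} (hz : |z| ≤ 1 / 4) :
    1 - z / 2 + 3 / 8 * z ^ 2 - 5 / 16 * z ^ 3 ≤ (Real.sqrt (1 + z))⁻¹ ∧
    (Real.sqrt (1 + z))⁻¹ ≤ 1 - z / 2 + 3 / 8 * z ^ 2 - 5 / 16 * z ^ 3 + z ^ 4 := by
  obtain ⟨h1, h2⟩ := abs_one_add_pos hz
  have hz' := abs_le.1 hz
  have hz2 : z ^ 2 ≤ 1 / 16 := by nlinarith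
  have hs : 0 < Real.sqrt (1 + z) := Real.sqrt_pos.2 (by linarith)
  have hq := Real.sq_sqrt (show 0 ≤ 1 + z by linarith)
  have hT : 0 < 1 - z / 2 + 3 / 8 * z ^ 2 - 5 / 16 * z ^ 3 := by nlinarith [sq_nonneg z]
  have hz4 : 0 ≤ z ^ 4 := by positivity
  constructor
  · rw [← one_div, le_div_iff₀ hs]
    refine abs_le_one_iff_mul_self_le_one.2 ?_ |> le_of_abs_le
    have : (1 - z / 2 + 3 / 8 * z ^ 2 - 5 / 16 * z ^ 3) ^ 2 * (1 + z) ≤ 1 := by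
      have : 1 - (1 - z / 2 + 3 / 8 * z ^ 2 - 5 / 16 * z ^ 3) ^ 2 * (1 + z)
        = z ^ 4 * (35 / 64 - 7 / 32 * z + 35 / 256 * z ^ 2 - 25 / 256 * z ^ 3) := by ring
      have h3 : 0 ≤ 35 / 64 - 7 / 32 * z + 35 / 256 * z ^ 2 - 25 / 256 * z ^ 3 := by
        nlinarith [sq_nonneg z]
      have := mul_nonneg hz4 h3
      linarith
    calc _ = (1 - z / 2 + 3 / 8 * z ^ 2 - 5 / 16 * z ^ 3) ^ 2 * Real.sqrt (1 + z) ^ 2 := by ring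
      _ ≤ 1 := by rw [hq]; exact this
  · rw [← one_div, div_le_iff₀ hs]
    by_contra hcon
    push Not at hcon
    have h3 : ((1 - z / 2 + 3 / 8 * z ^ 2 - 5 / 16 * z ^ 3 + z ^ 4) * Real.sqrt (1 + z)) ^ 2 < 1 := by
      apply pow_lt_one₀ _ hcon (by norm_num)
      positivity
    rw [mul_pow, hq] at h3
    have h4 : (1 - z / 2 + 3 / 8 * z ^ 2 - 5 / 16 * z ^ 3 + z ^ 4) ^ 2 * (1 + z) - 1
      = z ^ 4 * (-(35 / 64 - 7 / 32 * z + 35 / 256 * z ^ 2 - 25 / 256 * z ^ 3)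
        + (1 + z) * (2 * (1 - z / 2 + 3 / 8 * z ^ 2 - 5 / 16 * z ^ 3) + z ^ 4)) := by ring
    have h5 : 0 ≤ (-(35 / 64 - 7 / 32 * z + 35 / 256 * z ^ 2 - 25 / 256 * z ^ 3)
        + (1 + z) * (2 * (1 - z / 2 + 3 / 8 * z ^ 2 - 5 / 16 * z ^ 3) + z ^ 4)) := by
      have hT2 : 4 / 5 ≤ 1 - z / 2 + 3 / 8 * z ^ 2 - 5 / 16 * z ^ 3 := by nlinarith [sq_nonneg z]
      have : (3 / 4) * (8 / 5) ≤ (1 + z) * (2 * (1 - z / 2 + 3 / 8 * z ^ 2 - 5 / 16 * z ^ 3) + z ^ 4) := by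
        gcongr; linarith
      nlinarith [sq_nonneg z]
    have := mul_nonneg hz4 h5
    linarith

lemma sqrt_lower {z : ℝ} (hz : |z| ≤ 1 / 4) :
    1 + z / 2 - z ^ 2 / 8 + z ^ 3 / 16 - z ^ 4 ≤ Real.sqrt (1 + z) := by
  obtain ⟨h1, h2⟩ := abs_one_add_pos hz
  have hz' := abs_le.1 hz
  have hz2 : z ^ 2 ≤ 1 / 16 := by nlinarith
  have hz4 : 0 ≤ z ^ 4 := by positivity
  apply Real.le_sqrt_of_sq_le
  have h4 : 1 + z - (1 + z / 2 - z ^ 2 / 8 + z ^ 3 / 16 - z ^ 4) ^ 2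
    = z ^ 4 * (2 - 5 / 64 + z + z / 64 - z ^ 2 / 4 - z ^ 2 / 256 + z ^ 3 / 8 - z ^ 4) := by ring
  have h5 : 0 ≤ 2 - 5 / 64 + z + z / 64 - z ^ 2 / 4 - z ^ 2 / 256 + z ^ 3 / 8 - z ^ 4 := by
    nlinarith [sq_nonneg z]
  have := mul_nonneg hz4 h5
  linarith

lemma inv_bounds {z : ℝ} (hz : |z| ≤ 1 / 4) :
    1 - z + z ^ 2 - z ^ 3 ≤ (1 + z)⁻¹ ∧ (1 + z)⁻¹ ≤ 1 - z + z ^ 2 - z ^ 3 + 2 * z ^ 4 := by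
  obtain ⟨h1, h2⟩ := abs_one_add_pos hz
  have hz4 : 0 ≤ z ^ 4 := by positivity
  constructor
  · rw [← one_div, le_div_iff₀ (by linarith)]
    nlinarith
  · rw [← one_div, div_le_iff₀ (by linarith)]
    have : (1 - z + z ^ 2 - z ^ 3 + 2 * z ^ 4) * (1 + z) - 1 = z ^ 4 * (1 + 2 * z) := by ring
    have := mul_nonneg hz4 (show 0 ≤ 1 + 2 * z by linarith [(abs_le.1 hz).1])
    linarith

lemma log_lower {z : ℝ} (hz : |z| ≤ 1 / 4) :
    z - z ^ 2 / 2 + z ^ 3 / 3 - 2 * z ^ 4 ≤ Real.log (1 + z) := by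
  have h := Real.abs_log_sub_add_sum_range_le (x := -z) (by rw [abs_neg]; linarith) 3
  rw [abs_neg, sub_neg_eq_add] at h
  have h1 : |z| ^ (3 + 1) / (1 - |z|) ≤ 2 * z ^ 4 := by
    rw [div_le_iff₀ (by linarith)]
    have : |z| ^ (3 + 1) = z ^ 4 := by
      exact (show Even 4 by decide).pow_abs z
    rw [this]
    have hz4 : 0 ≤ z ^ 4 := by positivity
    nlinarith
  have h2 := (abs_le.1 (h.trans h1)).1
  simp [Finset.sum_range_succ] at h2
  norm_num at h2
  linarith

lemma avg_f3_le (hd : 3 ≤ d) (x : Zd d) : avg f3 x ≤ f3 x * (1 - 700 / reg x ^ 2) := by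
  have h := avg_taylor_le (d := d) (by omega) (Φ := fun z => (Real.sqrt (1 + z))⁻¹)
    (c₀ := 1) (c₁ := -1/2) (c₂ := 3 / 8) (c₃ := -5/16) (c₄ := 1) (by norm_num)
    (fun z hz => by have := (inv_sqrt_bounds hz).2; linarith) x
  have h2 := avg_scaled (g := fun a => (Real.sqrt a)⁻¹) (fun a b ha => by
    rw [Real.sqrt_mul ha.le, mul_inv]) x
  change avg f3 x = f3 x * _ at h2
  rw [h2]
  refine mul_le_mul_of_nonneg_left (h.trans ?_) (f3_pos x).le
  have hu := le_reg x
  have hu0 := reg_pos x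
  have hn := nsq_nonneg x
  have hn' : nsq x = reg x - 2000 := by rw [reg]; ring
  have hd' : (3 : ℝ) ≤ d := by exact_mod_cast hd
  have h3 : 4 * nsq x / d ≤ 4 * nsq x / 3 := by gcongr
  have h4 : 0 ≤ 12 * nsq x / d := by positivity
  generalize 12 * nsq x / (d : ℝ) = B at *
  generalize 4 * nsq x / (d : ℝ) = A at *
  generalize reg x = u at *
  have h5 : 3 / 8 * (1 + A) / u ^ 2 ≤ 3 / 8 * (1 + 4 * nsq x / 3) / u ^ 2 := by gcongr
  have h6 : -5 / 16 * (1 + B) / u ^ 3 ≤ 0 := by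
    apply div_nonpos_of_nonpos_of_nonneg <;> [linarith; positivity]
  have h7 : 1 + -1 / 2 / u + 3 / 8 * (1 + 4 * nsq x / 3) / u ^ 2 + 0 + 1 * (136 / u ^ 2)
      ≤ 1 - 700 / u ^ 2 := by
    rw [hn']
    have : 1 - 700 / u ^ 2 - (1 + -1 / 2 / u + 3 / 8 * (1 + 4 * (u - 2000) / 3) / u ^ 2 + 0 + 1 * (136 / u ^ 2)) = (1000 - 700 - 3/8 - 136) / u ^ 2 := by
      field_simp; ring
    have : (0:ℝ) ≤ (1000 - 700 - 3/8 - 136) / u ^ 2 := by norm_num; positivity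
    linarith
  linarith

lemma le_avg_f3 (x : Zd 3) : f3 x * (1 - 2000 / reg x ^ 2) ≤ avg f3 x := by
  have h := le_avg_taylor (d := 3) (by omega) (Φ := fun z => (Real.sqrt (1 + z))⁻¹)
    (c₀ := 1) (c₁ := -1/2) (c₂ := 3 / 8) (c₃ := -5/16) (c₄ := 0) (by norm_num)
    (fun z hz => by have := (inv_sqrt_bounds hz).1; linarith) x
  have h2 := avg_scaled (g := fun a => (Real.sqrt a)⁻¹) (fun a b ha => by
    rw [Real.sqrt_mul ha.le, mul_inv]) x
  change avg f3 x = f3 x * _ at h2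
  rw [h2]
  refine mul_le_mul_of_nonneg_left (le_trans ?_ h) (f3_pos x).le
  have hu := le_reg x
  have hu0 := reg_pos x
  have hn' : nsq x = reg x - 2000 := by rw [reg]; ring
  rw [hn']
  generalize reg x = u at *
  push_cast
  have : 1 + -1 / 2 / u + 3 / 8 * (1 + 4 * (u - 2000) / 3) / u ^ 2 +
      -5 / 16 * (1 + 12 * (u - 2000) / 3) / u ^ 3 - 0 * (136 / u ^ 2) - (1 - 2000 / u ^ 2)
      = ((1000 + 3/8 - 5/4) * u + 5/16 * (8000 - 1)) / u ^ 3 := by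
    field_simp; ring
  have : 0 ≤ ((1000 + 3/8 - 5/4) * u + 5/16 * (8000 - 1)) / u ^ 3 := by
    apply div_nonneg <;> [nlinarith; positivity]
  linarith

lemma avg_f4_le (x : Zd 4) : avg f4 x ≤ f4 x * (1 - 700 / reg x ^ 2) := by
  have h := avg_taylor_le (d := 4) (by omega) (Φ := fun z => (1 + z)⁻¹)
    (c₀ := 1) (c₁ := -1) (c₂ := 1) (c₃ := -1) (c₄ := 2) (by norm_num)
    (fun z hz => by have := (inv_bounds hz).2; linarith) x
  have h2 := avg_scaled (g := fun a => a⁻¹) (fun a b ha => mul_inv a b) x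
  change avg f4 x = f4 x * _ at h2
  rw [h2]
  refine mul_le_mul_of_nonneg_left (h.trans ?_) (f4_pos x).le
  have hu := le_reg x
  have hu0 := reg_pos x
  have hn' : nsq x = reg x - 2000 := by rw [reg]; ring
  rw [hn']
  generalize reg x = u at *
  push_cast
  have : 1 - 700 / u ^ 2 - (1 + -1 / u + 1 * (1 + 4 * (u - 2000) / 4) / u ^ 2 +
      -1 * (1 + 12 * (u - 2000) / 4) / u ^ 3 + 2 * (136 / u ^ 2))
      = ((2000 - 700 - 1 - 272) * u + (1 + 3 * (u - 2000))) / u ^ 3 := by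
    field_simp; ring
  have : 0 ≤ ((2000 - 700 - 1 - 272) * u + (1 + 3 * (u - 2000))) / u ^ 3 := by
    apply div_nonneg <;> [nlinarith; positivity]
  linarith

lemma le_avg_f4 (x : Zd 4) : f4 x * (1 - 3000 / reg x ^ 2) ≤ avg f4 x := by
  have h := le_avg_taylor (d := 4) (by omega) (Φ := fun z => (1 + z)⁻¹)
    (c₀ := 1) (c₁ := -1) (c₂ := 1) (c₃ := -1) (c₄ := 0) (by norm_num)
    (fun z hz => by have := (inv_bounds hz).1; linarith) x
  have h2 := avg_scaled (g := fun a => a⁻¹) (fun a b ha => mul_inv a b) x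
  change avg f4 x = f4 x * _ at h2
  rw [h2]
  refine mul_le_mul_of_nonneg_left (le_trans ?_ h) (f4_pos x).le
  have hu := le_reg x
  have hu0 := reg_pos x
  have hn' : nsq x = reg x - 2000 := by rw [reg]; ring
  rw [hn']
  generalize reg x = u at *
  push_cast
  have : (1 + -1 / u + 1 * (1 + 4 * (u - 2000) / 4) / u ^ 2 +
      -1 * (1 + 12 * (u - 2000) / 4) / u ^ 3 - 0 * (136 / u ^ 2)) - (1 - 3000 / u ^ 2)
      = ((1000 + 1) * u - (1 + 3 * (u - 2000))) / u ^ 3 := by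
    field_simp; ring
  have : 0 ≤ ((1000 + 1) * u - (1 + 3 * (u - 2000))) / u ^ 3 := by
    apply div_nonneg <;> [nlinarith; positivity]
  linarith

lemma avg_sqrt_reg (x : Zd 3) :
    Real.sqrt (reg x) + 1 / 6 * f3 x ≤ avg (fun y => Real.sqrt (reg y)) x := by
  have h := le_avg_taylor (d := 3) (by omega) (Φ := fun z => Real.sqrt (1 + z))
    (c₀ := 1) (c₁ := 1/2) (c₂ := -1 / 8) (c₃ := 1/16) (c₄ := 1) (by norm_num)
    (fun z hz => by have := sqrt_lower hz; linarith) x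
  have h2 := avg_scaled (g := fun a => Real.sqrt a) (fun a b ha => Real.sqrt_mul ha.le b) x
  rw [h2]
  have hu := le_reg x
  have hu0 := reg_pos x
  have hs := Real.sqrt_pos.2 hu0
  have hn' : nsq x = reg x - 2000 := by rw [reg]; ring
  have h3 : 1 / 6 * f3 x = Real.sqrt (reg x) * (1 / (6 * reg x)) := by
    unfold f3
    have := Real.sq_sqrt hu0.le
    field_simp
    linarith
  rw [h3, ← mul_one_add]
  refine mul_le_mul_of_nonneg_left (le_trans ?_ h) hs.le
  rw [hn']
  generalize reg x = u at *
  push_cast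
  have : (1 + 1 / 2 / u + -1 / 8 * (1 + 4 * (u - 2000) / 3) / u ^ 2 +
      1 / 16 * (1 + 12 * (u - 2000) / 3) / u ^ 3 - 1 * (136 / u ^ 2)) - (1 + 1 / (6 * u))
      = (1 / 6 * u ^ 2 + (1000/3 - 1/8 - 136) * u + (1 + 4 * (u - 2000)) / 16) / u ^ 3 := by
    field_simp; ring
  have : 0 ≤ (1 / 6 * u ^ 2 + (1000/3 - 1/8 - 136) * u + (1 + 4 * (u - 2000)) / 16) / u ^ 3 := by
    apply div_nonneg <;> [nlinarith; positivity]
  linarith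

lemma avg_log_reg (x : Zd 4) :
    Real.log (reg x) + 1 / 4 * f4 x ≤ avg (fun y => Real.log (reg y)) x := by
  have h := le_avg_taylor (d := 4) (by omega) (Φ := fun z => Real.log (reg x) + Real.log (1 + z))
    (c₀ := Real.log (reg x)) (c₁ := 1) (c₂ := -1 / 2) (c₃ := 1/3) (c₄ := 2) (by norm_num)
    (fun z hz => by have := log_lower hz; linarith) x
  have hu := le_reg x
  have hu0 := reg_pos x
  have hn' : nsq x = reg x - 2000 := by rw [reg]; ring
  have h2 : avg (fun y => Real.log (reg y)) x = (∑ i : Fin 4,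
      ((Real.log (reg x) + Real.log (1 + (1 + 2 * x i) / reg x))
        + (Real.log (reg x) + Real.log (1 + (1 - 2 * x i) / reg x)))) / (2 * (4 : ℕ)) := by
    have := avg_radial (fun v => Real.log (v + 2000)) x
    change avg (fun y => Real.log (nsq y + 2000)) x = _
    rw [this]
    congr 1
    refine Finset.sum_congr rfl fun i _ => ?_
    have key : ∀ b : ℝ, b ^ 2 ≤ 4 * reg x → 0 < 1 + (1 + b) / reg x := fun b hb => by
      have : 0 < reg x + (1 + b) := by nlinarith [sq_nonneg (b + reg x / 2)]
      have h : 1 + (1 + b) / reg x = (reg x + (1 + b)) / reg x := by field_simp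
      rw [h]; positivity
    have hxi : (x i : ℝ) ^ 2 ≤ nsq x :=
      Finset.single_le_sum (f := fun i => (x i : ℝ) ^ 2) (fun _ _ => sq_nonneg _) (Finset.mem_univ i)
    rw [reg_split, sub_eq_add_neg, reg_split, Real.log_mul hu0.ne' (key _ (by nlinarith)).ne',
      Real.log_mul hu0.ne' (key _ (by nlinarith)).ne', ← sub_eq_add_neg]
  rw [h2]
  refine le_trans ?_ h
  rw [hn', f4]
  generalize Real.log (reg x) = l at *
  generalize reg x = u at *
  push_cast
  have : (l + 1 / u + -1 / 2 * (1 + 4 * (u - 2000) / 4) / u ^ 2 +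
      1 / 3 * (1 + 12 * (u - 2000) / 4) / u ^ 3 - 2 * (136 / u ^ 2)) - (l + 1 / 4 * u⁻¹)
      = (1 / 4 * u ^ 2 + (1000 - 1/2 - 272) * u + (1 + 3 * (u - 2000)) / 3) / u ^ 3 := by
    field_simp; ring
  have : 0 ≤ (1 / 4 * u ^ 2 + (1000 - 1/2 - 272) * u + (1 + 3 * (u - 2000)) / 3) / u ^ 3 := by
    apply div_nonneg <;> [nlinarith; positivity]
  linarith

lemma avg_nsq (hd : 0 < d) : avg (nsq (d := d)) = fun x => nsq x + 1 := by
  funext x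
  have := avg_radial (d := d) (fun v => v) x
  rw [this]
  have hd' : (0 : ℝ) < d := by exact_mod_cast hd
  have : ∀ i ∈ Finset.univ, (nsq x + 1 + 2 * x i) + (nsq x + 1 - 2 * x i) = 2 * (nsq x + 1) :=
    fun i _ => by ring
  rw [Finset.sum_congr rfl this]
  simp
  field_simp

lemma avgN_reg (hd : 0 < d) (n : ℕ) (x : Zd d) : avg^[n] (reg (d := d)) x = reg x + n := by
  induction n generalizing x with
  | zero => simp
  | succ n ih =>
    rw [avgN_succ, show avg^[n] (reg (d := d)) = fun y => nsq y + (2000 + n) by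
      funext y; rw [ih y, reg]; ring]
    rw [avg_add, avg_nsq hd, avg_const hd, reg]
    push_cast; ring

/-- The Green function of the walk. -/
def green (x : Zd d) : ℝ := ∑' n, pn n x 0

lemma sum_avgN_defect (f : Zd d → ℝ) (n : ℕ) (x : Zd d) :
    ∑ k ∈ Finset.range n, avg^[k] (fun y => f y - avg f y) x = f x - avg^[n] f x := by
  have h : ∀ k, avg^[k] (fun y => f y - avg f y) x = avg^[k] f x - avg^[k+1] f x := fun k => by
    rw [avgN_sub, Function.iterate_succ_apply]
  simp_rw [h]
  exact Finset.sum_range_sub' (fun k => avg^[k] f x) n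

lemma sum_pn_mul_le (hd : 0 < d) {f : Zd d → ℝ} (hf : ∀ x, 0 ≤ f x) (hs : ∀ x, avg f x ≤ f x)
    (n : ℕ) (x : Zd d) :
    ∑ k ∈ Finset.range n, pn k x 0 * (f 0 - avg f 0) ≤ f x := by
  calc _ ≤ ∑ k ∈ Finset.range n, avg^[k] (fun y => f y - avg f y) x := by
        refine Finset.sum_le_sum fun k _ => ?_
        rw [mul_comm, pn, ← congrFun (avgN_const_mul k _ _) x]
        refine avgN_mono (fun y => ?_) k x
        split_ifs with h
        · rw [h, mul_one]
        · rw [mul_zero]; linarith [hs y]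
    _ ≤ f x := by
        rw [sum_avgN_defect]
        linarith [avgN_nonneg hd hf n x]

lemma green_bound (hd : 0 < d) {f : Zd d → ℝ} (hf : ∀ x, 0 ≤ f x) (hs : ∀ x, avg f x ≤ f x)
    (h0 : avg f 0 < f 0) (x : Zd d) :
    Summable (fun n => pn n x 0) ∧ green x ≤ (f 0 - avg f 0)⁻¹ * f x := by
  have hpos : 0 < f 0 - avg f 0 := by linarith
  have h : ∀ n, ∑ k ∈ Finset.range n, pn k x 0 ≤ (f 0 - avg f 0)⁻¹ * f x := fun n => by
    have := sum_pn_mul_le hd hf hs n x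
    rw [← Finset.sum_mul] at this
    rw [inv_mul_eq_div, le_div_iff₀ hpos]
    exact this
  have hsum := summable_of_sum_range_le (fun n => pn_nonneg hd n x 0) h
  exact ⟨hsum, hsum.tsum_le_of_sum_range_le h⟩

lemma avg_f3_lt (hd : 3 ≤ d) (x : Zd d) : avg f3 x < f3 x := by
  refine (avg_f3_le hd x).trans_lt ?_
  have h1 := f3_pos x
  have h2 := reg_pos x
  have : 0 < f3 x * (700 / reg x ^ 2) := by positivity
  linarith

lemma summable_pn (hd : 3 ≤ d) (x : Zd d) : Summable fun n => pn n x 0 :=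
  (green_bound (by omega) (fun x => (f3_pos x).le) (fun x => (avg_f3_lt hd x).le)
    (avg_f3_lt hd 0) x).1

lemma exists_green_le_f3 (hd : 3 ≤ d) : ∃ C : ℝ, 0 < C ∧ ∀ x : Zd d, green x ≤ C * f3 x :=
  ⟨_, inv_pos.2 (sub_pos.2 (avg_f3_lt hd 0)), fun x =>
    (green_bound (by omega) (fun x => (f3_pos x).le) (fun x => (avg_f3_lt hd x).le)
    (avg_f3_lt hd 0) x).2⟩

lemma avg_f4_lt (x : Zd 4) : avg f4 x < f4 x := by
  refine (avg_f4_le x).trans_lt ?_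
  have h1 := f4_pos x
  have h2 := reg_pos x
  have : ∀ c : ℝ, 0 < c → 0 < f4 x * (c / reg x ^ 2) := fun c hc => by positivity
  linarith [this _ (show (0:ℝ) < 700 by norm_num)]

lemma exists_green_le_f4 : ∃ C : ℝ, 0 < C ∧ ∀ x : Zd 4, green x ≤ C * f4 x :=
  ⟨_, inv_pos.2 (sub_pos.2 (avg_f4_lt 0)), fun x =>
    (green_bound (by omega) (fun x => (f4_pos x).le) (fun x => (avg_f4_lt x).le)
    (avg_f4_lt 0) x).2⟩

lemma green_nonneg (hd : 0 < d) (x : Zd d) : 0 ≤ green x := tsum_nonneg fun n => pn_nonneg hd n x 0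

lemma pn_eq_sub (n : ℕ) (x y : Zd d) : pn n x y = pn n (x - y) 0 := by
  rw [← pn_translate n (x - y) 0 y]; simp

lemma pn_neg (n : ℕ) (x : Zd d) : pn n (-x) 0 = pn n x 0 := by
  rw [pn_symm n x 0, ← pn_translate n (-x) 0 x]; simp

lemma green_neg (x : Zd d) : green (-x) = green x := by
  unfold green; simp_rw [pn_neg]

lemma green_sub_comm (x y : Zd d) : green (x - y) = green (y - x) := by
  rw [← green_neg, neg_sub]

lemma hasSum_green (hd : 3 ≤ d) (x y : Zd d) : HasSum (fun n => pn n x y) (green (x - y)) := by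
  simp_rw [pn_eq_sub _ x y]
  exact (summable_pn hd _).hasSum

lemma pn_zero (x y : Zd d) : pn 0 x y = if x = y then 1 else 0 := rfl

lemma avg_green (hd : 3 ≤ d) (x : Zd d) : avg green x = green x - if x = 0 then 1 else 0 := by
  have h1 : HasSum (fun n => avg (fun y => pn n y 0) x) (avg green x) := by
    unfold avg
    refine HasSum.div_const (hasSum_sum fun i _ => HasSum.add ?_ ?_) _
    · exact (summable_pn hd _).hasSum
    · exact (summable_pn hd _).hasSum
  have h2 : ∀ n, avg (fun y => pn n y 0) x = pn (n+1) x 0 := fun n => by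
    unfold pn; rw [avgN_succ]
  simp_rw [h2] at h1
  have h3 := (summable_pn hd x).hasSum
  have h4 := (hasSum_nat_add_iff' (f := fun n => pn n x 0) 1).2 h3
  have := h1.unique h4
  rw [this]
  simp [pn_zero, green]

lemma avg_green_le (hd : 3 ≤ d) (x : Zd d) : avg green x ≤ green x := by
  rw [avg_green hd]; split_ifs <;> linarith

/-- A nonnegative function is at most `2d` times its average at a neighbour. -/
lemma le_avg_of_nonneg (hd : 0 < d) {f : Zd d → ℝ} (hf : ∀ x, 0 ≤ f x) (x : Zd d)
    (q : Fin d × Bool) : f (x + nbr q) ≤ 2 * d * avg f x := by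
  rw [avg_eq_sum_nbr, ← Finset.mul_sum, ← mul_assoc, mul_inv_cancel₀ (by positivity), one_mul]
  exact Finset.single_le_sum (f := fun q => f (x + nbr q)) (fun i _ => hf _) (Finset.mem_univ q)

lemma green_nbr_le (hd : 3 ≤ d) (x : Zd d) (q : Fin d × Bool) :
    green (x + nbr q) ≤ 2 * d * green x := by
  refine (le_avg_of_nonneg (by omega) (green_nonneg (by omega)) x q).trans ?_
  have := avg_green_le hd x
  gcongr

lemma summable_one_add_sq_rpow {q : ℝ} (hq : 1 / 2 < q) :
    Summable fun k : ℤ => (1 + (k : ℝ) ^ 2) ^ (-q) := by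
  refine Summable.of_norm_bounded_eventually (Real.summable_abs_int_rpow (b := 2 * q) (by linarith)) ?_
  filter_upwards [(Set.finite_singleton (0 : ℤ)).compl_mem_cofinite] with k hk
  have hk0 : (0 : ℝ) < |(k : ℝ)| := by
    rw [abs_pos]; exact_mod_cast hk
  rw [Real.norm_of_nonneg (by positivity),
    show |(k : ℝ)| ^ (-(2 * q)) = ((k : ℝ) ^ 2) ^ (-q) by
      rw [← sq_abs, ← Real.rpow_natCast, ← Real.rpow_mul hk0.le]; congr 1; push_cast; ring]
  refine Real.rpow_le_rpow_of_nonpos ?_ (by linarith) (by linarith)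
  rw [← sq_abs]; positivity

lemma sq_coord_le_nsq (x : Zd d) (i : Fin d) : (x i : ℝ) ^ 2 ≤ nsq x := by
  unfold nsq
  exact Finset.single_le_sum (f := fun i => (x i : ℝ) ^ 2) (fun i _ => sq_nonneg _)
    (Finset.mem_univ i)

lemma summable_reg_rpow {q : ℝ} (hq : 1 / 2 < q) :
    Summable fun w : Zd d => reg w ^ (-(q * d)) := by
  set g : ℤ → ℝ := fun k => (1 + (k : ℝ) ^ 2) ^ (-q) with hg
  have hg0 : ∀ k, 0 ≤ g k := fun k => by positivity
  have hgs : Summable g := summable_one_add_sq_rpow hq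
  have h1 : ∀ w : Zd d, reg w ^ (-(q * d)) ≤ ∏ i, g (w i) := fun w => by
    have hr := reg_pos w
    calc reg w ^ (-(q * d)) = ∏ _i : Fin d, reg w ^ (-q) := by
          rw [Finset.prod_const, Finset.card_univ, Fintype.card_fin, ← Real.rpow_natCast,
            ← Real.rpow_mul hr.le]
          congr 1; ring
      _ ≤ _ := by
          refine Finset.prod_le_prod (fun i _ => by positivity) fun i _ => ?_
          refine Real.rpow_le_rpow_of_nonpos (by positivity) ?_ (by linarith)
          have := sq_coord_le_nsq w i
          rw [reg]; linarith
  refine summable_of_sum_le (c := ∏ _i : Fin d, ∑' k, g k)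
    (fun w => by have := reg_pos w; positivity) fun u => ?_
  calc ∑ w ∈ u, reg w ^ (-(q * d)) ≤ ∑ w ∈ u, ∏ i, g (w i) := Finset.sum_le_sum fun w _ => h1 w
    _ ≤ ∑ w ∈ Fintype.piFinset (fun i : Fin d => u.image fun w => w i), ∏ i, g (w i) := by
        refine Finset.sum_le_sum_of_subset_of_nonneg (fun w hw => ?_)
          fun w _ _ => Finset.prod_nonneg fun i _ => hg0 _
        rw [Fintype.mem_piFinset]
        exact fun i => Finset.mem_image_of_mem _ hw
    _ = ∏ i : Fin d, ∑ k ∈ u.image fun w => w i, g k := by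
        rw [Finset.prod_univ_sum]
    _ ≤ _ := Finset.prod_le_prod (fun i _ => Finset.sum_nonneg fun k _ => hg0 k)
        fun i _ => hgs.sum_le_tsum _ fun k _ => hg0 k

lemma finite_nsq_le (K : ℝ) : {x : Zd d | nsq x ≤ K}.Finite := by
  obtain ⟨M, hM⟩ := exists_nat_ge (max K 1)
  refine (Set.finite_Icc (fun _ : Fin d => -(M : ℤ)) fun _ => (M : ℤ)).subset fun x hx => ?_
  have hx' : nsq x ≤ K := hx
  have hM1 : (1 : ℝ) ≤ M := (le_max_right _ _).trans hM
  have hMK : K ≤ M := (le_max_left _ _).trans hM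
  have : ∀ i, |x i| ≤ (M : ℤ) := fun i => by
    have h1 := sq_coord_le_nsq x i
    have h2 : |(x i : ℝ)| ≤ M := by
      apply abs_le_of_sq_le_sq _ (by positivity)
      nlinarith
    exact_mod_cast h2
  exact ⟨fun i => (abs_le.1 (this i)).1, fun i => (abs_le.1 (this i)).2⟩

lemma tendsto_reg : Tendsto (reg (d := d)) cofinite atTop := by
  rw [tendsto_atTop]
  intro b
  refine (finite_nsq_le (d := d) b).subset fun x hx => ?_
  have : ¬ b ≤ reg x := hx
  rw [reg] at this
  change nsq x ≤ b
  linarith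

lemma tendsto_f3 : Tendsto (f3 (d := d)) cofinite (𝓝 0) :=
  tendsto_inv_atTop_zero.comp (Real.tendsto_sqrt_atTop.comp tendsto_reg)

lemma tendsto_f4 : Tendsto (f4 (d := d)) cofinite (𝓝 0) :=
  tendsto_inv_atTop_zero.comp tendsto_reg

lemma hasSum_pn_mul (φ : Zd d → ℝ) (n : ℕ) (x : Zd d) :
    HasSum (fun w => pn n x w * φ w) (avg^[n] φ x) := by
  induction n generalizing x with
  | zero =>
    have := hasSum_single (f := fun w => pn 0 x w * φ w) x fun w hw => by
      simp [pn_zero, hw.symm]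
    simpa [pn_zero] using this
  | succ n ih =>
    have h : ∀ w, pn (n + 1) x w * φ w = avg (fun y => pn n y w * φ w) x := fun w => by
      unfold pn
      rw [avgN_succ, mul_comm, ← congrFun (avg_const_mul _ _) x]
      simp_rw [mul_comm]
    simp_rw [h]
    rw [avgN_succ]
    unfold avg
    exact HasSum.div_const (hasSum_sum fun i _ => HasSum.add (ih _) (ih _)) _

lemma tendsto_avgN (hd : 3 ≤ d) {f : Zd d → ℝ} (hf : ∀ x, 0 ≤ f x)
    (h0 : Tendsto f cofinite (𝓝 0)) (x : Zd d) :
    Tendsto (fun n => avg^[n] f x) atTop (𝓝 0) := by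
  rw [Metric.tendsto_atTop]
  intro ε hε
  have hfin : {y | ¬ f y < ε / 2}.Finite := h0.eventually (gt_mem_nhds (show 0 < ε / 2 by linarith))
  set S := hfin.toFinset
  have hlim : Tendsto (fun n => ∑ y ∈ S, f y * pn n x y) atTop (𝓝 0) := by
    have : Tendsto (fun n => ∑ y ∈ S, f y * pn n x y) atTop (𝓝 (∑ y ∈ S, f y * 0)) :=
      tendsto_finsetSum _ fun y _ => ((hasSum_green hd x y).summable.tendsto_atTop_zero).const_mul _
    simpa using this
  obtain ⟨N, hN⟩ := (hlim.eventually (gt_mem_nhds (show 0 < ε / 2 by linarith))).exists_forall_of_atTop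
  refine ⟨N, fun n hn => ?_⟩
  have h1 : avg^[n] f x ≤ ε / 2 + ∑ y ∈ S, f y * pn n x y := by
    have hp : ∀ z, f z ≤ ε / 2 + ∑ y ∈ S, f y * (if z = y then 1 else 0) := fun z => by
      by_cases hz : z ∈ S
      · have : f z * (if z = z then 1 else 0) ≤ ∑ y ∈ S, f y * (if z = y then 1 else 0) :=
          Finset.single_le_sum (f := fun y => f y * (if z = y then (1:ℝ) else 0)) (fun i _ => by
            have := hf i
            positivity) hz
        simp only [if_true, mul_one] at this
        linarith
      · have h2 : f z < ε / 2 := by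
          by_contra hc
          exact hz (hfin.mem_toFinset.2 hc)
        have : 0 ≤ ∑ y ∈ S, f y * (if z = y then (1:ℝ) else 0) :=
          Finset.sum_nonneg fun i _ => by
            have := hf i
            positivity
        linarith
    refine (avgN_mono hp n x).trans (le_of_eq ?_)
    rw [avgN_add, avgN_const (by omega), avgN_sum]
    simp_rw [avgN_const_mul]
    rfl
  rw [Real.dist_eq, sub_zero, abs_of_nonneg (avgN_nonneg (by omega) hf n x)]
  linarith [hN n hn]

lemma riesz (hd : 3 ≤ d) {f : Zd d → ℝ} (hf : ∀ x, 0 ≤ f x) (hs : ∀ x, avg f x ≤ f x)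
    (h0 : Tendsto f cofinite (𝓝 0)) (x : Zd d) :
    HasSum (fun w => green (x - w) * (f w - avg f w)) (f x) := by
  have hρ : ∀ w, 0 ≤ f w - avg f w := fun w => sub_nonneg.2 (hs w)
  set ρ : Zd d → ℝ := fun w => f w - avg f w with hρd
  have h1 : HasSum (fun k => avg^[k] ρ x) (f x) := by
    rw [hasSum_iff_tendsto_nat_of_nonneg fun k => avgN_nonneg (by omega) hρ k x]
    refine Tendsto.congr (fun n => (sum_avgN_defect f n x).symm) ?_
    simpa using (tendsto_avgN hd hf h0 x).const_sub (f x)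
  have h2 := fun k => hasSum_pn_mul ρ k x
  set F : ℕ × Zd d → ℝ := fun q => pn q.1 x q.2 * ρ q.2 with hF
  have hsF : Summable F := by
    rw [summable_prod_of_nonneg fun q => mul_nonneg (pn_nonneg (by omega) _ _ _) (hρ _)]
    refine ⟨fun k => (h2 k).summable, ?_⟩
    exact h1.summable.congr fun k => (h2 k).tsum_eq.symm
  have h3 := hsF.hasSum.prod_fiberwise h2
  have h4 : HasSum F (f x) := by
    rw [h1.unique h3]; exact hsF.hasSum
  have h5 := (Equiv.prodComm (Zd d) ℕ).hasSum_iff.2 h4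
  exact h5.prod_fiberwise fun w => (hasSum_green hd x w).mul_right (ρ w)

section Capacity

variable {P : Zd d → Measure (ℕ → Zd d)}

/-- Escape probability from `A`. -/
def esc (P : Zd d → Measure (ℕ → Zd d)) (A : Set (Zd d)) (x : Zd d) : ℝ := (P x).real (avoidSet A)

lemma esc_nonneg (A : Set (Zd d)) (x : Zd d) : 0 ≤ esc P A x := measureReal_nonneg

/-- Normalised capacity of a finite set. -/
def capF (P : Zd d → Measure (ℕ → Zd d)) (A : Finset (Zd d)) : ℝ := ∑ x ∈ A, esc P A x

lemma capZ_eq (A : Finset (Zd d)) : capZ P (A : Set (Zd d)) = 2 * d * capF P A := by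
  unfold capZ capF esc
  rw [Finset.mul_sum]
  exact Finset.tsum_subtype A fun x => (2 * d : ℝ) * (P x (avoidSet A)).toReal

lemma measurableSet_avoidSet (A : Set (Zd d)) : MeasurableSet (avoidSet A) := by
  have : avoidSet A = ⋂ k, ⋂ (_ : 1 ≤ k), {ω : ℕ → Zd d | ω k ∈ A}ᶜ := by
    ext ω; simp [avoidSet]
  rw [this]
  exact MeasurableSet.iInter fun k => MeasurableSet.iInter fun _ =>
    ((measurable_pi_apply k) (Set.to_countable A).measurableSet).compl

/-- Trajectories whose last visit to `A` is at time `k`, at the point `x`. -/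
def lastVisit (A : Finset (Zd d)) (q : ℕ × A) : Set (ℕ → Zd d) :=
  {ω | ω q.1 = q.2} ∩ {ω | (fun n => ω (q.1 + n)) ∈ avoidSet (A : Set (Zd d))}

lemma measurableSet_lastVisit (A : Finset (Zd d)) (q : ℕ × A) : MeasurableSet (lastVisit A q) :=
  (measurableSet_eval_eq _ _).inter (measurable_shift _ (measurableSet_avoidSet _))

lemma lastVisit_disjoint (A : Finset (Zd d)) : Pairwise (Function.onFun Disjoint (lastVisit A)) := by
  have key : ∀ q q' : ℕ × A, ∀ ω, ω ∈ lastVisit A q → ω ∈ lastVisit A q' → ¬ q.1 < q'.1 := by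
    rintro ⟨k, x⟩ ⟨k', x'⟩ ω ⟨_, h2⟩ ⟨h1', _⟩ hlt
    simp only at hlt
    have h := h2 (k' - k) (by omega)
    have h1'' : ω k' = x' := h1'
    simp only [show k + (k' - k) = k' by omega, h1''] at h
    exact h x'.2
  intro q q' hne
  rw [Function.onFun, Set.disjoint_left]
  intro ω h h'
  have hk : q.1 = q'.1 := by
    have := key q q' ω h h'; have := key q' q ω h' h; omega
  refine hne (Prod.ext hk (Subtype.ext ?_))
  have h1 : ω q.1 = q.2 := h.1
  have h2 : ω q'.1 = q'.2 := h'.1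
  rw [← h1, ← h2, hk]

lemma WalkLaw.prob_iUnion_lastVisit (hW : WalkLaw d P) (hd : 3 ≤ d) (A : Finset (Zd d)) (w : Zd d) :
    (P w).real (⋃ q, lastVisit A q) = ∑ x ∈ A, green (w - x) * esc P A x := by
  have := hW.prob
  have hterm : ∀ q : ℕ × A, P w (lastVisit A q)
      = ENNReal.ofReal (pn q.1 w q.2 * esc P A q.2) := fun q => by
    rw [lastVisit, hW.markov w q.2 q.1 _ (measurableSet_avoidSet _), hW.prob_eval (by omega),
      ENNReal.ofReal_mul (pn_nonneg (by omega) _ _ _), esc, ofReal_measureReal]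
  have hs : ∀ x : A, HasSum (fun k => pn k w x * esc P A x) (green (w - (x : Zd d)) * esc P A x) :=
    fun x => (hasSum_green hd w x).mul_right _
  have h : P w (⋃ q, lastVisit A q) = ENNReal.ofReal (∑ x ∈ A, green (w - x) * esc P A x) := by
    rw [measure_iUnion (lastVisit_disjoint A) (measurableSet_lastVisit A)]
    simp_rw [hterm]
    rw [ENNReal.tsum_prod', ENNReal.tsum_comm, tsum_fintype,
      ENNReal.ofReal_sum_of_nonneg fun x _ =>
        mul_nonneg (green_nonneg (by omega) _) (esc_nonneg _ _), ← Finset.sum_coe_sort A]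
    refine Finset.sum_congr rfl fun x _ => ?_
    rw [← (hs x).tsum_eq, ENNReal.ofReal_tsum_of_nonneg _ (hs x).summable]
    exact fun k => mul_nonneg (pn_nonneg (by omega) _ _ _) (esc_nonneg _ _)
  rw [Measure.real, h, ENNReal.toReal_ofReal]
  exact Finset.sum_nonneg fun x _ => mul_nonneg (green_nonneg (by omega) _) (esc_nonneg _ _)

lemma WalkLaw.potential_le_one (hW : WalkLaw d P) (hd : 3 ≤ d) (A : Finset (Zd d)) (w : Zd d) :
    ∑ x ∈ A, green (w - x) * esc P A x ≤ 1 := by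
  have := hW.prob
  rw [← hW.prob_iUnion_lastVisit hd]
  exact measureReal_le_one

lemma WalkLaw.ae_eventually_notMem (hW : WalkLaw d P) (hd : 3 ≤ d) (A : Finset (Zd d)) (w : Zd d) :
    ∀ᵐ ω ∂(P w), ∀ᶠ n in atTop, ω n ∉ A := by
  have h : ∀ a ∈ A, ∀ᵐ ω ∂(P w), ∀ᶠ n in atTop, ω n ≠ a := fun a _ => by
    have := MeasureTheory.ae_eventually_notMem (μ := P w) (s := fun n => {ω | ω n = a}) (by
      simp_rw [hW.prob_eval (show 0 < d by omega)]
      rw [← ENNReal.ofReal_tsum_of_nonneg (fun n => pn_nonneg (by omega) _ _ _)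
        (hasSum_green hd w a).summable]
      exact ENNReal.ofReal_ne_top)
    exact this
  have h' := (Finset.eventually_all A).2 h
  filter_upwards [h'] with ω hω
  filter_upwards [(Finset.eventually_all A).2 hω] with n hn hmem
  exact hn _ hmem rfl

lemma WalkLaw.potential_eq_one (hW : WalkLaw d P) (hd : 3 ≤ d) (A : Finset (Zd d)) {w : Zd d}
    (hw : w ∈ A) : ∑ x ∈ A, green (w - x) * esc P A x = 1 := by
  have := hW.prob
  rw [← hW.prob_iUnion_lastVisit hd, ← probReal_univ (μ := P w)]
  apply measureReal_congr
  filter_upwards [hW.ae_start w, hW.ae_eventually_notMem hd A w] with ω h0 hev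
  refine propext ⟨fun _ => trivial, fun _ => ?_⟩
  obtain ⟨N, hN⟩ := hev.exists_forall_of_atTop
  set k := Nat.findGreatest (fun n => ω n ∈ A) N with hk
  have hkA : ω k ∈ A := Nat.findGreatest_spec (P := fun n => ω n ∈ A) (Nat.zero_le N) (by rwa [h0])
  refine Set.mem_iUnion.2 ⟨(k, ⟨ω k, hkA⟩), rfl, ?_⟩
  intro m hm hmem
  have hmem' : ω (k + m) ∈ A := hmem
  have hle : k + m ≤ N := by
    by_contra hc
    exact hN _ (by omega) hmem'
  have := Nat.le_findGreatest (P := fun n => ω n ∈ A) hle hmem'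
  omega

/-- A charge whose potential is at least one on `A` dominates the capacity. -/
lemma WalkLaw.capF_le (hW : WalkLaw d P) (hd : 3 ≤ d) (A B : Finset (Zd d)) {ν : Zd d → ℝ}
    (hν : ∀ x, 0 ≤ ν x) (h : ∀ a ∈ A, 1 ≤ ∑ b ∈ B, green (a - b) * ν b) :
    capF P A ≤ ∑ b ∈ B, ν b := by
  calc capF P A ≤ ∑ a ∈ A, esc P A a * ∑ b ∈ B, green (a - b) * ν b :=
        Finset.sum_le_sum fun a ha => le_mul_of_one_le_right (esc_nonneg _ _) (h a ha)
    _ = ∑ b ∈ B, ν b * ∑ a ∈ A, green (b - a) * esc P A a := by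
        simp_rw [Finset.mul_sum]
        rw [Finset.sum_comm]
        refine Finset.sum_congr rfl fun b _ => Finset.sum_congr rfl fun a _ => ?_
        rw [green_sub_comm b a]; ring
    _ ≤ _ := Finset.sum_le_sum fun b _ =>
        mul_le_of_le_one_right (hν b) (hW.potential_le_one hd A b)

/-- A charge on `A` whose potential is at most `S` on `A` bounds the capacity below. -/
lemma WalkLaw.le_capF_mul (hW : WalkLaw d P) (hd : 3 ≤ d) (A : Finset (Zd d)) {ν : Zd d → ℝ} {S : ℝ}
    (h : ∀ b ∈ A, ∑ a ∈ A, green (b - a) * ν a ≤ S) :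
    ∑ a ∈ A, ν a ≤ capF P A * S := by
  calc ∑ a ∈ A, ν a = ∑ a ∈ A, ν a * ∑ b ∈ A, green (a - b) * esc P A b :=
        Finset.sum_congr rfl fun a ha => by rw [hW.potential_eq_one hd A ha, mul_one]
    _ = ∑ b ∈ A, esc P A b * ∑ c ∈ A, green (b - c) * ν c := by
        simp_rw [Finset.mul_sum]
        rw [Finset.sum_comm]
        refine Finset.sum_congr rfl fun b _ => Finset.sum_congr rfl fun a _ => ?_
        rw [green_sub_comm b a]; ring
    _ ≤ ∑ b ∈ A, esc P A b * S := Finset.sum_le_sum fun b hb =>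
        mul_le_mul_of_nonneg_left (h b hb) (esc_nonneg _ _)
    _ = _ := by rw [← Finset.sum_mul]; rfl

lemma WalkLaw.capF_mono (hW : WalkLaw d P) (hd : 3 ≤ d) {A B : Finset (Zd d)} (h : A ⊆ B) :
    capF P A ≤ capF P B :=
  hW.capF_le hd A B (esc_nonneg _) fun _ ha => (hW.potential_eq_one hd B (h ha)).ge

lemma WalkLaw.capF_translate_le (hW : WalkLaw d P) (hd : 3 ≤ d) (A : Finset (Zd d)) (v : Zd d) :
    capF P A ≤ capF P (A.image (· + v)) := by
  have hinj : Function.Injective fun x : Zd d => x + v := add_left_injective v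
  have h := hW.capF_le hd A A (ν := fun b => esc P (A.image (· + v)) (b + v))
    (fun _ => esc_nonneg _ _) fun a ha => by
      have := hW.potential_eq_one hd (A.image (· + v)) (Finset.mem_image_of_mem (· + v) ha)
      rw [Finset.sum_image hinj.injOn] at this
      simpa using this.ge
  refine h.trans (le_of_eq ?_)
  rw [capF, Finset.sum_image hinj.injOn]

end Capacity

/-- Euclidean length. -/
def len (x : Zd d) : ℝ := Real.sqrt (nsq x)

lemma len_eq_norm (x : Zd d) : len x = ‖WithLp.toLp 2 (fun i => (x i : ℝ))‖ := by
  rw [EuclideanSpace.norm_eq]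
  simp [len, nsq]

lemma len_nonneg (x : Zd d) : 0 ≤ len x := Real.sqrt_nonneg _

lemma len_sq (x : Zd d) : len x ^ 2 = nsq x := Real.sq_sqrt (nsq_nonneg x)

lemma len_add_le (x y : Zd d) : len (x + y) ≤ len x + len y := by
  rw [len_eq_norm, len_eq_norm x, len_eq_norm y]
  refine le_trans (le_of_eq ?_) (norm_add_le _ _)
  congr 1
  ext i
  simp

lemma len_neg (x : Zd d) : len (-x) = len x := by simp [len, nsq]

lemma len_sub_le (x y : Zd d) : len (x - y) ≤ len x + len y := by
  rw [sub_eq_add_neg, ← len_neg y]; exact len_add_le _ _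

lemma len_le_sqrt_reg (x : Zd d) : len x ≤ Real.sqrt (reg x) :=
  Real.sqrt_le_sqrt (by rw [reg]; linarith)

lemma one_le_sqrt_reg (x : Zd d) : 1 ≤ Real.sqrt (reg x) :=
  Real.one_le_sqrt.2 (by linarith [le_reg x])

lemma sqrt_reg_le (x : Zd d) : Real.sqrt (reg x) ≤ len x + 45 := by
  rw [Real.sqrt_le_left (by linarith [len_nonneg x]), reg, ← len_sq]
  nlinarith [len_nonneg x]

lemma sqrt_reg_add_le (x y : Zd d) : Real.sqrt (reg (x + y)) ≤ Real.sqrt (reg x) + len y := by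
  have h1 := len_add_le x y
  have h2 := len_le_sqrt_reg x
  have h3 := len_nonneg y
  have h4 := len_nonneg (x + y)
  have h5 := len_nonneg x
  rw [Real.sqrt_le_left (by positivity)]
  have h6 : Real.sqrt (reg x) ^ 2 = len x ^ 2 + 2000 := by
    rw [Real.sq_sqrt (reg_pos x).le, len_sq, reg]
  rw [reg, ← len_sq]
  nlinarith

lemma f3_sub_le (x w : Zd d) : f3 (x - w) ≤ (1 + len w) * f3 x := by
  have h := sqrt_reg_add_le (x - w) w
  rw [sub_add_cancel] at h
  have h1 := one_le_sqrt_reg x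
  have h2 := one_le_sqrt_reg (x - w)
  have h3 := len_nonneg w
  unfold f3
  rw [← div_eq_mul_inv, le_div_iff₀ (by linarith), inv_mul_le_iff₀ (by linarith)]
  nlinarith

lemma green_pos_of_le {c : ℝ} (hc : 0 < c) (h : ∀ x : Zd d, c * f3 x ≤ green x) (x : Zd d) :
    0 < green x := (mul_pos hc (f3_pos x)).trans_le (h x)

lemma exists_green_add_le (hd : 3 ≤ d) (w : Zd d) :
    ∃ K : ℝ, 0 ≤ K ∧ ∀ x : Zd d, green (x + w) ≤ K * green x := by
  let S : AddSubgroup (Zd d) :=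
    { carrier := {w | (∃ K : ℝ, 0 ≤ K ∧ ∀ x : Zd d, green (x + w) ≤ K * green x) ∧
        ∃ K : ℝ, 0 ≤ K ∧ ∀ x : Zd d, green (x + -w) ≤ K * green x}
      add_mem' := by
        rintro a b ⟨⟨K, hK, h⟩, ⟨L, hL, h'⟩⟩ ⟨⟨K1, hK1, h1⟩, ⟨L1, hL1, h1'⟩⟩
        refine ⟨⟨K1 * K, by positivity, fun x => ?_⟩, ⟨L1 * L, by positivity, fun x => ?_⟩⟩
        · rw [← add_assoc, mul_assoc]
          exact (h1 _).trans (mul_le_mul_of_nonneg_left (h x) hK1)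
        · rw [neg_add, ← add_assoc, mul_assoc]
          exact (h1' _).trans (mul_le_mul_of_nonneg_left (h' x) hL1)
      zero_mem' := ⟨⟨1, by norm_num, by simp⟩, ⟨1, by norm_num, by simp⟩⟩
      neg_mem' := by
        rintro a ⟨h, h'⟩
        exact ⟨h', by rwa [neg_neg]⟩ }
  have hsingle : ∀ i, (Pi.single i 1 : Zd d) ∈ S := fun i =>
    ⟨⟨2 * d, by positivity, fun x => by simpa [nbr] using green_nbr_le hd x (i, true)⟩,
      ⟨2 * d, by positivity, fun x => by simpa [nbr] using green_nbr_le hd x (i, false)⟩⟩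
  have hw : w ∈ S := by
    have : w = ∑ i, w i • (Pi.single i 1 : Zd d) := by
      conv_lhs => rw [← Finset.univ_sum_single w]
      refine Finset.sum_congr rfl fun i _ => ?_
      rw [← Pi.single_smul]; simp
    rw [this]
    exact S.sum_mem fun i _ => S.zsmul_mem (hsingle i) _
  exact hw.1

lemma defect_f3_nonneg (x : Zd 3) : 0 ≤ f3 x - avg f3 x := by linarith [avg_f3_lt le_rfl x]

lemma summable_len_mul_defect : Summable fun w : Zd 3 => (1 + len w) * (f3 w - avg f3 w) := by
  have h := (summable_reg_rpow (d := 3) (q := 2 / 3) (by norm_num)).mul_left 4000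
  refine Summable.of_nonneg_of_le (fun w => ?_) (fun w => ?_) h
  · exact mul_nonneg (by linarith [len_nonneg w]) (defect_f3_nonneg w)
  · have h1 := le_avg_f3 w
    have h2 : f3 w - avg f3 w ≤ f3 w * (2000 / reg w ^ 2) := by linarith
    have h3 := len_le_sqrt_reg w
    have h4 := one_le_sqrt_reg w
    have h5 : 1 + len w ≤ 2 * Real.sqrt (reg w) := by linarith
    have h6 := reg_pos w
    calc _ ≤ 2 * Real.sqrt (reg w) * (f3 w * (2000 / reg w ^ 2)) := by
          gcongr
          · exact defect_f3_nonneg w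
      _ = 4000 / reg w ^ 2 := by
          unfold f3; field_simp; norm_num
      _ = _ := by
          rw [show (-(2 / 3 * ((3 : ℕ) : ℝ))) = -((2 : ℕ) : ℝ) by norm_num, Real.rpow_neg h6.le,
            Real.rpow_natCast, div_eq_mul_inv]

lemma summable_defect_f3 : Summable fun w : Zd 3 => f3 w - avg f3 w :=
  Summable.of_nonneg_of_le defect_f3_nonneg
    (fun w => le_mul_of_one_le_left (defect_f3_nonneg w) (by linarith [len_nonneg w]))
    summable_len_mul_defect

lemma riesz_f3 (x : Zd 3) : HasSum (fun w => green (x - w) * (f3 w - avg f3 w)) (f3 x) :=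
  riesz le_rfl (fun x => (f3_pos x).le) (fun x => (avg_f3_lt le_rfl x).le) tendsto_f3 x

lemma exists_le_green : ∃ c : ℝ, 0 < c ∧ ∀ x : Zd 3, c * f3 x ≤ green x := by
  obtain ⟨C, hC, hgC⟩ := exists_green_le_f3 (d := 3) le_rfl
  set ρ : Zd 3 → ℝ := fun w => f3 w - avg f3 w with hρ
  have hρ0 : ∀ w, 0 ≤ ρ w := defect_f3_nonneg
  have hs := summable_len_mul_defect
  obtain ⟨F, hF⟩ := ((tendsto_order.1 (tendsto_tsum_compl_atTop_zero
    fun w : Zd 3 => (1 + len w) * ρ w)).2 (1 / (2 * C)) (by positivity)).exists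
  choose K hK0 hK using fun w : Zd 3 => exists_green_add_le (d := 3) le_rfl w
  have hnear : ∀ x, ∑ w ∈ F, green (x - w) * ρ w ≤ (∑ w ∈ F, K (-w) * ρ w) * green x := fun x => by
    rw [Finset.sum_mul]
    refine Finset.sum_le_sum fun w _ => ?_
    have := hK (-w) x
    rw [← sub_eq_add_neg] at this
    nlinarith [hρ0 w]
  have hfar : ∀ x : Zd 3, ∑' w : {w // w ∉ F}, green (x - (w : Zd 3)) * ρ w ≤ f3 x / 2 := fun x => by
    have h1 : ∀ w : {w // w ∉ F}, green (x - (w : Zd 3)) * ρ w ≤ C * f3 x * ((1 + len (w : Zd 3)) * ρ w) :=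
      fun w => by
        have h2 := hgC (x - (w : Zd 3))
        have h3 := f3_sub_le x (w : Zd 3)
        have h4 : green (x - (w : Zd 3)) ≤ C * ((1 + len (w : Zd 3)) * f3 x) :=
          h2.trans (mul_le_mul_of_nonneg_left h3 hC.le)
        calc _ ≤ C * ((1 + len (w : Zd 3)) * f3 x) * ρ w :=
              mul_le_mul_of_nonneg_right h4 (hρ0 w)
          _ = _ := by ring
    have h5 := ((riesz_f3 x).summable.subtype fun w => w ∉ F).tsum_le_tsum h1
      ((hs.subtype fun w => w ∉ F).mul_left _)
    refine h5.trans ?_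
    rw [tsum_mul_left]
    have h6 := f3_pos x
    calc _ ≤ C * f3 x * (1 / (2 * C)) := by gcongr
      _ = _ := by field_simp
  set D := ∑ w ∈ F, K (-w) * ρ w with hD
  have hD0 : 0 ≤ D := Finset.sum_nonneg fun w _ => mul_nonneg (hK0 _) (hρ0 _)
  refine ⟨1 / (2 * (D + 1)), by positivity, fun x => ?_⟩
  have h1 := (riesz_f3 x).summable.sum_add_tsum_subtype_compl F
  rw [(riesz_f3 x).tsum_eq] at h1
  have h2 := hnear x
  have h3 := hfar x
  have h4 := green_nonneg (d := 3) (by norm_num) x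
  rw [div_mul_eq_mul_div, div_le_iff₀ (by positivity)]
  have h5 : f3 x ≤ D * green x + f3 x / 2 := by
    rw [← h1]; linarith
  nlinarith

lemma eventually_add {p : Zd d → Prop} (h : ∀ᶠ x in cofinite, p x) (v : Zd d) :
    ∀ᶠ x in cofinite, p (x + v) :=
  (add_left_injective v).tendsto_cofinite.eventually h

/-- One propagation step: if `u ≥ 0` near `x` and `avg u x ≤ u x`, then `u` at a neighbour is
controlled by `u x`. -/
lemma le_mul_of_superharmonic (hd : 0 < d) {u : Zd d → ℝ} {x : Zd d} (h : ∀ q, 0 ≤ u (x + nbr q))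
    (hs : avg u x ≤ u x) (q : Fin d × Bool) : u (x + nbr q) ≤ 2 * d * u x := by
  have h1 : u (x + nbr q) ≤ 2 * d * avg u x := by
    rw [avg_eq_sum_nbr, ← Finset.mul_sum, ← mul_assoc, mul_inv_cancel₀ (by positivity), one_mul]
    exact Finset.single_le_sum (f := fun q => u (x + nbr q)) (fun i _ => h i) (Finset.mem_univ q)
  refine h1.trans ?_
  gcongr

lemma eventually_f3_le (v : Zd d) : ∀ᶠ x in cofinite, f3 (x + v) ≤ 2 * f3 x := by
  have h : ∀ᶠ x : Zd d in cofinite, 2 * len v ≤ Real.sqrt (reg x) :=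
    (Real.tendsto_sqrt_atTop.comp tendsto_reg).eventually_ge_atTop _
  filter_upwards [h] with x hx
  have h1 := sqrt_reg_add_le (x + v) (-v)
  rw [add_neg_cancel_right, len_neg] at h1
  have h2 := one_le_sqrt_reg x
  have h3 := one_le_sqrt_reg (x + v)
  unfold f3
  rw [← div_eq_mul_inv, le_div_iff₀ (by linarith), inv_mul_le_iff₀ (by linarith)]
  linarith

lemma eventually_green_nbr_le (q : Fin 3 × Bool) {ε : ℝ} (hε : 0 < ε) :
    ∀ᶠ x : Zd 3 in cofinite, green (x + nbr q) ≤ (1 + ε) * green x := by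
  obtain ⟨c, hc, hgc⟩ := exists_le_green
  obtain ⟨C, hC, hgC⟩ := exists_green_le_f3 (d := 3) le_rfl
  have hpos := green_pos_of_le hc hgc
  set e : Zd 3 := nbr q with he
  have he0 : e ≠ 0 := fun h => by
    have h1 := congrFun h q.1
    rw [he, nbr] at h1
    split_ifs at h1 <;> simp at h1
  set S : Set ℝ := {l | ∀ᶠ x : Zd 3 in cofinite, green (x + e) ≤ l * green x} with hS
  have hmem : ∀ l, (∀ᶠ x : Zd 3 in cofinite, green (x + e) ≤ l * green x) → l ∈ S := fun _ h => h
  have hK : (6 : ℝ) ∈ S := hmem _ <| Eventually.of_forall fun x => by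
    have := green_nbr_le (d := 3) le_rfl x q
    norm_num at this
    exact this
  have hneg : ∀ x : Zd 3, green x ≤ 6 * green (x + e) := fun x => by
    have := green_nbr_le (d := 3) le_rfl (x + e) (q.1, !q.2)
    have h0 : x + e + nbr (q.1, !q.2) = x := by
      rw [he, nbr, nbr]
      cases h : q.2 <;> simp
    rw [h0] at this
    norm_num at this
    exact this
  have hbdd : BddBelow S := ⟨0, fun l hl => by
    obtain ⟨x, hx⟩ := (show ∀ᶠ x : Zd 3 in cofinite, green (x + e) ≤ l * green x from hl).exists
    have h1 := hpos x
    have h2 := hpos (x + e)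
    by_contra hlt
    push Not at hlt
    nlinarith⟩
  set L := sInf S with hL
  have hup : ∀ δ > 0, L + δ ∈ S := fun δ hδ => by
    obtain ⟨l, hl, hlt⟩ := exists_lt_of_csInf_lt ⟨6, hK⟩ (show sInf S < L + δ by linarith)
    apply hmem
    filter_upwards [hl] with x hx
    exact hx.trans (mul_le_mul_of_nonneg_right hlt.le (hpos x).le)
  have hdown : ∀ δ > 0, ∃ᶠ x : Zd 3 in cofinite, (L - δ) * green x < green (x + e) := fun δ hδ => by
    intro h
    have : L - δ ∈ S := by
      apply hmem
      filter_upwards [h] with x hx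
      exact not_lt.1 hx
    linarith [csInf_le hbdd this]
  suffices hL1 : L ≤ 1 by
    filter_upwards [hup ε hε] with x hx
    exact hx.trans (mul_le_mul_of_nonneg_right (by linarith) (hpos x).le)
  by_contra hL1
  push Not at hL1
  set L' := (1 + L) / 2 with hL'
  have hL'1 : 1 < L' := by rw [hL']; linarith
  obtain ⟨k, hk⟩ := pow_unbounded_of_one_lt (2 * C / c) hL'1
  set D : ℝ := 2 * 36 ^ k with hD
  have hD0 : 0 < D := by positivity
  set δ : ℝ := (L - 1) / (2 * D) with hδ
  have hδ0 : 0 < δ := div_pos (by linarith) (by positivity)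
  set u : Zd 3 → ℝ := fun y => (L + δ) * green y - green (y + e) with hu
  have hu0 : ∀ᶠ x in cofinite, 0 ≤ u x := by
    filter_upwards [hup δ hδ0] with x hx
    simp only [hu]; linarith
  have hus : ∀ᶠ x in cofinite, avg u x ≤ u x := by
    have h1 : ∀ᶠ x : Zd 3 in cofinite, x ≠ 0 := (Set.finite_singleton 0).compl_mem_cofinite
    have h2 : ∀ᶠ x : Zd 3 in cofinite, x ≠ -e := (Set.finite_singleton (-e)).compl_mem_cofinite
    filter_upwards [h1, h2] with x hx hx'
    have h3 : x + e ≠ 0 := fun h => hx' (eq_neg_of_add_eq_zero_left h)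
    simp only [hu]
    rw [avg_sub, avg_const_mul, avg_translate]
    beta_reduce
    rw [avg_green le_rfl, avg_green le_rfl, if_neg hx,
      if_neg h3]
    simp
  have hstep : ∀ᶠ x in cofinite, ∀ j ∈ Finset.range k, u (x + (j + 1) • e) ≤ 6 * u (x + j • e) := by
    rw [Finset.eventually_all]
    intro j _
    have h1 : ∀ᶠ x in cofinite, ∀ q' : Fin 3 × Bool, 0 ≤ u (x + nbr q') :=
      eventually_all.2 fun q' => eventually_add hu0 _
    filter_upwards [eventually_add h1 (j • e), eventually_add hus (j • e)] with x hx hx'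
    have := le_mul_of_superharmonic (by norm_num) hx hx' q
    norm_num at this
    rw [add_smul, one_smul, ← add_assoc]
    exact this
  have hev := (hstep.and (eventually_f3_le (k • e))).and hu0
  obtain ⟨x, hx1, ⟨hx2, hx3⟩, hx4⟩ := ((hdown δ hδ0).and_eventually hev).exists
  have hux : u x ≤ 2 * δ * green x := by simp only [hu]; linarith
  have hj : ∀ j ≤ k, u (x + j • e) ≤ 6 ^ j * (2 * δ * green x) := by
    intro j
    induction j with
    | zero => intro _; simpa using hux
    | succ j ih =>
      intro hjk
      have h1 := hx2 j (Finset.mem_range.2 (by omega))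
      have h2 := ih (by omega)
      rw [pow_succ]; linarith
  have hgj : ∀ j : ℕ, green x ≤ 6 ^ j * green (x + j • e) := by
    intro j
    induction j with
    | zero => simp
    | succ j ih =>
      have h1 := hneg (x + j • e)
      rw [add_assoc, ← succ_nsmul] at h1
      have h6 : (0:ℝ) < 6 ^ j := by positivity
      calc _ ≤ _ := ih
        _ ≤ 6 ^ j * (6 * green (x + (j + 1) • e)) := by gcongr
        _ = _ := by rw [pow_succ]; ring
  have hgrow : ∀ j ≤ k, L' ^ j * green x ≤ green (x + j • e) := by
    intro j
    induction j with
    | zero => intro _; simp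
    | succ j ih =>
      intro hjk
      have h1 := ih (by omega)
      have h2 := hj j (by omega)
      have h3 := hgj j
      have h4 := hpos (x + j • e)
      have h5 : (6 : ℝ) ^ j * (2 * δ * green x) ≤ (L - 1) / 2 * green (x + j • e) := by
        have h36 : (36 : ℝ) ^ j ≤ 36 ^ k := pow_le_pow_right₀ (by norm_num) (by omega)
        calc _ ≤ (6 : ℝ) ^ j * (2 * δ * (6 ^ j * green (x + j • e))) := by gcongr
          _ = 36 ^ j * (2 * δ * green (x + j • e)) := by
              rw [show (36 : ℝ) = 6 * 6 by norm_num, mul_pow]; ring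
          _ ≤ 36 ^ k * (2 * δ * green (x + j • e)) := by gcongr
          _ = D * δ * green (x + j • e) := by rw [hD]; ring
          _ = _ := by rw [hδ]; field_simp
      simp only [hu] at h2
      rw [add_assoc, ← succ_nsmul] at h2
      have h6 : L' * green (x + j • e) ≤ green (x + (j + 1) • e) := by
        rw [hL']
        nlinarith
      calc L' ^ (j + 1) * green x = L' * (L' ^ j * green x) := by rw [pow_succ]; ring
        _ ≤ L' * green (x + j • e) := by gcongr
        _ ≤ _ := h6
  have h1 := hgrow k le_rfl
  have h2 := hgC (x + k • e)
  have h3 := hgc x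
  have h4 := f3_pos x
  rw [div_lt_iff₀ hc] at hk
  have h5 : L' ^ k * (c * f3 x) ≤ L' ^ k * green x := by gcongr
  have h6 : C * f3 (x + k • e) ≤ C * (2 * f3 x) := by gcongr
  have h7 : 2 * C * f3 x < L' ^ k * c * f3 x := by gcongr
  linarith

lemma eventually_green_add_le (w : Zd 3) {ε : ℝ} (hε : 0 < ε) :
    ∀ᶠ x : Zd 3 in cofinite, green (x + w) ≤ (1 + ε) * green x := by
  have hg := fun x : Zd 3 => green_nonneg (d := 3) (by norm_num) x
  let T : Set (Zd 3) := {w | ∀ ε > 0, ∀ᶠ x : Zd 3 in cofinite, green (x + w) ≤ (1 + ε) * green x}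
  have hadd : ∀ a ∈ T, ∀ b ∈ T, a + b ∈ T := fun a ha b hb ε hε => by
    set δ := min (ε / 3) 1 with hδ
    have hδ0 : 0 < δ := by positivity
    have h1 : δ ≤ ε / 3 := min_le_left _ _
    have h2 : δ ≤ 1 := min_le_right _ _
    filter_upwards [ha δ hδ0, eventually_add (hb δ hδ0) a] with x hx hx'
    rw [← add_assoc]
    calc _ ≤ (1 + δ) * ((1 + δ) * green x) := hx'.trans (by gcongr)
      _ = ((1 + δ) * (1 + δ)) * green x := by ring
      _ ≤ _ := by
          have := hg x
          gcongr
          nlinarith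
  let S : AddSubgroup (Zd 3) :=
    { carrier := {w | w ∈ T ∧ -w ∈ T}
      add_mem' := fun {a b} ha hb =>
        ⟨hadd a ha.1 b hb.1, by rw [neg_add]; exact hadd _ ha.2 _ hb.2⟩
      zero_mem' := by
        have : (0 : Zd 3) ∈ T := fun ε hε => Eventually.of_forall fun x => by
          rw [add_zero]
          nlinarith [hg x]
        exact ⟨this, by rwa [neg_zero]⟩
      neg_mem' := fun {a} ha => ⟨ha.2, by rw [neg_neg]; exact ha.1⟩ }
  have hsingle : ∀ i, (Pi.single i 1 : Zd 3) ∈ S := fun i =>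
    ⟨fun ε hε => by simpa [nbr] using eventually_green_nbr_le (i, true) hε,
      fun ε hε => by simpa [nbr] using eventually_green_nbr_le (i, false) hε⟩
  have hw : w ∈ S := by
    have : w = ∑ i, w i • (Pi.single i 1 : Zd 3) := by
      conv_lhs => rw [← Finset.univ_sum_single w]
      refine Finset.sum_congr rfl fun i _ => ?_
      rw [← Pi.single_smul]; simp
    rw [this]
    exact S.sum_mem fun i _ => S.zsmul_mem (hsingle i) _
  exact hw.1 ε hε

lemma tendsto_green_ratio (w : Zd 3) :
    Tendsto (fun x : Zd 3 => green (x - w) / green x) cofinite (𝓝 1) := by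
  obtain ⟨c, hc, hgc⟩ := exists_le_green
  have hpos := green_pos_of_le hc hgc
  rw [tendsto_order]
  constructor
  · intro a ha
    rcases le_or_gt a 0 with h0 | h0
    · exact Eventually.of_forall fun x => h0.trans_lt (div_pos (hpos _) (hpos _))
    · set ε := (1 / a - 1) / 2 with hε
      have h1 : 1 < 1 / a := (one_lt_div h0).2 ha
      have hε0 : 0 < ε := by rw [hε]; linarith
      filter_upwards [eventually_add (eventually_green_add_le w hε0) (-w)] with x hx
      rw [neg_add_cancel_right, ← sub_eq_add_neg] at hx
      rw [lt_div_iff₀ (hpos x)]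
      have h2 : 1 + ε < 1 / a := by rw [hε]; linarith
      have h3 := hpos (x - w)
      calc a * green x ≤ a * ((1 + ε) * green (x - w)) := by gcongr
        _ < a * (1 / a * green (x - w)) := by gcongr
        _ = _ := by field_simp
  · intro a ha
    set ε := (a - 1) / 2 with hε
    have hε0 : 0 < ε := by rw [hε]; linarith
    filter_upwards [eventually_green_add_le (-w) hε0] with x hx
    rw [div_lt_iff₀ (hpos x), sub_eq_add_neg]
    have := hpos x
    refine hx.trans_lt ?_
    gcongr
    rw [hε]; linarith

lemma exists_tendsto_green : ∃ a : ℝ, 0 < a ∧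
    Tendsto (fun x : Zd 3 => green x * Real.sqrt (reg x)) cofinite (𝓝 a) := by
  obtain ⟨c, hc, hgc⟩ := exists_le_green
  obtain ⟨C, hC, hgC⟩ := exists_green_le_f3 (d := 3) le_rfl
  have hpos := green_pos_of_le hc hgc
  set ρ : Zd 3 → ℝ := fun w => f3 w - avg f3 w with hρ
  have hρ0 : ∀ w, 0 ≤ ρ w := defect_f3_nonneg
  have hm : 0 < ∑' w, ρ w := by
    refine summable_defect_f3.tsum_pos hρ0 0 ?_
    exact sub_pos.2 (avg_f3_lt le_rfl 0)
  have hbound : ∀ x w : Zd 3, ‖green (x - w) / green x * ρ w‖ ≤ C / c * ((1 + len w) * ρ w) :=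
    fun x w => by
      have h1 := hpos x
      have h2 := hpos (x - w)
      have h3 := hρ0 w
      rw [Real.norm_of_nonneg (by positivity), ← mul_assoc]
      refine mul_le_mul_of_nonneg_right ?_ h3
      rw [div_le_iff₀ h1]
      have h4 := len_nonneg w
      calc green (x - w) ≤ C * ((1 + len w) * f3 x) :=
            (hgC _).trans (mul_le_mul_of_nonneg_left (f3_sub_le x w) hC.le)
        _ = C / c * (1 + len w) * (c * f3 x) := by field_simp
        _ ≤ _ := by gcongr; exact hgc x
  have hlim : Tendsto (fun x => ∑' w, green (x - w) / green x * ρ w) cofinite (𝓝 (∑' w, ρ w)) := by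
    refine tendsto_tsum_of_dominated_convergence (summable_len_mul_defect.mul_left (C / c))
      (fun w => ?_) (Eventually.of_forall fun x w => hbound x w)
    simpa using (tendsto_green_ratio w).mul_const (ρ w)
  refine ⟨(∑' w, ρ w)⁻¹, inv_pos.2 hm, ?_⟩
  refine (hlim.inv₀ hm.ne').congr fun x => ?_
  have h1 : ∑' w, green (x - w) / green x * ρ w = f3 x / green x := by
    rw [← ((riesz_f3 x).div_const (green x)).tsum_eq]
    exact tsum_congr fun w => by ring
  rw [h1, f3, inv_div, div_inv_eq_mul]

/-- Sharp asymptotics of the three-dimensional Green function. -/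
lemma green_asymptotics : ∃ a : ℝ, 0 < a ∧ ∀ δ : ℝ, 0 < δ → δ < 1 → ∃ R : ℝ, 0 < R ∧
    (∀ x : Zd 3, (1 - δ) * a / (len x + R) ≤ green x) ∧
    ∀ x : Zd 3, R ≤ len x → green x ≤ (1 + δ) * a / len x := by
  obtain ⟨c, hc, hgc⟩ := exists_le_green
  have hpos := green_pos_of_le hc hgc
  obtain ⟨a, ha, hlim⟩ := exists_tendsto_green
  refine ⟨a, ha, fun δ hδ hδ1 => ?_⟩
  have h1 : ∀ᶠ x : Zd 3 in cofinite, (1 - δ) * a < green x * Real.sqrt (reg x) ∧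
      green x * Real.sqrt (reg x) < (1 + δ) * a :=
    (hlim.eventually (lt_mem_nhds (show (1 - δ) * a < a by nlinarith))).and
      (hlim.eventually (gt_mem_nhds (show a < (1 + δ) * a by nlinarith)))
  have hfin : {x : Zd 3 | ¬ ((1 - δ) * a < green x * Real.sqrt (reg x) ∧
      green x * Real.sqrt (reg x) < (1 + δ) * a)}.Finite := h1
  set F := hfin.toFinset with hF
  have hA0 : 0 ≤ ∑ x ∈ F, a / green x :=
    Finset.sum_nonneg fun x _ => div_nonneg ha.le (hpos x).le
  have hB0 : 0 ≤ ∑ x ∈ F, len x := Finset.sum_nonneg fun x _ => len_nonneg x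
  refine ⟨45 + ∑ x ∈ F, a / green x + ∑ x ∈ F, len x, by linarith, fun x => ?_, fun x hx => ?_⟩
  · have hl := len_nonneg x
    rw [div_le_iff₀ (by linarith)]
    by_cases hxF : x ∈ F
    · have h2 : a / green x ≤ ∑ x ∈ F, a / green x :=
        Finset.single_le_sum (f := fun x => a / green x)
          (fun x _ => div_nonneg ha.le (hpos x).le) hxF
      have h3 : green x * (a / green x) = a := by have := hpos x; field_simp
      have h4 := hpos x
      have h5 : green x * (a / green x) ≤ green x * (len x + (45 + ∑ x ∈ F, a / green x + ∑ x ∈ F, len x)) := by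
        gcongr; linarith
      nlinarith
    · have h2 : (1 - δ) * a < green x * Real.sqrt (reg x) ∧
          green x * Real.sqrt (reg x) < (1 + δ) * a := by
        by_contra hcon
        exact hxF (hfin.mem_toFinset.2 hcon)
      refine h2.1.le.trans (mul_le_mul_of_nonneg_left ?_ (hpos x).le)
      linarith [sqrt_reg_le x]
  · have hxF : x ∉ F := fun hxF => by
      have : len x ≤ ∑ x ∈ F, len x :=
        Finset.single_le_sum (f := fun x => len x) (fun x _ => len_nonneg x) hxF
      linarith
    have h2 : (1 - δ) * a < green x * Real.sqrt (reg x) ∧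
        green x * Real.sqrt (reg x) < (1 + δ) * a := by
      by_contra hcon
      exact hxF (hfin.mem_toFinset.2 hcon)
    rw [le_div_iff₀ (by linarith)]
    exact (mul_le_mul_of_nonneg_left (len_le_sqrt_reg x) (hpos x).le).trans h2.2.le

lemma sum_avgN_le {f ψ : Zd d → ℝ} {κ : ℝ} (h : ∀ x, ψ x + κ * f x ≤ avg ψ x) (n : ℕ) (x : Zd d) :
    κ * ∑ k ∈ Finset.range n, avg^[k] f x ≤ avg^[n] ψ x - ψ x := by
  induction n with
  | zero => simp
  | succ n ih =>
    have h1 := avgN_mono h n x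
    rw [avgN_add, avgN_const_mul, ← Function.iterate_succ_apply avg n ψ] at h1
    rw [Finset.sum_range_succ, mul_add]
    simp only at h1
    linarith

lemma sum_avgN_green_le {f ψ : Zd d → ℝ} {κ C B : ℝ} (hκ : 0 < κ) (hC : 0 < C)
    (hg : ∀ x, green x ≤ C * f x) (h : ∀ x, ψ x + κ * f x ≤ avg ψ x) (hψ : 0 ≤ ψ 0) (n : ℕ)
    (hB : avg^[n] ψ 0 ≤ B) :
    ∑ k ∈ Finset.range n, avg^[k] green (0 : Zd d) ≤ C / κ * B := by
  have h1 := sum_avgN_le h n 0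
  have h2 : ∀ k, avg^[k] green (0 : Zd d) ≤ C * avg^[k] f 0 := fun k => by
    have := avgN_mono hg k 0
    rwa [avgN_const_mul] at this
  have h3 : ∑ k ∈ Finset.range n, avg^[k] green (0 : Zd d)
      ≤ C * ∑ k ∈ Finset.range n, avg^[k] f 0 := by
    rw [Finset.mul_sum]; exact Finset.sum_le_sum fun k _ => h2 k
  have h4 : ∑ k ∈ Finset.range n, avg^[k] f 0 ≤ B / κ := by
    rw [le_div_iff₀ hκ]; linarith
  calc _ ≤ C * (B / κ) := h3.trans (by gcongr)
    _ = _ := by ring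

lemma avgN_sqrt_reg_le (hd : 0 < d) (n : ℕ) :
    avg^[n] (fun x : Zd d => Real.sqrt (reg x)) 0 ≤ Real.sqrt (n + 2000) := by
  set c : ℝ := n + 2000 with hc
  have hc0 : 0 < c := by positivity
  have hs := Real.sqrt_pos.2 hc0
  have h : ∀ x : Zd d, Real.sqrt (reg x) ≤ Real.sqrt c / 2 + (1 / (2 * Real.sqrt c)) * reg x := by
    intro x
    have h1 := Real.sq_sqrt (reg_pos x).le
    have h2 : Real.sqrt c / 2 + (1 / (2 * Real.sqrt c)) * reg x
        = (Real.sqrt c ^ 2 + Real.sqrt (reg x) ^ 2) / (2 * Real.sqrt c) := by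
      rw [h1]; field_simp
    rw [h2, le_div_iff₀ (by positivity)]
    nlinarith [sq_nonneg (Real.sqrt c - Real.sqrt (reg x))]
  refine (avgN_mono h n 0).trans (le_of_eq ?_)
  rw [avgN_add, avgN_const hd, avgN_const_mul]
  simp only
  rw [avgN_reg hd]
  have h0 : reg (0 : Zd d) + n = Real.sqrt c ^ 2 := by
    rw [Real.sq_sqrt hc0.le, reg, nsq_zero, hc]; ring
  rw [h0]
  field_simp
  ring

lemma avgN_log_reg_le (hd : 0 < d) (n : ℕ) :
    avg^[n] (fun x : Zd d => Real.log (reg x)) 0 ≤ Real.log (n + 2000) := by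
  set c : ℝ := n + 2000 with hc
  have hc0 : 0 < c := by positivity
  have h : ∀ x : Zd d, Real.log (reg x) ≤ (Real.log c - 1) + (1 / c) * reg x := by
    intro x
    have h1 := Real.log_le_sub_one_of_pos (div_pos (reg_pos x) hc0)
    rw [Real.log_div (reg_pos x).ne' hc0.ne'] at h1
    have : 1 / c * reg x = reg x / c := by ring
    linarith
  refine (avgN_mono h n 0).trans (le_of_eq ?_)
  rw [avgN_add, avgN_const hd, avgN_const_mul]
  simp only
  rw [avgN_reg hd]
  have h0 : reg (0 : Zd d) + n = c := by
    rw [reg, nsq_zero, hc]; ring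
  rw [h0]
  field_simp
  ring

lemma exists_sum_avgN_green3 : ∃ C : ℝ, 0 < C ∧ ∀ n : ℕ,
    ∑ k ∈ Finset.range n, avg^[k] green (0 : Zd 3) ≤ C * Real.sqrt (n + 2000) := by
  obtain ⟨C, hC, hgC⟩ := exists_green_le_f3 (d := 3) le_rfl
  exact ⟨C / (1 / 6), by positivity, fun n => sum_avgN_green_le (by norm_num) hC hgC avg_sqrt_reg
    (Real.sqrt_nonneg _) n (avgN_sqrt_reg_le (by norm_num) n)⟩

lemma exists_sum_avgN_green4 : ∃ C : ℝ, 0 < C ∧ ∀ n : ℕ,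
    ∑ k ∈ Finset.range n, avg^[k] green (0 : Zd 4) ≤ C * Real.log (n + 2000) := by
  obtain ⟨C, hC, hgC⟩ := exists_green_le_f4
  exact ⟨C / (1 / 4), by positivity, fun n => sum_avgN_green_le (by norm_num) hC hgC avg_log_reg
    (Real.log_nonneg (by linarith [le_reg (0 : Zd 4)])) n (avgN_log_reg_le (by norm_num) n)⟩

section Balls

lemma mem_ballZ {x y : Zd d} {r : ℝ} : y ∈ ballZ x r ↔ len (x - y) ≤ r := Iff.rfl

lemma finite_ballZ (x : Zd d) (r : ℝ) : (ballZ x r).Finite := by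
  have h : ballZ x r ⊆ (fun y => x - y) '' {y | nsq y ≤ r ^ 2} := fun y hy => by
    refine ⟨x - y, ?_, by simp⟩
    have hy' : len (x - y) ≤ r := hy
    change nsq (x - y) ≤ r ^ 2
    rw [← len_sq]
    exact pow_le_pow_left₀ (len_nonneg _) hy' 2
  exact ((finite_nsq_le _).image _).subset h

lemma visited_subset {V : Type} (A : Set V) (ω : ℕ → V) : visited A ω ⊆ A := by
  rintro v ⟨k, h, rfl⟩
  exact h k le_rfl

/-- The points visited before exiting a ball, as a finite set. -/
def visF (x : Zd d) (r : ℝ) (ω : ℕ → Zd d) : Finset (Zd d) :=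
  ((finite_ballZ x r).subset (visited_subset _ ω)).toFinset

lemma coe_visF (x : Zd d) (r : ℝ) (ω : ℕ → Zd d) :
    (visF x r ω : Set (Zd d)) = visited (ballZ x r) ω := Set.Finite.coe_toFinset _

lemma mem_visF {x : Zd d} {r : ℝ} {ω : ℕ → Zd d} {v : Zd d} :
    v ∈ visF x r ω ↔ v ∈ visited (ballZ x r) ω := Set.Finite.mem_toFinset _

lemma measurableSet_mem_visited (A : Set (Zd d)) (v : Zd d) :
    MeasurableSet {ω | v ∈ visited A ω} := by
  have : {ω | v ∈ visited A ω} = ⋃ k : ℕ, {ω | (∀ n ≤ k, ω n ∈ A) ∧ ω k = v} := by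
    ext ω; simp [visited]
  rw [this]
  refine MeasurableSet.iUnion fun k => DetBy.measurableSet (n := k) fun ω ω' h => ?_
  have h1 : (∀ n ≤ k, ω n ∈ A) ↔ ∀ n ≤ k, ω' n ∈ A :=
    forall₂_congr fun n hn => by rw [h n hn]
  change _ ∧ _ ↔ _ ∧ _
  rw [h1, h k le_rfl]

lemma measurable_pair_fun {β : Type} [MeasurableSpace β] (F : Zd d → β) (i j : ℕ) :
    Measurable fun ω : ℕ → Zd d => F (ω i - ω j) := by
  have h1 : Measurable (fun q : Zd d × Zd d => F (q.1 - q.2)) := measurable_of_countable _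
  have h2 : Measurable (fun ω : ℕ → Zd d => (ω i, ω j)) :=
    (measurable_pi_apply i).prodMk (measurable_pi_apply j)
  exact h1.comp h2

lemma measurableSet_visF (x : Zd d) (r : ℝ) (p : Finset (Zd d) → Prop) :
    MeasurableSet {ω | p (visF x r ω)} := by
  have h1 : ∀ B : Finset (Zd d), MeasurableSet {ω | visF x r ω = B} := fun B => by
    have : {ω | visF x r ω = B} = ⋂ v, {ω | v ∈ visited (ballZ x r) ω ↔ v ∈ B} := by
      ext ω
      simp only [Set.mem_iInter, Finset.ext_iff, mem_visF]
      rfl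
    rw [this]
    refine MeasurableSet.iInter fun v => ?_
    by_cases hv : v ∈ B
    · simpa [hv] using measurableSet_mem_visited (ballZ x r) v
    · have h := (measurableSet_mem_visited (ballZ x r) v).compl
      convert h using 1
      ext ω
      simp [hv]
  have : {ω | p (visF x r ω)} = ⋃ B : {B : Finset (Zd d) // p B}, {ω | visF x r ω = B} := by
    ext ω
    simp only [Set.mem_iUnion, Subtype.exists]
    constructor
    · intro h; exact ⟨_, h, rfl⟩
    · rintro ⟨B, hB, rfl⟩; exact hB
  rw [this]
  exact MeasurableSet.iUnion fun B => h1 B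

end Balls

section Walk

variable {P : Zd d → Measure (ℕ → Zd d)}

lemma WalkLaw.exit_le (hW : WalkLaw d P) (hd : 0 < d) (z : Zd d) {R : ℝ} (hR : 0 < R) (k : ℕ)
    (x : Zd d) :
    (P x).real {ω | ∃ j ≤ k, ω j ∉ ballZ z R} ≤ (nsq (x - z) + k) / R ^ 2 := by
  have := hW.prob
  by_cases hx : x ∈ ballZ z R
  · induction k generalizing x with
    | zero =>
      have : (P x).real {ω | ∃ j ≤ 0, ω j ∉ ballZ z R} = 0 := by
        unfold Measure.real
        rw [measure_eq_zero_iff_ae_notMem.2, ENNReal.toReal_zero]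
        filter_upwards [hW.ae_start x] with ω h0
        rintro ⟨j, hj, h⟩
        rw [Nat.le_zero.1 hj, h0] at h
        exact h hx
      rw [this]
      have := nsq_nonneg (x - z)
      positivity
    | succ k ih =>
      have hdet : DetBy (k + 1) {ω : ℕ → Zd d | ∃ j ≤ k + 1, ω j ∉ ballZ z R} := fun ω ω' h =>
        exists_congr fun j => and_congr_right fun hj => by rw [h j hj]
      rw [hW.real_one_step hd x hdet.measurableSet]
      have heq : cons x ⁻¹' {ω : ℕ → Zd d | ∃ j ≤ k + 1, ω j ∉ ballZ z R}
          = {ω | ∃ j ≤ k, ω j ∉ ballZ z R} := by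
        ext ω
        constructor
        · rintro ⟨j, hj, h⟩
          rcases j with _ | j
          · exact absurd hx h
          · exact ⟨j, by omega, by simpa using h⟩
        · rintro ⟨j, hj, h⟩
          exact ⟨j + 1, by omega, by simpa using h⟩
      rw [heq]
      refine (avg_mono (g := fun y => (1 / R ^ 2) * nsq (y + -z) + k / R ^ 2) (fun y => ?_) x).trans
        (le_of_eq ?_)
      · have hb : (P y).real {ω | ∃ j ≤ k, ω j ∉ ballZ z R} ≤ (nsq (y - z) + k) / R ^ 2 := by
          by_cases hy : y ∈ ballZ z R
          · exact ih y hy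
          · have h1 : R < len (z - y) := not_le.1 hy
            rw [← len_neg, neg_sub] at h1
            have h2 : R ^ 2 ≤ nsq (y - z) := by
              rw [← len_sq]; exact pow_le_pow_left₀ hR.le h1.le 2
            refine measureReal_le_one.trans ?_
            rw [le_div_iff₀ (by positivity)]
            have : (0:ℝ) ≤ k := by positivity
            linarith
        refine hb.trans (le_of_eq ?_)
        rw [sub_eq_add_neg]; ring
      · rw [avg_add, avg_const_mul, avg_const hd]
        simp only
        rw [avg_translate nsq (-z)]
        simp only
        rw [avg_nsq hd, ← sub_eq_add_neg]
        push_cast; ring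
  · have h1 : R < len (z - x) := not_le.1 hx
    rw [← len_neg, neg_sub] at h1
    have h2 : R ^ 2 ≤ nsq (x - z) := by
      rw [← len_sq]; exact pow_le_pow_left₀ hR.le h1.le 2
    refine measureReal_le_one.trans ?_
    rw [le_div_iff₀ (by positivity)]
    have : (0:ℝ) ≤ k := by positivity
    linarith

lemma WalkLaw.lintegral_increment (hW : WalkLaw d P) (hd : 0 < d) {φ : Zd d → ℝ} (hφ : ∀ x, 0 ≤ φ x)
    (i k : ℕ) (x : Zd d) :
    ∫⁻ ω, ENNReal.ofReal (φ (ω i - ω (i + k))) ∂(P x) = ENNReal.ofReal (avg^[k] φ 0) := by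
  have := hW.prob
  induction i generalizing x with
  | zero =>
    have h1 := hW.lintegral_eval hd (φ := fun y => φ (x - y)) (fun y => hφ _) k x
    rw [avgN_reflect] at h1
    simp only [sub_self] at h1
    rw [← h1]
    refine lintegral_congr_ae ?_
    filter_upwards [hW.ae_start x] with ω h0
    rw [h0, zero_add]
  | succ i ih =>
    have hm : Measurable fun ω : ℕ → Zd d => ENNReal.ofReal (φ (ω (i + 1) - ω (i + 1 + k))) :=
      measurable_pair_fun (fun v => ENNReal.ofReal (φ v)) _ _
    rw [hW.lintegral_one_step hd x hm]
    have h2 : ∀ ω : ℕ → Zd d, cons x ω (i + 1) - cons x ω (i + 1 + k) = ω i - ω (i + k) := fun ω => by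
      rw [show i + 1 + k = (i + k) + 1 by ring, cons_succ, cons_succ]
    simp_rw [h2, ih]
    rw [Finset.sum_const, Finset.card_univ, Fintype.card_prod, Fintype.card_fin, Fintype.card_bool,
      nsmul_eq_mul, ← mul_assoc]
    have : ((d * 2 : ℕ) : ℝ≥0∞) * (2 * d : ℝ≥0∞)⁻¹ = 1 := by
      push_cast
      rw [mul_comm (d : ℝ≥0∞) 2]
      exact ENNReal.mul_inv_cancel (by simp; omega) (by finiteness)
    rw [this, one_mul]

/-- Self-energy of the first `t` points of a trajectory. -/
def energy (t : ℕ) (ω : ℕ → Zd d) : ℝ :=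
  ∑ i ∈ Finset.range t, ∑ j ∈ Finset.range t, green (ω i - ω j)

lemma sum_range_dist_le {a : ℕ → ℝ} (ha : ∀ k, 0 ≤ a k) {t i : ℕ} (hi : i < t) :
    ∑ j ∈ Finset.range t, a (Nat.dist i j) ≤ 2 * ∑ k ∈ Finset.range t, a k := by
  have h1 : ∑ j ∈ Finset.range (i + 1), a (Nat.dist i j) = ∑ k ∈ Finset.range (i + 1), a k := by
    rw [← Finset.sum_range_reflect]
    refine Finset.sum_congr rfl fun j hj => ?_
    have := Finset.mem_range.1 hj
    congr 1
    unfold Nat.dist; omega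
  have h2 : ∑ j ∈ Finset.Ico (i + 1) t, a (Nat.dist i j) ≤ ∑ k ∈ Finset.range t, a k := by
    rw [Finset.sum_Ico_eq_sum_range]
    calc _ = ∑ k ∈ Finset.range (t - (i + 1)), a (k + 1) :=
          Finset.sum_congr rfl fun k _ => by congr 1; unfold Nat.dist; omega
      _ ≤ ∑ k ∈ Finset.range (t - (i + 1) + 1), a k := by
          rw [Finset.sum_range_succ']; linarith [ha 0]
      _ ≤ _ := Finset.sum_le_sum_of_subset_of_nonneg
          (Finset.range_subset_range.2 (by omega)) fun _ _ _ => ha _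
  have h3 : ∑ k ∈ Finset.range (i + 1), a k ≤ ∑ k ∈ Finset.range t, a k :=
    Finset.sum_le_sum_of_subset_of_nonneg (Finset.range_subset_range.2 (by omega)) fun _ _ _ => ha _
  rw [← Finset.sum_range_add_sum_Ico _ (show i + 1 ≤ t by omega), h1]
  linarith

lemma WalkLaw.lintegral_energy_le (hW : WalkLaw d P) (hd : 0 < d) (t : ℕ) {Γ : ℝ}
    (hΓ : ∑ k ∈ Finset.range t, avg^[k] green (0 : Zd d) ≤ Γ) (x : Zd d) :
    ∫⁻ ω, ENNReal.ofReal (energy t ω) ∂(P x) ≤ ENNReal.ofReal (2 * t * Γ) := by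
  have hg := green_nonneg hd
  have ha : ∀ k, 0 ≤ avg^[k] green (0 : Zd d) := fun k => avgN_nonneg hd hg k 0
  have hm : ∀ i j, Measurable fun ω : ℕ → Zd d => ENNReal.ofReal (green (ω i - ω j)) := fun i j =>
    measurable_pair_fun (fun v => ENNReal.ofReal (green v)) i j
  have hpair : ∀ i j, ∫⁻ ω, ENNReal.ofReal (green (ω i - ω j)) ∂(P x)
      = ENNReal.ofReal (avg^[Nat.dist i j] green 0) := fun i j => by
    rcases le_total i j with h | h
    · have := hW.lintegral_increment hd hg i (j - i) x
      rw [show i + (j - i) = j by omega] at this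
      rw [this, Nat.dist_eq_sub_of_le h]
    · have := hW.lintegral_increment hd hg j (i - j) x
      rw [show j + (i - j) = i by omega] at this
      simp_rw [green_sub_comm _ _] at this ⊢
      rw [Nat.dist_eq_sub_of_le_right h, ← this]
  unfold energy
  simp_rw [fun ω : ℕ → Zd d => ENNReal.ofReal_sum_of_nonneg (s := Finset.range t)
    (f := fun i => ∑ j ∈ Finset.range t, green (ω i - ω j))
    fun i _ => Finset.sum_nonneg fun j _ => hg _,
    fun (ω : ℕ → Zd d) i => ENNReal.ofReal_sum_of_nonneg (s := Finset.range t)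
    (f := fun j => green (ω i - ω j)) fun j _ => hg _]
  rw [lintegral_finsetSum _ fun i _ => Finset.measurable_fun_sum _ fun j _ => hm i j]
  simp_rw [lintegral_finsetSum _ fun j _ => hm _ j, hpair]
  simp_rw [fun i => (ENNReal.ofReal_sum_of_nonneg (s := Finset.range t)
    (f := fun j => avg^[Nat.dist i j] green (0 : Zd d)) fun j _ => ha _).symm]
  rw [← ENNReal.ofReal_sum_of_nonneg fun i _ => Finset.sum_nonneg fun j _ => ha _]
  refine ENNReal.ofReal_le_ofReal ?_
  calc _ ≤ ∑ i ∈ Finset.range t, 2 * Γ := Finset.sum_le_sum fun i hi =>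
        (sum_range_dist_le ha (Finset.mem_range.1 hi)).trans (by linarith)
    _ = _ := by rw [Finset.sum_const, Finset.card_range, nsmul_eq_mul]; ring

/-- Low self-energy forces large capacity. -/
lemma WalkLaw.sq_le_energy_mul_capF (hW : WalkLaw d P) (hd : 3 ≤ d) {t : ℕ} (ht : 0 < t)
    {ω : ℕ → Zd d} {l : ℝ} (hl : 0 < l) (hω : energy t ω ≤ l) {X : Finset (Zd d)}
    (hX : ∀ i < t, ω i ∈ X) : (t : ℝ) ^ 2 ≤ 4 * l * capF P X := by
  have hg := green_nonneg (d := d) (by omega)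
  have ht' : (0 : ℝ) < t := by exact_mod_cast ht
  set I := (Finset.range t).filter fun i => ∑ j ∈ Finset.range t, green (ω i - ω j) ≤ 2 * l / t
  set J := (Finset.range t).filter fun i => ¬ ∑ j ∈ Finset.range t, green (ω i - ω j) ≤ 2 * l / t
  have hIJ : I.card + J.card = t := by
    rw [Finset.card_filter_add_card_filter_not, Finset.card_range]
  have hJ : (J.card : ℝ) * (2 * l / t) ≤ l := by
    calc _ = ∑ i ∈ J, 2 * l / t := by rw [Finset.sum_const, nsmul_eq_mul]
      _ ≤ ∑ i ∈ J, ∑ j ∈ Finset.range t, green (ω i - ω j) := Finset.sum_le_sum fun i hi =>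
          (not_le.1 (Finset.mem_filter.1 hi).2).le
      _ ≤ energy t ω := Finset.sum_le_sum_of_subset_of_nonneg (Finset.filter_subset _ _)
          fun i _ _ => Finset.sum_nonneg fun j _ => hg _
      _ ≤ l := hω
  have hJ' : (J.card : ℝ) ≤ t / 2 := by
    have h1 : (J.card : ℝ) * (2 * l / t) = (2 * J.card / t) * l := by ring
    rw [h1] at hJ
    have h2 : (2 * J.card / t : ℝ) ≤ 1 := by
      by_contra hc
      push Not at hc
      nlinarith
    rw [div_le_one ht'] at h2
    linarith
  have hI : (t : ℝ) / 2 ≤ I.card := by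
    have : (I.card : ℝ) + J.card = t := by exact_mod_cast hIJ
    linarith
  set A := I.image ω with hA
  have hAX : A ⊆ X := by
    intro v hv
    obtain ⟨i, hi, rfl⟩ := Finset.mem_image.1 hv
    exact hX i (Finset.mem_range.1 (Finset.mem_filter.1 hi).1)
  have hmaps : ∀ i ∈ I, ω i ∈ A := fun i hi => Finset.mem_image_of_mem _ hi
  have key := hW.le_capF_mul hd A (ν := fun a => ((I.filter fun i => ω i = a).card : ℝ))
    (S := 2 * l / t) fun b hb => by
      obtain ⟨i, hi, rfl⟩ := Finset.mem_image.1 hb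
      have h1 : ∑ a ∈ A, green (ω i - a) * ((I.filter fun i => ω i = a).card : ℝ)
          = ∑ j ∈ I, green (ω i - ω j) := by
        rw [← Finset.sum_fiberwise_of_maps_to hmaps]
        refine Finset.sum_congr rfl fun a _ => ?_
        rw [Finset.sum_congr rfl (g := fun _ => green (ω i - a)) fun j hj => by
          rw [(Finset.mem_filter.1 hj).2], Finset.sum_const, nsmul_eq_mul, mul_comm]
      rw [h1]
      exact (Finset.sum_le_sum_of_subset_of_nonneg (Finset.filter_subset _ _)
        fun j _ _ => hg _).trans (Finset.mem_filter.1 hi).2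
  have h2 : ∑ a ∈ A, ((I.filter fun i => ω i = a).card : ℝ) = I.card := by
    exact_mod_cast (Finset.card_eq_sum_card_fiberwise hmaps).symm
  rw [h2] at key
  have h3 := hW.capF_mono hd hAX
  have h4 : (t : ℝ) / 2 ≤ capF P X * (2 * l / t) :=
    hI.trans (key.trans (mul_le_mul_of_nonneg_right h3 (by positivity)))
  have h5 : capF P X * (2 * l / t) * t = 2 * l * capF P X := by field_simp
  nlinarith

/-- With high probability the walk has collected a large capacity before leaving a ball. -/
lemma WalkLaw.prob_small_cap_le (hW : WalkLaw d P) (hd : 3 ≤ d) {t : ℕ} (ht : 0 < t) {Γ : ℝ}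
    (hΓ0 : 0 < Γ) (hΓ : ∑ k ∈ Finset.range t, avg^[k] green (0 : Zd d) ≤ Γ) {ε R : ℝ} (hε : 0 < ε)
    (hR : 0 < R) (htR : t ≤ ε / 2 * R ^ 2) (z : Zd d) :
    (P z).real {ω | capF P (visF z R ω) < ε * t / (16 * Γ)} ≤ ε := by
  have := hW.prob
  have ht' : (0 : ℝ) < t := by exact_mod_cast ht
  set l : ℝ := 4 * t * Γ / ε with hl
  have hl0 : 0 < l := by positivity
  have hsub : {ω | capF P (visF z R ω) < ε * t / (16 * Γ)}
      ⊆ {ω | ∃ j ≤ t, ω j ∉ ballZ z R} ∪ {ω | ENNReal.ofReal l ≤ ENNReal.ofReal (energy t ω)} := by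
    intro ω hω
    by_contra hcon
    rw [Set.mem_union, not_or] at hcon
    obtain ⟨h1, h2⟩ := hcon
    have h1' : ∀ j ≤ t, ω j ∈ ballZ z R := fun j hj => by
      by_contra hc; exact h1 ⟨j, hj, hc⟩
    have h2' : energy t ω ≤ l := by
      by_contra hc
      exact h2 (ENNReal.ofReal_le_ofReal (not_le.1 hc).le)
    have h3 := hW.sq_le_energy_mul_capF hd ht hl0 h2' (X := visF z R ω) fun i hi =>
      mem_visF.2 ⟨i, fun n hn => h1' n (by omega), rfl⟩
    have hω' : capF P (visF z R ω) < ε * t / (16 * Γ) := hω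
    have h4 : 4 * l * capF P (visF z R ω) < 4 * l * (ε * t / (16 * Γ)) := by gcongr
    have h5 : 4 * l * (ε * t / (16 * Γ)) = t ^ 2 := by rw [hl]; field_simp; norm_num
    linarith
  have hA : (P z).real {ω | ∃ j ≤ t, ω j ∉ ballZ z R} ≤ ε / 2 := by
    refine (hW.exit_le (by omega) z hR t z).trans ?_
    rw [sub_self, nsq_zero, zero_add, div_le_iff₀ (by positivity)]
    exact htR
  have hB : (P z).real {ω | ENNReal.ofReal l ≤ ENNReal.ofReal (energy t ω)} ≤ ε / 2 := by
    have hm : Measurable fun ω : ℕ → Zd d => ENNReal.ofReal (energy t ω) := by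
      refine ENNReal.measurable_ofReal.comp ?_
      unfold energy
      refine Finset.measurable_fun_sum _ fun i _ => Finset.measurable_fun_sum _ fun j _ => ?_
      exact measurable_pair_fun green i j
    have h1 := (mul_meas_ge_le_lintegral (μ := P z) hm (ENNReal.ofReal l)).trans
      (hW.lintegral_energy_le (by omega) t hΓ z)
    have h2 : l * (P z).real {ω | ENNReal.ofReal l ≤ ENNReal.ofReal (energy t ω)} ≤ 2 * t * Γ := by
      have := ENNReal.toReal_mono ENNReal.ofReal_ne_top h1
      rw [ENNReal.toReal_mul, ENNReal.toReal_ofReal hl0.le,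
        ENNReal.toReal_ofReal (by positivity)] at this
      exact this
    have h3 : 2 * t * Γ = l * (ε / 2) := by rw [hl]; field_simp; norm_num
    rw [h3] at h2
    exact le_of_mul_le_mul_left h2 hl0
  calc _ ≤ (P z).real ({ω | ∃ j ≤ t, ω j ∉ ballZ z R} ∪
        {ω | ENNReal.ofReal l ≤ ENNReal.ofReal (energy t ω)}) := measureReal_mono hsub
    _ ≤ _ := (measureReal_union_le _ _).trans (by linarith)

end Walk

lemma mem_ballZ_zero {y : Zd d} {r : ℝ} : y ∈ ballZ 0 r ↔ len y ≤ r := by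
  rw [mem_ballZ, zero_sub, len_neg]

/-- The path leaves `B(0,ρ)` for the first time at time `n`, at distance at most one. -/
def firstExit (ρ : ℝ) (n : ℕ) : Set (ℕ → Zd d) :=
  {ω | (∀ k < n, len (ω k) ≤ ρ) ∧ ρ < len (ω n) ∧ len (ω n) ≤ ρ + 1}

lemma detBy_firstExit (ρ : ℝ) (n : ℕ) : DetBy n (firstExit (d := d) ρ n) := by
  intro ω ω' h
  have h1 : (∀ k < n, len (ω k) ≤ ρ) ↔ ∀ k < n, len (ω' k) ≤ ρ :=
    forall₂_congr fun k hk => by rw [h k hk.le]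
  change _ ∧ _ ↔ _ ∧ _
  rw [h1, h n le_rfl]

lemma firstExit_unique {ρ : ℝ} {n m : ℕ} {ω : ℕ → Zd d} (hn : ω ∈ firstExit ρ n)
    (hm : ω ∈ firstExit ρ m) : n = m := by
  rcases lt_trichotomy n m with h | h | h
  · exact absurd (hm.1 n h) (not_le.2 hn.2.1)
  · exact h
  · exact absurd (hn.1 m h) (not_le.2 hm.2.1)

/-- The event that the path, restarted on leaving `B(0,ρ)`, satisfies `V`. -/
def afterExit (V : Zd d → Set (ℕ → Zd d)) (ρ : ℝ) : Set (ℕ → Zd d) :=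
  {ω | ∃ n, ω ∈ firstExit ρ n ∧ (fun m => ω (n + m)) ∈ V (ω n)}

lemma detBy_inter_afterExit {V : Zd d → Set (ℕ → Zd d)} {R : ℝ}
    (hloc : ∀ (z : Zd d) (m : ℕ) (ω ω' : ℕ → Zd d), ω m ∉ ballZ z R → (∀ i ≤ m, ω i = ω' i) →
      ω ∈ V z → ω' ∈ V z) {ρ : ℕ → ℝ} (k n : ℕ) (S : Finset ℕ)
    (hρ : ∀ j ∈ S, ρ j + 1 + R ≤ ρ k) (hR : 0 ≤ R) :
    DetBy n (firstExit (ρ k) n ∩ ⋂ j ∈ S, afterExit V (ρ j)) := by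
  have key : ∀ ω ω' : ℕ → Zd d, (∀ i ≤ n, ω i = ω' i) →
      ω ∈ firstExit (ρ k) n ∩ ⋂ j ∈ S, afterExit V (ρ j) →
      ω' ∈ firstExit (ρ k) n ∩ ⋂ j ∈ S, afterExit V (ρ j) := by
    rintro ω ω' h ⟨h1, h2⟩
    refine ⟨(detBy_firstExit _ _ ω ω' h).1 h1, ?_⟩
    simp only [Set.mem_iInter] at h2 ⊢
    intro j hj
    obtain ⟨m, hm, hV⟩ := h2 j hj
    have hjk := hρ j hj
    have hmn : m ≤ n := by
      by_contra hc
      have := hm.1 n (not_le.1 hc)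
      linarith [h1.2.1]
    refine ⟨m, (detBy_firstExit _ _ ω ω' fun i hi => h i (hi.trans hmn)).1 hm, ?_⟩
    rw [← h m hmn]
    refine hloc (ω m) (n - m) _ _ ?_ (fun i hi => h _ (by omega)) hV
    rw [mem_ballZ, show m + (n - m) = n by omega]
    intro hc
    have h3 := len_sub_le (ω m) (ω m - ω n)
    rw [sub_sub_cancel] at h3
    linarith [h1.2.1, hm.2.2]
  exact fun ω ω' h => ⟨key ω ω' h, key ω' ω fun i hi => (h i hi).symm⟩

section Walk

variable {P : Zd d → Measure (ℕ → Zd d)}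

lemma WalkLaw.iInter_afterExit_le (hW : WalkLaw d P) (hd : 0 < d) {V : Zd d → Set (ℕ → Zd d)}
    (hV : ∀ z, MeasurableSet (V z)) {ε R : ℝ} (hε : 0 ≤ ε) (hVε : ∀ z, (P z).real (V z) ≤ ε)
    (hloc : ∀ (z : Zd d) (m : ℕ) (ω ω' : ℕ → Zd d), ω m ∉ ballZ z R → (∀ i ≤ m, ω i = ω' i) →
      ω ∈ V z → ω' ∈ V z) {ρ : ℕ → ℝ} (hρ : ∀ i j, i < j → ρ i + 1 + R ≤ ρ j) (hR : 0 ≤ R)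
    (x : Zd d) (S : Finset ℕ) :
    P x (⋂ j ∈ S, afterExit V (ρ j)) ≤ ENNReal.ofReal (ε ^ S.card) := by
  have := hW.prob
  induction S using Finset.induction_on_max with
  | empty => simp
  | insert k S hk ih =>
    have hdet := fun n => detBy_inter_afterExit hloc k n S (fun j hj => hρ j k (hk j hj)) hR
    have hsub : ⋂ j ∈ insert k S, afterExit V (ρ j) ⊆
        ⋃ n, ((firstExit (ρ k) n ∩ ⋂ j ∈ S, afterExit V (ρ j)) ∩
          {ω | (fun m => ω (n + m)) ∈ V (ω n)}) := by
      intro ω hω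
      simp only [Set.mem_iInter, Finset.mem_insert] at hω
      obtain ⟨n, hn, hnV⟩ := hω k (Or.inl rfl)
      refine Set.mem_iUnion.2 ⟨n, ⟨hn, ?_⟩, hnV⟩
      simp only [Set.mem_iInter]
      exact fun j hj => hω j (Or.inr hj)
    calc _ ≤ ∑' n, P x ((firstExit (ρ k) n ∩ ⋂ j ∈ S, afterExit V (ρ j)) ∩
          {ω | (fun m => ω (n + m)) ∈ V (ω n)}) := (measure_mono hsub).trans (measure_iUnion_le _)
      _ ≤ ∑' n, ENNReal.ofReal ε * P x (firstExit (ρ k) n ∩ ⋂ j ∈ S, afterExit V (ρ j)) := by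
        refine ENNReal.tsum_le_tsum fun n => ?_
        have h1 := hW.markov_past_le hd hV hε hVε n (hdet n) x
        rw [← ofReal_measureReal, ← ofReal_measureReal (s := _ ∩ ⋂ j ∈ S, _),
          ← ENNReal.ofReal_mul hε]
        exact ENNReal.ofReal_le_ofReal h1
      _ = ENNReal.ofReal ε * P x (⋃ n, (firstExit (ρ k) n ∩ ⋂ j ∈ S, afterExit V (ρ j))) := by
        rw [ENNReal.tsum_mul_left, measure_iUnion ?_ fun n => (hdet n).measurableSet]
        intro n m hnm
        refine Set.disjoint_left.2 fun ω h1 h2 => hnm (firstExit_unique h1.1 h2.1)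
      _ ≤ ENNReal.ofReal ε * ENNReal.ofReal (ε ^ S.card) := by
        gcongr
        exact (measure_mono (Set.iUnion_subset fun n => Set.inter_subset_right)).trans ih
      _ = _ := by
        rw [Finset.card_insert_of_notMem fun h => lt_irrefl _ (hk k h), pow_succ',
          ENNReal.ofReal_mul hε]

lemma two_pow_mul_le {δ : ℝ} (hδ : 0 < δ) {M m : ℕ} (hm : δ * M ≤ m) :
    (2 : ℝ) ^ M * Real.exp (-(2 / δ)) ^ m ≤ Real.exp (-M) := by
  have h1 : (2 : ℝ) ^ M ≤ Real.exp M := by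
    rw [← Real.exp_one_pow]
    gcongr
    linarith [Real.add_one_le_exp (1 : ℝ)]
  have h2 : Real.exp (-(2 / δ)) ^ m ≤ Real.exp (-(2 * M)) := by
    rw [← Real.exp_nat_mul]
    apply Real.exp_le_exp.2
    have : m * -(2 / δ) = -(2 * (m / δ)) := by ring
    rw [this]
    have : (M : ℝ) ≤ m / δ := by rw [le_div_iff₀ hδ]; linarith
    linarith
  calc _ ≤ Real.exp M * Real.exp (-(2 * M)) := by gcongr
    _ = _ := by rw [← Real.exp_add]; congr 1; ring

lemma WalkLaw.many_afterExit_le (hW : WalkLaw d P) (hd : 0 < d) {V : Zd d → Set (ℕ → Zd d)}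
    (hV : ∀ z, MeasurableSet (V z)) {δ R : ℝ} (hδ : 0 < δ)
    (hVε : ∀ z, (P z).real (V z) ≤ Real.exp (-(2 / δ)))
    (hloc : ∀ (z : Zd d) (m : ℕ) (ω ω' : ℕ → Zd d), ω m ∉ ballZ z R → (∀ i ≤ m, ω i = ω' i) →
      ω ∈ V z → ω' ∈ V z) {ρ : ℕ → ℝ} (hρ : ∀ i j, i < j → ρ i + 1 + R ≤ ρ j) (hR : 0 ≤ R)
    (x : Zd d) (M : ℕ) :
    P x {ω | δ * M ≤ ((Finset.range M).filter fun j => ω ∈ afterExit V (ρ j)).card}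
      ≤ ENNReal.ofReal (Real.exp (-M)) := by
  set T := (Finset.range M).powerset.filter fun S => δ * M ≤ S.card with hT
  have hsub : {ω | δ * M ≤ ((Finset.range M).filter fun j => ω ∈ afterExit V (ρ j)).card}
      ⊆ ⋃ S ∈ T, ⋂ j ∈ S, afterExit V (ρ j) := by
    intro ω hω
    simp only [Set.mem_iUnion]
    refine ⟨(Finset.range M).filter fun j => ω ∈ afterExit V (ρ j), ?_, ?_⟩
    · rw [hT, Finset.mem_filter, Finset.mem_powerset]
      exact ⟨Finset.filter_subset _ _, hω⟩
    · simp only [Set.mem_iInter]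
      exact fun j hj => (Finset.mem_filter.1 hj).2
  have hTc : (T.card : ℝ) ≤ 2 ^ M := by
    have := Finset.card_filter_le (Finset.range M).powerset fun S => δ * M ≤ (S.card : ℝ)
    rw [Finset.card_powerset, Finset.card_range] at this
    exact_mod_cast this
  calc _ ≤ ∑ S ∈ T, P x (⋂ j ∈ S, afterExit V (ρ j)) :=
        (measure_mono hsub).trans (measure_biUnion_finset_le _ _)
    _ ≤ ∑ S ∈ T, ENNReal.ofReal (Real.exp (-M) / 2 ^ M) := by
        refine Finset.sum_le_sum fun S hS =>
          (hW.iInter_afterExit_le hd hV (Real.exp_nonneg _) hVε hloc hρ hR x S).trans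
            (ENNReal.ofReal_le_ofReal ?_)
        rw [le_div_iff₀ (by positivity), mul_comm]
        exact two_pow_mul_le hδ (Finset.mem_filter.1 hS).2
    _ = ENNReal.ofReal (T.card * (Real.exp (-M) / 2 ^ M)) := by
        rw [Finset.sum_const, nsmul_eq_mul, ENNReal.ofReal_mul (by positivity),
          ENNReal.ofReal_natCast]
    _ ≤ _ := by
        refine ENNReal.ofReal_le_ofReal ?_
        calc _ ≤ 2 ^ M * (Real.exp (-M) / 2 ^ M) := by gcongr
          _ = _ := by field_simp

lemma WalkLaw.ae_adj (hW : WalkLaw d P) (x : Zd d) : ∀ᵐ ω ∂(P x), ∀ n, adjZ (ω n) (ω (n + 1)) := by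
  rw [ae_all_iff]
  intro n
  have h : ∀ q : Zd d × Zd d, ¬ adjZ q.1 q.2 → ∀ᵐ ω ∂(P x), ¬ (ω n = q.1 ∧ ω (n + 1) = q.2) := by
    intro q hq
    have h1 := hW.markov x q.1 n {ω | ω 1 = q.2} (measurableSet_eval_eq 1 q.2)
    rw [hW.step, if_neg hq, ENNReal.ofReal_zero, mul_zero] at h1
    rw [ae_iff]
    simp only [not_not]
    exact h1
  have h2 : ∀ᵐ ω ∂(P x), ∀ q : Zd d × Zd d, ¬ adjZ q.1 q.2 → ¬ (ω n = q.1 ∧ ω (n + 1) = q.2) := by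
    rw [ae_all_iff]
    intro q
    by_cases hq : adjZ q.1 q.2
    · exact Eventually.of_forall fun _ h => absurd hq h
    · filter_upwards [h q hq] with ω hω _ using hω
  filter_upwards [h2] with ω hω
  by_contra hc
  exact hω (ω n, ω (n + 1)) hc ⟨rfl, rfl⟩

lemma len_le_of_adj {x y : Zd d} (h : adjZ x y) : len (y - x) ≤ 1 := by
  have h1 : nsq (y - x) ≤ 1 := by
    unfold nsq
    have h2 : ∀ i, |x i - y i| ≤ 1 := fun i => by
      rw [adjZ] at h
      rw [← h]
      exact Finset.single_le_sum (f := fun i => |x i - y i|) (fun _ _ => abs_nonneg _)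
        (Finset.mem_univ i)
    calc ∑ i, (((y - x) i : ℤ) : ℝ) ^ 2 ≤ ∑ i, ((|x i - y i| : ℤ) : ℝ) := by
          refine Finset.sum_le_sum fun i _ => ?_
          have h3 := h2 i
          have h4 : ((y - x) i) ^ 2 ≤ |x i - y i| := by
            rw [Pi.sub_apply, ← sq_abs, abs_sub_comm]
            nlinarith [abs_nonneg (x i - y i)]
          exact_mod_cast h4
      _ = 1 := by rw [← Int.cast_sum]; rw [adjZ] at h; exact_mod_cast h
  rw [len]
  exact Real.sqrt_le_one.2 h1

lemma exists_firstExit {ω : ℕ → Zd d} (h0 : ω 0 = 0) (hadj : ∀ n, adjZ (ω n) (ω (n + 1))) {ρ : ℝ}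
    (hρ : 0 ≤ ρ) (hex : ∃ n, ρ < len (ω n)) : ∃ n, ω ∈ firstExit ρ n := by
  refine ⟨Nat.find hex, fun k hk => not_lt.1 (Nat.find_min hex hk), Nat.find_spec hex, ?_⟩
  rcases hn : Nat.find hex with _ | m
  · have := Nat.find_spec hex
    rw [hn, h0, len, nsq_zero, Real.sqrt_zero] at this
    linarith
  · have h1 : len (ω m) ≤ ρ := not_lt.1 (Nat.find_min hex (by omega))
    have h2 := len_le_of_adj (hadj m)
    have h3 := len_add_le (ω m) (ω (m + 1) - ω m)
    rw [add_sub_cancel] at h3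
    linarith

lemma WalkLaw.shells (hW : WalkLaw d P) (hd : 3 ≤ d) {δ s R κ N : ℝ} (hδ : 0 < δ) (hR : 0 ≤ R)
    (hRs : R + 1 ≤ s) (hκ : ∀ z, (P z).real {ω | capF P (visF z R ω) < κ} ≤ Real.exp (-(2 / δ)))
    {M : ℕ} (hM : (M + 1) * s ≤ N) :
    P 0 {ω | ¬ ∃ G : Finset ℕ, G ⊆ Finset.range M ∧ (1 - δ) * M ≤ G.card ∧
      ∃ A : ℕ → Finset (Zd d), ∀ j ∈ G, A j ⊆ visF 0 N ω ∧ κ ≤ capF P (A j) ∧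
        ∀ a ∈ A j, |len a - (j + 1) * s| ≤ R + 1} ≤ ENNReal.ofReal (Real.exp (-M)) := by
  set V : Zd d → Set (ℕ → Zd d) := fun z => {ω | capF P (visF z R ω) < κ} with hVdef
  set ρ : ℕ → ℝ := fun j => (j + 1) * s with hρdef
  have hs : 0 < s := by linarith
  have hloc : ∀ (z : Zd d) (m : ℕ) (ω ω' : ℕ → Zd d), ω m ∉ ballZ z R → (∀ i ≤ m, ω i = ω' i) →
      ω ∈ V z → ω' ∈ V z := by
    intro z m ω ω' hm h hω
    have hk : ∀ ω₁ ω₂ : ℕ → Zd d, ω₁ m ∉ ballZ z R → (∀ i ≤ m, ω₁ i = ω₂ i) →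
        visF z R ω₁ ⊆ visF z R ω₂ := by
      intro ω₁ ω₂ hm h v hv
      rw [mem_visF] at hv ⊢
      obtain ⟨k, hk, rfl⟩ := hv
      have hkm : k ≤ m := by
        by_contra hc
        exact hm (hk m (not_le.1 hc).le)
      exact ⟨k, fun n hn => h n (hn.trans hkm) ▸ hk n hn, (h k hkm).symm⟩
    have : visF z R ω = visF z R ω' := (hk ω ω' hm h).antisymm
      (hk ω' ω (h m le_rfl ▸ hm) fun i hi => (h i hi).symm)
    change capF P (visF z R ω') < κ
    rw [← this]
    exact hω
  have hρ : ∀ i j, i < j → ρ i + 1 + R ≤ ρ j := fun i j hij => by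
    have : (i : ℝ) + 1 ≤ j := by exact_mod_cast hij
    have h2 : ((i : ℝ) + 1 + 1) * s ≤ (j + 1) * s := by gcongr
    simp only [hρdef]
    linarith
  have h1 := hW.many_afterExit_le (show 0 < d by omega) (V := V)
    (fun z => measurableSet_visF z R fun A => capF P A < κ) hδ hκ hloc hρ hR 0 M
  refine le_trans (measure_mono_ae ?_) h1
  filter_upwards [hW.ae_start 0, hW.ae_adj 0,
    hW.ae_eventually_notMem hd (finite_ballZ (0 : Zd d) N).toFinset 0] with ω h0 hadj hesc
  intro hω
  by_contra hc
  refine hω ⟨(Finset.range M).filter fun j => ω ∉ afterExit V (ρ j), Finset.filter_subset _ _, ?_, ?_⟩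
  · have h2 := Finset.card_filter_add_card_filter_not (s := Finset.range M)
      fun j => ω ∈ afterExit V (ρ j)
    rw [Finset.card_range] at h2
    have h3 : (((Finset.range M).filter fun j => ω ∈ afterExit V (ρ j)).card : ℝ)
        + ((Finset.range M).filter fun j => ω ∉ afterExit V (ρ j)).card = M := by exact_mod_cast h2
    have h4 := not_le.1 hc
    linarith
  have hex : ∀ j : ℕ, j < M → ∃ n, ω ∈ firstExit (ρ j) n := fun j hj => by
    refine exists_firstExit h0 hadj (by positivity) ?_
    obtain ⟨n, hn⟩ := hesc.exists
    refine ⟨n, ?_⟩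
    rw [Set.Finite.mem_toFinset, mem_ballZ_zero, not_le] at hn
    refine lt_of_le_of_lt ?_ hn
    have : (j : ℝ) + 1 ≤ M := by exact_mod_cast hj
    have h2 : ((j : ℝ) + 1) * s ≤ (M + 1) * s := by gcongr
    simp only [hρdef]
    linarith
  choose! τ hτ using hex
  refine ⟨fun j => visF (ω (τ j)) R fun m => ω (τ j + m), fun j hj => ?_⟩
  obtain ⟨hjM, hjb⟩ := Finset.mem_filter.1 hj
  have hjM := Finset.mem_range.1 hjM
  have hjM' : (j : ℝ) + 1 ≤ M := by exact_mod_cast hjM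
  have hjN : ρ j + 1 + R ≤ N := by
    have h2 : ((j : ℝ) + 1 + 1) * s ≤ (M + 1) * s := by gcongr
    simp only [hρdef]
    linarith
  have hτj := hτ j hjM
  have hball : ∀ m, ω (τ j + m) ∈ ballZ (ω (τ j)) R → |len (ω (τ j + m)) - ρ j| ≤ R + 1 := by
    intro m hm
    rw [mem_ballZ] at hm
    have h2 := len_sub_le (ω (τ j)) (ω (τ j) - ω (τ j + m))
    rw [sub_sub_cancel] at h2
    have h3 := len_add_le (ω (τ j) - ω (τ j + m)) (ω (τ j + m))
    rw [sub_add_cancel] at h3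
    have h4 := hτj.2.1
    have h5 := hτj.2.2
    rw [abs_le]
    constructor <;> linarith
  refine ⟨fun v hv => ?_, ?_, fun a ha => ?_⟩
  · rw [mem_visF] at hv ⊢
    obtain ⟨k, hk, rfl⟩ := hv
    refine ⟨τ j + k, fun n hn => ?_, rfl⟩
    rw [mem_ballZ_zero]
    rcases lt_or_ge n (τ j) with hnt | hnt
    · linarith [hτj.1 n hnt]
    · have := hball (n - τ j) (hk (n - τ j) (by omega))
      rw [show τ j + (n - τ j) = n by omega] at this
      linarith [(abs_le.1 this).2]
  · by_contra hcc
    exact hjb ⟨τ j, hτj, not_le.1 hcc⟩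
  · rw [mem_visF] at ha
    obtain ⟨k, hk, rfl⟩ := ha
    exact hball k (hk k le_rfl)

lemma WalkLaw.card_le_capF_mul (hW : WalkLaw d P) (hd : 3 ≤ d) {κ S : ℝ} (hκ : 0 < κ)
    {G : Finset ℕ} {A : ℕ → Finset (Zd d)} {X : Finset (Zd d)} (hA : ∀ j ∈ G, A j ⊆ X)
    (hcap : ∀ j ∈ G, κ ≤ capF P (A j)) (u : ℕ → Zd d → ℝ)
    (hu : ∀ b ∈ X, ∀ j ∈ G, 1 / κ ≤ u j b ∨ ∀ a ∈ A j, green (b - a) ≤ u j b)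
    (hS : ∀ b ∈ X, ∑ j ∈ G, u j b ≤ S) : G.card ≤ capF P X * S := by
  set ν : Zd d → ℝ := fun a => ∑ j ∈ G, if a ∈ A j then esc P (A j) a / capF P (A j) else 0 with hν
  have hsum : ∀ f : Zd d → ℝ, ∑ a ∈ X, f a * ν a
      = ∑ j ∈ G, (∑ a ∈ A j, f a * esc P (A j) a) / capF P (A j) := fun f => by
    simp only [hν, Finset.mul_sum]
    rw [Finset.sum_comm]
    refine Finset.sum_congr rfl fun j hj => ?_
    simp_rw [mul_ite, mul_zero]
    rw [← Finset.sum_filter, Finset.filter_mem_eq_inter, Finset.inter_eq_right.2 (hA j hj),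
      Finset.sum_div]
    exact Finset.sum_congr rfl fun _ _ => by ring
  have h1 : ∑ a ∈ X, ν a = G.card := by
    have h2 := hsum fun _ => 1
    simp only [one_mul] at h2
    rw [h2, Finset.cast_card]
    refine Finset.sum_congr rfl fun j hj => ?_
    exact div_self (hκ.trans_le (hcap j hj)).ne'
  rw [← h1]
  refine hW.le_capF_mul hd X fun b hb => ?_
  rw [hsum fun a => green (b - a)]
  refine (Finset.sum_le_sum fun j hj => ?_).trans (hS b hb)
  have hc := hκ.trans_le (hcap j hj)
  rcases hu b hb j hj with h | h
  · refine le_trans ?_ h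
    exact div_le_div₀ zero_le_one (hW.potential_le_one hd _ b) hκ (hcap j hj)
  · rw [div_le_iff₀ hc, capF, Finset.mul_sum]
    exact Finset.sum_le_sum fun a ha => mul_le_mul_of_nonneg_right (h a ha) (esc_nonneg _ _)

end Walk

section Tube

lemma finite_tube (d : ℕ) (N p : ℤ) : (tube d N p).Finite := by
  refine (Set.finite_Icc (fun _ : Fin d => -(|N| + |p|)) fun _ => |N| + |p|).subset fun x hx => ?_
  have h : ∀ i, |x i| ≤ |N| + |p| := fun i => by
    have hi := hx i
    have := abs_nonneg N
    have := abs_nonneg p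
    split_ifs at hi with h0
    · rw [abs_of_nonneg hi.1]
      linarith [le_abs_self N]
    · linarith [le_abs_self p]
  exact ⟨fun i => (abs_le.1 (h i)).1, fun i => (abs_le.1 (h i)).2⟩

/-- The tube as a finite set. -/
def tubeF (d : ℕ) (N p : ℤ) : Finset (Zd d) := (finite_tube d N p).toFinset

lemma coe_tubeF (N p : ℤ) : (tubeF d N p : Set (Zd d)) = tube d N p := Set.Finite.coe_toFinset _

lemma mem_tubeF {N p : ℤ} {x : Zd d} : x ∈ tubeF d N p ↔ x ∈ tube d N p :=
  Set.Finite.mem_toFinset _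

end Tube

section Walk

variable {P : Zd d → Measure (ℕ → Zd d)}

lemma WalkLaw.event_eq (hd : 0 < d) (N p : ℕ) :
    {ω | capZ P (visited (ballZ (0 : Zd d) (N : ℝ)) ω) ≤ capZ P (tube d (N : ℤ) (p : ℤ))}
      = {ω | capF P (visF 0 N ω) ≤ capF P (tubeF d N p)} := by
  ext ω
  rw [Set.mem_ofPred_eq, Set.mem_ofPred_eq]
  rw [← coe_visF, ← coe_tubeF, capZ_eq, capZ_eq]
  have : (0 : ℝ) < 2 * d := by positivity
  exact mul_le_mul_iff_right₀ this

lemma WalkLaw.piece_cap (hW : WalkLaw d P) (hd : 3 ≤ d) {ε R Γ : ℝ} (hε : 0 < ε) (hR : 0 < R)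
    (hεR : 2 ≤ ε * R ^ 2) (hΓ0 : 0 < Γ)
    (hΓ : ∑ k ∈ Finset.range ⌊ε / 2 * R ^ 2⌋₊, avg^[k] green (0 : Zd d) ≤ Γ) (z : Zd d) :
    (P z).real {ω | capF P (visF z R ω) < ε ^ 2 * R ^ 2 / (64 * Γ)} ≤ ε := by
  have := hW.prob
  have h1 : 1 ≤ ε / 2 * R ^ 2 := by linarith
  have ht : 0 < ⌊ε / 2 * R ^ 2⌋₊ := Nat.floor_pos.2 h1
  have key : ε ^ 2 * R ^ 2 / (64 * Γ) ≤ ε * ⌊ε / 2 * R ^ 2⌋₊ / (16 * Γ) := ?_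
  · have hsub : {ω | capF P (visF z R ω) < ε ^ 2 * R ^ 2 / (64 * Γ)}
        ⊆ {ω | capF P (visF z R ω) < ε * ⌊ε / 2 * R ^ 2⌋₊ / (16 * Γ)} := fun ω hω =>
      lt_of_lt_of_le (show capF P (visF z R ω) < _ from hω) key
    exact (measureReal_mono hsub).trans
      (hW.prob_small_cap_le hd ht hΓ0 hΓ hε hR (Nat.floor_le (by linarith)) z)
  have h2 := Nat.lt_floor_add_one (ε / 2 * R ^ 2)
  have h3 : (1 : ℝ) ≤ ⌊ε / 2 * R ^ 2⌋₊ := by exact_mod_cast ht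
  have h4 : ε * R ^ 2 / 4 ≤ ⌊ε / 2 * R ^ 2⌋₊ := by linarith
  calc ε ^ 2 * R ^ 2 / (64 * Γ) = ε * (ε * R ^ 2 / 4) / (16 * Γ) := by ring
    _ ≤ _ := by gcongr

lemma exists_piece3 {ε : ℝ} (hε : 0 < ε) (hε1 : ε ≤ 1) : ∃ κ > 0, ∃ R₀ : ℝ, 0 < R₀ ∧
    ∀ (P : Zd 3 → Measure (ℕ → Zd 3)), WalkLaw 3 P → ∀ R, R₀ ≤ R → ∀ z,
      (P z).real {ω | capF P (visF z R ω) < κ * R} ≤ ε := by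
  obtain ⟨C, hC, h⟩ := exists_sum_avgN_green3
  refine ⟨ε ^ 2 / (64 * C), by positivity, 64 + 2 / ε, by positivity, fun P hW R hR z => ?_⟩
  have h2 : 2 / ε ≤ R := by linarith
  have h64 : 64 ≤ R := by
    have : 0 < 2 / ε := by positivity
    linarith
  rw [div_le_iff₀ hε] at h2
  have h3 := hW.piece_cap le_rfl (R := R) (Γ := C * R) hε (by linarith) (by nlinarith)
    (by positivity) ?_ z
  · have : ε ^ 2 * R ^ 2 / (64 * (C * R)) = ε ^ 2 / (64 * C) * R := by field_simp
    rwa [this] at h3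
  · refine (h _).trans ?_
    gcongr
    refine Real.sqrt_le_iff.2 ⟨by linarith, ?_⟩
    have := Nat.floor_le (show 0 ≤ ε / 2 * R ^ 2 by positivity)
    nlinarith [sq_nonneg R]

lemma exists_piece4 {ε : ℝ} (hε : 0 < ε) (hε1 : ε ≤ 1) : ∃ κ > 0, ∃ R₀ : ℝ, 2 ≤ R₀ ∧
    ∀ (P : Zd 4 → Measure (ℕ → Zd 4)), WalkLaw 4 P → ∀ R, R₀ ≤ R → ∀ z,
      (P z).real {ω | capF P (visF z R ω) < κ * R ^ 2 / Real.log R} ≤ ε := by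
  obtain ⟨C, hC, h⟩ := exists_sum_avgN_green4
  refine ⟨ε ^ 2 / (128 * C), by positivity, 64 + 2 / ε, ?_, fun P hW R hR z => ?_⟩
  · have : 0 < 2 / ε := by positivity
    linarith
  have h2 : 2 / ε ≤ R := by linarith
  have h64 : 64 ≤ R := by
    have : 0 < 2 / ε := by positivity
    linarith
  rw [div_le_iff₀ hε] at h2
  have hlog : 0 < Real.log R := Real.log_pos (by linarith)
  have h3 := hW.piece_cap (by norm_num) (R := R) (Γ := C * (2 * Real.log R)) hε (by linarith)
    (by nlinarith) (by positivity) ?_ z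
  · have : ε ^ 2 * R ^ 2 / (64 * (C * (2 * Real.log R)))
        = ε ^ 2 / (128 * C) * R ^ 2 / Real.log R := by field_simp; norm_num
    rwa [this] at h3
  · refine (h _).trans ?_
    gcongr
    have h5 : 2 * Real.log R = Real.log (R ^ 2) := by rw [Real.log_pow]; norm_num
    rw [h5]
    refine Real.log_le_log (by positivity) ?_
    have := Nat.floor_le (show 0 ≤ ε / 2 * R ^ 2 by positivity)
    nlinarith [sq_nonneg R]

lemma sum_comp_le_of_injOn {S : Finset ℕ} {M : ℕ} {γ : ℕ → ℝ} (hγ : ∀ i, 0 ≤ γ i) {φ : ℕ → ℕ}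
    (hφ : Set.InjOn φ S) (hM : ∀ j ∈ S, φ j < M) :
    ∑ j ∈ S, γ (φ j) ≤ ∑ i ∈ Finset.range M, γ i := by
  rw [← Finset.sum_image hφ]
  refine Finset.sum_le_sum_of_subset_of_nonneg (fun i hi => ?_) fun _ _ _ => hγ _
  obtain ⟨j, hj, rfl⟩ := Finset.mem_image.1 hi
  exact Finset.mem_range.2 (hM j hj)

lemma sum_shell_le {γ : ℕ → ℝ} (hγ : ∀ i, 0 ≤ γ i) {β : ℝ} (hβ : 0 ≤ β) {M j₀ : ℕ}
    (hj₀ : j₀ ≤ M + 2) {G : Finset ℕ} (hG : G ⊆ Finset.range M) :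
    ∑ j ∈ G, (if Nat.dist (j + 1) j₀ ≤ 3 then β else γ (Nat.dist (j + 1) j₀ - 2))
      ≤ 7 * β + 2 * ∑ i ∈ Finset.range M, γ i := by
  have hle : ∀ j : ℕ, (if Nat.dist (j + 1) j₀ ≤ 3 then β else γ (Nat.dist (j + 1) j₀ - 2))
      ≤ (if Nat.dist (j + 1) j₀ ≤ 3 then β else 0) + (if j₀ + 4 ≤ j + 1 then γ (j - 1 - j₀) else 0)
        + (if j + 1 + 4 ≤ j₀ then γ (j₀ - j - 3) else 0) := by
    intro j
    by_cases h1 : Nat.dist (j + 1) j₀ ≤ 3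
    · rw [if_pos h1, if_pos h1]
      have h2 : 0 ≤ if j₀ + 4 ≤ j + 1 then γ (j - 1 - j₀) else 0 := by split_ifs; exacts [hγ _, le_rfl]
      have h3 : 0 ≤ if j + 1 + 4 ≤ j₀ then γ (j₀ - j - 3) else 0 := by split_ifs; exacts [hγ _, le_rfl]
      linarith
    · rw [if_neg h1, if_neg h1]
      unfold Nat.dist at h1 ⊢
      by_cases h2 : j₀ + 4 ≤ j + 1
      · rw [if_pos h2, if_neg (by omega), show j + 1 - j₀ + (j₀ - (j + 1)) - 2 = j - 1 - j₀ by omega]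
        linarith
      · rw [if_neg h2, if_pos (by omega), show j + 1 - j₀ + (j₀ - (j + 1)) - 2 = j₀ - j - 3 by omega]
        linarith
  refine (Finset.sum_le_sum fun j _ => hle j).trans ?_
  rw [Finset.sum_add_distrib, Finset.sum_add_distrib, ← Finset.sum_filter, ← Finset.sum_filter,
    ← Finset.sum_filter]
  have hlt : ∀ j ∈ G, j < M := fun j hj => Finset.mem_range.1 (hG hj)
  have h1 : ∑ j ∈ G.filter (fun j => Nat.dist (j + 1) j₀ ≤ 3), β ≤ 7 * β := by
    rw [Finset.sum_const, nsmul_eq_mul]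
    gcongr
    have hc : (G.filter fun j => Nat.dist (j + 1) j₀ ≤ 3).card ≤ 7 := by
      calc _ ≤ (Finset.Icc (j₀ - 4) (j₀ + 2)).card := Finset.card_le_card fun j hj => by
            have := (Finset.mem_filter.1 hj).2
            unfold Nat.dist at this
            rw [Finset.mem_Icc]
            omega
        _ ≤ 7 := by rw [Nat.card_Icc]; omega
    exact_mod_cast hc
  have h2 : ∑ j ∈ G.filter (fun j => j₀ + 4 ≤ j + 1), γ (j - 1 - j₀) ≤ ∑ i ∈ Finset.range M, γ i := by
    refine sum_comp_le_of_injOn hγ (φ := fun j => j - 1 - j₀) (fun i hi j hj hij => ?_) fun j hj => ?_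
    · have h1 := (Finset.mem_filter.1 hi).2
      have h2 := (Finset.mem_filter.1 hj).2
      simp only at hij
      omega
    · have h1 := hlt j (Finset.mem_filter.1 hj).1
      omega
  have h3 : ∑ j ∈ G.filter (fun j => j + 1 + 4 ≤ j₀), γ (j₀ - j - 3) ≤ ∑ i ∈ Finset.range M, γ i := by
    refine sum_comp_le_of_injOn hγ (φ := fun j => j₀ - j - 3) (fun i hi j hj hij => ?_) fun j hj => ?_
    · have h1 := (Finset.mem_filter.1 hi).2
      have h2 := (Finset.mem_filter.1 hj).2
      simp only at hij
      omega
    · have h1 := hlt j (Finset.mem_filter.1 hj).1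
      omega
  linarith

lemma WalkLaw.shells_cap (hW : WalkLaw d P) (hd : 3 ≤ d) {δ s κ N : ℝ} (hδ : 0 < δ) (hs : 4 ≤ s)
    (hκ0 : 0 < κ)
    (hκ : ∀ z, (P z).real {ω | capF P (visF z (s / 4) ω) < κ} ≤ Real.exp (-(2 / δ)))
    {γ : ℕ → ℝ} (hγ : ∀ i, 0 ≤ γ i)
    (hgγ : ∀ i : ℕ, 2 ≤ i → ∀ x : Zd d, i * s ≤ len x → green x ≤ γ i)
    {M : ℕ} (hM : (M + 1) * s ≤ N) (hM' : N ≤ (M + 2) * s) :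
    P 0 {ω | capF P (visF 0 N ω) * (7 / κ + 2 * ∑ i ∈ Finset.range M, γ i) < (1 - δ) * M}
      ≤ ENNReal.ofReal (Real.exp (-M)) := by
  refine (measure_mono ?_).trans
    (hW.shells hd (R := s / 4) hδ (by positivity) (by linarith) hκ hM)
  intro ω hω
  rintro ⟨G, hG, hGc, A, hA⟩
  have hs0 : 0 < s := by linarith
  have h1 := hW.card_le_capF_mul hd hκ0 (X := visF 0 N ω) (fun j hj => (hA j hj).1)
    (fun j hj => (hA j hj).2.1)
    (u := fun j b => if Nat.dist (j + 1) ⌊len b / s⌋₊ ≤ 3 then 1 / κ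
      else γ (Nat.dist (j + 1) ⌊len b / s⌋₊ - 2)) (S := 7 * (1 / κ) + 2 * ∑ i ∈ Finset.range M, γ i)
    ?_ ?_
  · have h2 : capF P (visF 0 N ω) * (7 / κ + 2 * ∑ i ∈ Finset.range M, γ i) < (1 - δ) * M := hω
    rw [show 7 * (1 / κ) = 7 / κ by ring] at h1
    linarith
  · intro b hb j hj
    by_cases h3 : Nat.dist (j + 1) ⌊len b / s⌋₊ ≤ 3
    · left
      rw [if_pos h3]
    · right
      intro a ha
      rw [if_neg h3]
      refine hgγ _ (by omega) _ ?_
      have h4 := (hA j hj).2.2 a ha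
      have hf1 := Nat.floor_le (show 0 ≤ len b / s from div_nonneg (len_nonneg _) hs0.le)
      have hf2 := Nat.lt_floor_add_one (len b / s)
      rw [le_div_iff₀ hs0] at hf1
      rw [div_lt_iff₀ hs0] at hf2
      set j₀ := ⌊len b / s⌋₊
      have h5 := len_sub_le b (b - a)
      rw [sub_sub_cancel] at h5
      have h6 := len_add_le (b - a) a
      rw [sub_add_cancel] at h6
      obtain ⟨h7, h8⟩ := abs_le.1 h4
      unfold Nat.dist at h3 ⊢
      rcases le_total j₀ (j + 1) with h9 | h9
      · rw [show j + 1 - j₀ + (j₀ - (j + 1)) - 2 = j - 1 - j₀ by omega]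
        rw [Nat.cast_sub (by omega), Nat.cast_sub (by omega)]
        push_cast
        nlinarith
      · rw [show j + 1 - j₀ + (j₀ - (j + 1)) - 2 = j₀ - (j + 3) by omega]
        rw [Nat.cast_sub (by omega)]
        push_cast
        nlinarith
  · intro b hb
    refine sum_shell_le hγ (by positivity) ?_ hG
    rw [mem_visF] at hb
    have h2 := mem_ballZ_zero.1 (visited_subset _ _ hb)
    have h3 : len b / s ≤ ((M + 2 : ℕ) : ℝ) := by
      rw [div_le_iff₀ hs0]
      push_cast
      linarith
    exact Nat.floor_le_of_le h3

end Walk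

lemma log_div_le_sum (q : ℝ) (hq : 0 ≤ q) (m : ℕ) :
    Real.log ((m + 1 + q) / (1 + q)) ≤ ∑ i ∈ Finset.range m, 1 / ((i : ℝ) + 1 + q) := by
  induction m with
  | zero => simp [div_self (show 1 + q ≠ 0 by positivity)]
  | succ m ih =>
    rw [Finset.sum_range_succ]
    have h1 : Real.log ((((m + 1 : ℕ) : ℝ) + 1 + q) / (1 + q))
        = Real.log ((m + 1 + q) / (1 + q)) + Real.log (1 + 1 / ((m : ℝ) + 1 + q)) := by
      rw [← Real.log_mul (by positivity) (by positivity)]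
      congr 1
      push_cast
      field_simp
      ring
    have h2 := Real.log_le_sub_one_of_pos (show 0 < 1 + 1 / ((m : ℝ) + 1 + q) by positivity)
    rw [h1]
    linarith

lemma sum_window_le {f : ℕ → ℝ} (hf : ∀ k, 0 ≤ f k) {n₀ N m : ℕ} (hn : n₀ ≤ N) :
    ∑ i ∈ Finset.range m, f (n₀ + m + 1 + i) + ∑ i ∈ Finset.range m, f (n₀ + m - 1 - i)
      ≤ ∑ k ∈ Finset.range (N + 2 * m + 1), f k := by
  have h1 : ∑ k ∈ Finset.range (n₀ + 2 * m + 1), f k ≤ ∑ k ∈ Finset.range (N + 2 * m + 1), f k :=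
    Finset.sum_le_sum_of_subset_of_nonneg (Finset.range_subset_range.2 (by omega)) fun _ _ _ => hf _
  have h2 : ∑ i ∈ Finset.range m, f (n₀ + m - 1 - i) = ∑ i ∈ Finset.range m, f (n₀ + i) := by
    rw [← Finset.sum_range_reflect]
    refine Finset.sum_congr rfl fun i hi => ?_
    have := Finset.mem_range.1 hi
    congr 1
    omega
  have h3 : ∑ k ∈ Finset.range (n₀ + 2 * m + 1), f k
      = ∑ k ∈ Finset.range n₀, f k + ∑ i ∈ Finset.range m, f (n₀ + i)
        + (f (n₀ + m) + ∑ i ∈ Finset.range m, f (n₀ + m + 1 + i)) := by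
    rw [show n₀ + 2 * m + 1 = n₀ + m + 1 + m by ring, Finset.sum_range_add, Finset.sum_range_succ,
      Finset.sum_range_add]
    ring
  have h4 : 0 ≤ ∑ k ∈ Finset.range n₀, f k := Finset.sum_nonneg fun _ _ => hf _
  have h5 := hf (n₀ + m)
  rw [h2]
  linarith

/-- The point `k e₀` of the first coordinate axis. -/
def axis (k : ℤ) : Zd d := fun i => if (i : ℕ) = 0 then k else 0

lemma axis_injective (hd : 0 < d) : Function.Injective (axis (d := d)) := fun i j hij => by
  have := congrFun hij ⟨0, hd⟩
  simpa [axis] using this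

lemma len_sub_axis_le {p : ℕ} {x : Zd 3} {N : ℤ} (hx : x ∈ tube 3 N p) (j : ℤ) :
    len (x - axis j) ≤ |((x 0 - j : ℤ) : ℝ)| + 2 * p := by
  have h1 := hx 1
  have h2 := hx 2
  rw [if_neg (by decide)] at h1 h2
  have h1' : |(x 1 : ℝ)| ≤ p := by exact_mod_cast h1
  have h2' : |(x 2 : ℝ)| ≤ p := by exact_mod_cast h2
  refine Real.sqrt_le_iff.2 ⟨by positivity, ?_⟩
  rw [nsq, Fin.sum_univ_three]
  have e0 : (x - (axis j : Zd 3)) 0 = x 0 - j := by simp [axis]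
  have e1 : (x - (axis j : Zd 3)) 1 = x 1 := by simp [axis]
  have e2 : (x - (axis j : Zd 3)) 2 = x 2 := by simp [axis]
  rw [e0, e1, e2, ← sq_abs ((x 0 - j : ℤ) : ℝ), ← sq_abs (x 1 : ℝ), ← sq_abs (x 2 : ℝ)]
  have h5 : |(x 1 : ℝ)| ^ 2 ≤ (p : ℝ) ^ 2 := by gcongr
  have h6 : |(x 2 : ℝ)| ^ 2 ≤ (p : ℝ) ^ 2 := by gcongr
  nlinarith [mul_nonneg (abs_nonneg ((x 0 - j : ℤ) : ℝ)) (Nat.cast_nonneg (α := ℝ) p)]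

lemma WalkLaw.capF_tube3_le {P : Zd 3 → Measure (ℕ → Zd 3)} (hW : WalkLaw 3 P) {α R : ℝ}
    (hα : 0 < α) (hR : 0 < R) (hg : ∀ x : Zd 3, α / (len x + R) ≤ green x) (N p m : ℕ) (hm : 0 < m) :
    capF P (tubeF 3 N p)
      ≤ (N + 2 * m + 1) / (2 * α * Real.log ((m + 1 + (2 * p + R)) / (1 + (2 * p + R)))) := by
  set q : ℝ := 2 * p + R with hq
  have hq0 : 0 < q := by positivity
  set L := Real.log ((m + 1 + q) / (1 + q)) with hL
  have hL0 : 0 < L := by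
    refine Real.log_pos ?_
    rw [one_lt_div (by positivity)]
    have : (0 : ℝ) < m := by exact_mod_cast hm
    linarith
  obtain ⟨e, he, hedef⟩ : ∃ e : ℕ → Zd 3, Function.Injective e ∧ ∀ k, e k = axis ((k : ℤ) - m) :=
    ⟨fun k => axis ((k : ℤ) - m), fun i j hij => by
      have := axis_injective (by norm_num) hij
      omega, fun _ => rfl⟩
  set lam : ℝ := 1 / (2 * α * L) with hlam
  have hlam0 : 0 ≤ lam := by positivity
  have h := hW.capF_le le_rfl (tubeF 3 N p) ((Finset.range (N + 2 * m + 1)).image e)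
    (ν := fun _ => lam) (fun _ => hlam0) ?_
  · refine h.trans (le_of_eq ?_)
    rw [Finset.sum_const, Finset.card_image_of_injective _ he, Finset.card_range, nsmul_eq_mul, hlam]
    push_cast
    ring
  · intro x hx
    rw [mem_tubeF] at hx
    rw [Finset.sum_image he.injOn, ← Finset.sum_mul]
    have hx0 := hx 0
    rw [if_pos (by decide)] at hx0
    obtain ⟨n₀, hn₀⟩ := Int.eq_ofNat_of_zero_le hx0.1
    have hn : n₀ ≤ N := by omega
    have hterm : ∀ k i : ℕ, |(x 0 - ((k : ℤ) - m))| ≤ i + 1 →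
        α * (1 / ((i : ℝ) + 1 + q)) ≤ green (x - e k) := fun k i hki => by
      refine le_trans ?_ (hg _)
      rw [mul_one_div]
      have h1 := len_sub_axis_le hx ((k : ℤ) - m)
      have h2 : |((x 0 - ((k : ℤ) - m) : ℤ) : ℝ)| ≤ i + 1 := by exact_mod_cast hki
      have h3 := len_nonneg (x - e k)
      refine div_le_div_of_nonneg_left hα.le (by positivity) ?_
      rw [hq, hedef]
      linarith
    have h1 := sum_window_le (f := fun k => green (x - e k)) (fun k => green_nonneg (by norm_num) _)
      (m := m) hn
    have h2 : α * L ≤ ∑ i ∈ Finset.range m, green (x - e (n₀ + m + 1 + i)) := by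
      refine (mul_le_mul_of_nonneg_left (log_div_le_sum q hq0.le m) hα.le).trans ?_
      rw [Finset.mul_sum]
      refine Finset.sum_le_sum fun i hi => hterm _ i ?_
      rw [hn₀, abs_le]
      push_cast
      constructor <;> omega
    have h3 : α * L ≤ ∑ i ∈ Finset.range m, green (x - e (n₀ + m - 1 - i)) := by
      refine (mul_le_mul_of_nonneg_left (log_div_le_sum q hq0.le m) hα.le).trans ?_
      rw [Finset.mul_sum]
      refine Finset.sum_le_sum fun i hi => hterm _ i ?_
      have := Finset.mem_range.1 hi
      rw [hn₀, abs_le]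
      constructor <;> omega
    have h4 : (1 : ℝ) = 2 * α * L * lam := by rw [hlam]; field_simp
    rw [h4]
    gcongr
    linarith

lemma sum_inv_range_le {M : ℕ} : ∑ i ∈ Finset.range M, 1 / (i : ℝ) ≤ 1 + Real.log M := by
  have h1 : ∑ i ∈ Finset.range (M + 1), 1 / (i : ℝ) = (harmonic M : ℝ) := by
    rw [Finset.sum_range_succ', harmonic]
    push_cast
    simp
  have h2 := harmonic_le_one_add_log M
  rw [← h1, Finset.sum_range_succ] at h2
  have : (0 : ℝ) ≤ 1 / (M : ℝ) := by positivity
  linarith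

lemma small_log_compare {η δ a K K₂ L : ℝ} (hη : 0 < η) (hη1 : η < 1) (hδ : δ = η / 20)
    (ha : 0 < a) (hK : 0 ≤ K) (hK₂ : 0 ≤ K₂) (hL : (2 * K₂ + 2 * a * K + 1) / (δ * a) ≤ L) :
    (1 + 3 * δ) * (K₂ + 2 * (1 + δ) * a * ((1 - η) * L)) < (1 - δ) ^ 3 * (2 * a * (L - K)) := by
  have hδ0 : 0 < δ := by rw [hδ]; positivity
  have hδ1 : δ < 1 / 20 := by rw [hδ]; linarith
  have hη' : η = 20 * δ := by rw [hδ]; ring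
  rw [div_le_iff₀ (by positivity)] at hL
  have hL0 : 0 ≤ L := by
    by_contra hc
    have : L * (δ * a) < 0 := mul_neg_of_neg_of_pos (not_le.1 hc) (by positivity)
    have : 0 ≤ a * K := by positivity
    linarith
  have h1 : (1 + 3 * δ) * (1 + δ) * (1 - η) ≤ 1 - 15 * δ := by
    rw [hη']; nlinarith [sq_nonneg δ, mul_nonneg hδ0.le (sq_nonneg δ)]
  have h2 : 1 - 3 * δ ≤ (1 - δ) ^ 3 := by nlinarith [sq_nonneg δ, mul_nonneg hδ0.le (sq_nonneg δ)]
  have h3 : (1 - δ) ^ 3 ≤ 1 := pow_le_one₀ (by linarith) (by linarith)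
  have h4 : (1 + 3 * δ) * (1 + δ) * (1 - η) * (2 * a * L) ≤ (1 - 15 * δ) * (2 * a * L) := by gcongr
  have h5 : (1 - 3 * δ) * (2 * a * L) ≤ (1 - δ) ^ 3 * (2 * a * L) := by gcongr
  have h6 : (1 - δ) ^ 3 * (2 * a * K) ≤ 1 * (2 * a * K) := by gcongr
  have h7 : (1 + 3 * δ) * K₂ ≤ 2 * K₂ := by gcongr; linarith
  nlinarith

lemma WalkLaw.capF_tube3_le_log {P : Zd 3 → Measure (ℕ → Zd 3)} (hW : WalkLaw 3 P) {α δ R : ℝ}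
    (hδ : 0 < δ) (hα : 0 < α) (hR : 0 < R) (hg : ∀ x : Zd 3, α / (len x + R) ≤ green x) {N p : ℕ}
    (hp : 1 ≤ p) (hN : 3 ≤ δ * N) (hL : 0 < Real.log ((N : ℝ) / p) - Real.log ((3 + R) / δ)) :
    capF P (tubeF 3 N p) ≤ N * (1 + 3 * δ)
      / (2 * α * (Real.log ((N : ℝ) / p) - Real.log ((3 + R) / δ))) := by
  have hp1 : (1 : ℝ) ≤ p := by exact_mod_cast hp
  have hN0 : (0 : ℝ) < N := by
    by_contra hc
    have := mul_nonneg hδ.le (sub_nonneg.2 (not_lt.1 hc))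
    linarith
  set m : ℕ := ⌈δ * N⌉₊ with hm
  have hm0 : 0 < m := Nat.ceil_pos.2 (by positivity)
  have hmle := Nat.ceil_lt_add_one (show 0 ≤ δ * N by positivity)
  have hmge := Nat.le_ceil (δ * N)
  rw [← hm] at hmle hmge
  have hLK : Real.log ((N : ℝ) / p) - Real.log ((3 + R) / δ)
      ≤ Real.log ((m + 1 + (2 * p + R)) / (1 + (2 * p + R))) := by
    rw [← Real.log_div (by positivity) (by positivity)]
    refine Real.log_le_log (by positivity) ?_
    have : (N : ℝ) / p / ((3 + R) / δ) = δ * N / ((3 + R) * p) := by field_simp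
    rw [this]
    refine div_le_div₀ (by positivity) (by linarith) (by positivity) ?_
    have := mul_le_mul_of_nonneg_left hp1 hR.le
    linarith
  refine (hW.capF_tube3_le hα hR hg N p m hm0).trans ?_
  refine div_le_div₀ (by positivity) (by linarith) (by positivity) ?_
  exact mul_le_mul_of_nonneg_left hLK (by positivity)

lemma exists_upper3 {η : ℝ} (hη : 0 < η) (hη1 : η < 1) : ∃ C : ℝ, 0 < C ∧
    ∀ P : Zd 3 → Measure (ℕ → Zd 3), WalkLaw 3 P → ∀ N p : ℕ, 1 ≤ p → p ≤ N →
      P 0 {ω | capF P (visF 0 N ω) ≤ capF P (tubeF 3 N p)}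
        ≤ ENNReal.ofReal (C * Real.exp (-((N : ℝ) / p) ^ (1 - η))) := by
  obtain ⟨a, ha, hasy⟩ := green_asymptotics
  set δ : ℝ := η / 20 with hδ
  have hδ0 : 0 < δ := by positivity
  have hδ1 : δ < 1 / 20 := by rw [hδ]; linarith
  obtain ⟨R₁, hR₁, hlow, hupp⟩ := hasy δ hδ0 (by linarith)
  obtain ⟨κ, hκ, R₀, hR₀, hpiece⟩ := exists_piece3 (Real.exp_pos (-(2 / δ)))
    (Real.exp_le_one_iff.2 (by have : 0 < 2 / δ := by positivity
                               linarith))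
  set K : ℝ := Real.log ((3 + R₁) / δ) with hK
  have hK0 : 0 ≤ K := Real.log_nonneg (by rw [le_div_iff₀ hδ0]; linarith)
  set K₂ : ℝ := 28 / κ + 2 * (1 + δ) * a with hK₂
  have hK₂0 : 0 ≤ K₂ := by positivity
  have ev : ∀ᶠ r : ℝ in atTop, 4 + 4 * R₀ + R₁ ≤ r ^ η ∧ 2 / δ ≤ r ^ (1 - η) ∧ 3 / δ ≤ r ∧
      (2 * K₂ + 2 * a * K + 1) / (δ * a) ≤ Real.log r ∧ K + 1 ≤ Real.log r :=
    ((tendsto_rpow_atTop hη).eventually_ge_atTop _).and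
      (((tendsto_rpow_atTop (by linarith : 0 < 1 - η)).eventually_ge_atTop _).and
        ((eventually_ge_atTop _).and ((Real.tendsto_log_atTop.eventually_ge_atTop _).and
          (Real.tendsto_log_atTop.eventually_ge_atTop _))))
  obtain ⟨r₀, hr₀⟩ := eventually_atTop.1 ev
  refine ⟨Real.exp 2 + Real.exp r₀, by positivity, fun P hW N p hp hpN => ?_⟩
  have := hW.prob
  have hp0 : (0 : ℝ) < p := by exact_mod_cast hp
  have hpN' : (p : ℝ) ≤ N := by exact_mod_cast hpN
  have hN0 : (0 : ℝ) < N := hp0.trans_le hpN'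
  set r : ℝ := N / p with hr
  have hr1 : 1 ≤ r := by rw [hr, one_le_div hp0]; exact hpN'
  have hr0 : 0 < r := by linarith
  rcases lt_or_ge r r₀ with hlt | hge
  · refine prob_le_one.trans ?_
    rw [← ENNReal.ofReal_one]
    refine ENNReal.ofReal_le_ofReal ?_
    have h1 : r ^ (1 - η) ≤ r := by
      calc r ^ (1 - η) ≤ r ^ (1 : ℝ) := Real.rpow_le_rpow_of_exponent_le hr1 (by linarith)
        _ = r := Real.rpow_one r
    calc (1 : ℝ) = Real.exp r₀ * Real.exp (-r₀) := by rw [← Real.exp_add]; simp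
      _ ≤ _ := by
        gcongr
        · linarith [Real.exp_pos 2]
        · linarith
  obtain ⟨e1, e2, e3, e4, e5⟩ := hr₀ r hge
  set L := Real.log r with hL
  set s : ℝ := p * r ^ η with hs
  have hsr : r ^ η ≤ s := by
    rw [hs]
    have : (1 : ℝ) ≤ p := by exact_mod_cast hp
    exact le_mul_of_one_le_left (by positivity) this
  have hs4 : 4 ≤ s := by linarith
  have hs0 : 0 < s := by linarith
  have hNs : N / s = r ^ (1 - η) := by
    rw [hs, Real.rpow_sub hr0, Real.rpow_one, ← div_div]
  set M : ℕ := ⌊(N : ℝ) / s⌋₊ - 1 with hM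
  have hfl : 2 ≤ ⌊(N : ℝ) / s⌋₊ := by
    refine Nat.le_floor ?_
    rw [hNs]
    refine le_trans ?_ e2
    rw [le_div_iff₀ hδ0]
    push_cast
    linarith
  have hM1 : 1 ≤ M := by omega
  have hMf : (M : ℝ) + 1 = ⌊(N : ℝ) / s⌋₊ := by
    have : M + 1 = ⌊(N : ℝ) / s⌋₊ := by omega
    exact_mod_cast this
  have hf1 := Nat.floor_le (show 0 ≤ (N : ℝ) / s by positivity)
  have hf2 := Nat.lt_floor_add_one ((N : ℝ) / s)
  rw [← hMf] at hf1 hf2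
  have hMs1 : ((M : ℝ) + 1) * s ≤ N := (le_div_iff₀ hs0).1 hf1
  have hMs2 : (N : ℝ) ≤ (M + 2) * s := by
    have := (div_lt_iff₀ hs0).1 hf2
    linarith
  have hR14 : (0 : ℝ) < 4 * R₀ := by positivity
  have hshell := hW.shells_cap le_rfl (δ := δ) (s := s) (κ := κ * (s / 4)) (N := N)
    (γ := fun i => (1 + δ) * a / s * (1 / i)) hδ0 hs4 (by positivity)
    (hpiece P hW (s / 4) (by linarith)) (fun i => by positivity) ?_ hMs1 hMs2
  swap
  · intro i hi x hx
    have hi' : (2 : ℝ) ≤ i := by exact_mod_cast hi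
    have h2s : 2 * s ≤ i * s := by gcongr
    refine (hupp x (by linarith)).trans ?_
    have : (1 + δ) * a / s * (1 / i) = (1 + δ) * a / (i * s) := by field_simp
    rw [this]
    gcongr
  have hprob : ENNReal.ofReal (Real.exp (-M))
      ≤ ENNReal.ofReal ((Real.exp 2 + Real.exp r₀) * Real.exp (-r ^ (1 - η))) := by
    refine ENNReal.ofReal_le_ofReal ?_
    calc Real.exp (-M) ≤ Real.exp (2 + -r ^ (1 - η)) := by
          apply Real.exp_le_exp.2
          rw [← hNs]
          linarith
      _ = Real.exp 2 * Real.exp (-r ^ (1 - η)) := Real.exp_add _ _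
      _ ≤ _ := by gcongr; linarith [Real.exp_pos r₀]
  refine (measure_mono ?_).trans (hshell.trans hprob)
  -- comparison of the two capacities
  set S : ℝ := 7 / (κ * (s / 4)) + 2 * ∑ i ∈ Finset.range M, (1 + δ) * a / s * (1 / (i : ℝ)) with hS
  have hS0 : 0 ≤ S := by positivity
  have hSle : S ≤ (K₂ + 2 * (1 + δ) * a * ((1 - η) * L)) / s := by
    have h1 := sum_inv_range_le (M := M)
    have h2 : Real.log M ≤ (1 - η) * L := by
      rw [hL, ← Real.log_rpow hr0, ← hNs]
      exact Real.log_le_log (by exact_mod_cast hM1) (by linarith)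
    have h3 : S = (28 / κ + 2 * (1 + δ) * a * ∑ i ∈ Finset.range M, 1 / (i : ℝ)) / s := by
      rw [hS, ← Finset.mul_sum]
      field_simp
      norm_num
    rw [h3, hK₂]
    refine div_le_div_of_nonneg_right ?_ hs0.le
    have h4 : 2 * (1 + δ) * a * ∑ i ∈ Finset.range M, 1 / (i : ℝ)
        ≤ 2 * (1 + δ) * a * (1 + (1 - η) * L) := by
      gcongr
      linarith
    linarith
  have hN3 : 3 ≤ δ * N := by
    have h1 : r ≤ N := by
      rw [hr]
      exact div_le_self hN0.le (by exact_mod_cast hp)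
    have h2 : 3 ≤ r * δ := (div_le_iff₀ hδ0).1 e3
    have h3 : r * δ ≤ N * δ := mul_le_mul_of_nonneg_right h1 hδ0.le
    linarith
  have hLK0 : 0 < L - K := by linarith
  have htube : capF P (tubeF 3 N p) ≤ N * (1 + 3 * δ) / (2 * ((1 - δ) * a) * (L - K)) :=
    hW.capF_tube3_le_log hδ0 (mul_pos (by linarith) ha) hR₁ hlow hp hN3 hLK0
  have hlog := small_log_compare hη hη1 hδ ha hK0 hK₂0 e4
  have hfin : capF P (tubeF 3 N p) * S < (1 - δ) * M := by
    have hδ' : 0 < 1 - δ := by linarith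
    have hM2 : (1 - δ) * (N / s) ≤ M := by
      have : 2 ≤ δ * (N / s) := by
        rw [hNs]
        rw [div_le_iff₀ hδ0] at e2
        linarith
      linarith
    calc capF P (tubeF 3 N p) * S ≤ N * (1 + 3 * δ) / (2 * ((1 - δ) * a) * (L - K)) *
          ((K₂ + 2 * (1 + δ) * a * ((1 - η) * L)) / s) := by
          gcongr
      _ = (N / s) * ((1 + 3 * δ) * (K₂ + 2 * (1 + δ) * a * ((1 - η) * L)))
          / (2 * ((1 - δ) * a) * (L - K)) := by field_simp
      _ < (N / s) * ((1 - δ) ^ 3 * (2 * a * (L - K))) / (2 * ((1 - δ) * a) * (L - K)) := by gcongr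
      _ = (1 - δ) * ((1 - δ) * (N / s)) := by field_simp
      _ ≤ _ := by gcongr
  intro ω hω
  have hω' : capF P (visF 0 N ω) ≤ capF P (tubeF 3 N p) := hω
  exact lt_of_le_of_lt (mul_le_mul_of_nonneg_right hω' hS0) hfin

lemma defect_f4_le (w : Zd 4) : f4 w - avg f4 w ≤ 3000 * reg w ^ (-((3 / 4 : ℝ) * (4 : ℕ))) := by
  have h1 := le_avg_f4 w
  have h2 := reg_pos w
  have h3 : reg w ^ (-((3 / 4 : ℝ) * (4 : ℕ))) = (reg w ^ 3)⁻¹ := by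
    rw [Real.rpow_neg h2.le]
    norm_num
  have h4 : f4 w * (1 - 3000 / reg w ^ 2) = f4 w - 3000 * (reg w ^ 3)⁻¹ := by
    unfold f4
    field_simp
  rw [h3]
  linarith

lemma summable_defect_f4 : Summable fun w : Zd 4 => f4 w - avg f4 w :=
  Summable.of_nonneg_of_le (fun w => (sub_pos.2 (avg_f4_lt w)).le) defect_f4_le
    ((summable_reg_rpow (by norm_num)).mul_left _)

lemma WalkLaw.sum_esc_f4_le {P : Zd 4 → Measure (ℕ → Zd 4)} (hW : WalkLaw 4 P) (A : Finset (Zd 4))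
    (v : Zd 4) : ∑ a ∈ A, esc P A a * f4 (a - v) ≤ ∑' w : Zd 4, (f4 w - avg f4 w) := by
  have h1 : ∀ a ∈ A, HasSum (fun w => esc P A a * (green (a - v - w) * (f4 w - avg f4 w)))
      (esc P A a * f4 (a - v)) := fun a _ =>
    (riesz (by norm_num) (fun x => (f4_pos x).le) (fun x => (avg_f4_lt x).le) tendsto_f4
      (a - v)).mul_left _
  refine hasSum_le (fun w => ?_) (hasSum_sum h1) summable_defect_f4.hasSum
  have h2 := hW.potential_le_one (by norm_num) A (v + w)
  have h3 : ∑ a ∈ A, esc P A a * (green (a - v - w) * (f4 w - avg f4 w))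
      = (f4 w - avg f4 w) * ∑ a ∈ A, green (v + w - a) * esc P A a := by
    rw [Finset.mul_sum]
    refine Finset.sum_congr rfl fun a _ => ?_
    rw [sub_sub, green_sub_comm]
    ring
  rw [h3]
  exact mul_le_of_le_one_right (sub_pos.2 (avg_f4_lt w)).le h2

lemma le_f4_sub_axis {p : ℕ} (hp : 1 ≤ p) {x : Zd 4} {N : ℤ} (hx : x ∈ tube 4 N p) {j : ℤ}
    (hj : |x 0 - j| ≤ p) : 1 / (2004 * (p : ℝ) ^ 2) ≤ f4 (x - axis j) := by
  have h1 := hx 1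
  have h2 := hx 2
  have h3 := hx 3
  rw [if_neg (by decide)] at h1 h2 h3
  have hb : ∀ z : ℤ, |z| ≤ p → (z : ℝ) ^ 2 ≤ (p : ℝ) ^ 2 := fun z hz => by
    rw [← sq_abs (z : ℝ)]
    have : |(z : ℝ)| ≤ p := by exact_mod_cast hz
    gcongr
  have hp1 : (1 : ℝ) ≤ p := by exact_mod_cast hp
  unfold f4 reg
  rw [nsq, Fin.sum_univ_four]
  have e0 : (x - (axis j : Zd 4)) 0 = x 0 - j := by simp [axis]
  have e1 : (x - (axis j : Zd 4)) 1 = x 1 := by simp [axis]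
  have e2 : (x - (axis j : Zd 4)) 2 = x 2 := by simp [axis]
  have e3 : (x - (axis j : Zd 4)) 3 = x 3 := by simp [axis]
  rw [e0, e1, e2, e3, one_div]
  refine inv_anti₀ (by positivity) ?_
  nlinarith [hb _ hj, hb _ h1, hb _ h2, hb _ h3]

lemma exists_capF_tube4_le : ∃ D : ℝ, 0 < D ∧ ∀ P : Zd 4 → Measure (ℕ → Zd 4), WalkLaw 4 P →
    ∀ N p : ℕ, 1 ≤ p → p ≤ N → capF P (tubeF 4 N p) ≤ D * N * p := by
  set D₀ : ℝ := ∑' w : Zd 4, (f4 w - avg f4 w) with hD₀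
  have hD₀0 : 0 ≤ D₀ := tsum_nonneg fun w => (sub_pos.2 (avg_f4_lt w)).le
  refine ⟨4008 * D₀ + 1, by positivity, fun P hW N p hp hpN => ?_⟩
  have hp1 : (1 : ℝ) ≤ p := by exact_mod_cast hp
  have hpN' : (p : ℝ) ≤ N := by exact_mod_cast hpN
  set v : ℕ → Zd 4 := fun k => axis ((k : ℤ) - p) with hv
  have h1 : ∑ k ∈ Finset.range (N + 2 * p + 1), ∑ a ∈ tubeF 4 N p,
      esc P (tubeF 4 N p) a * f4 (a - v k) ≤ (N + 2 * p + 1) * D₀ := by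
    refine (Finset.sum_le_sum fun k _ => hW.sum_esc_f4_le _ (v k)).trans ?_
    simp [hD₀]
  rw [Finset.sum_comm] at h1
  have h2 : ∀ a ∈ tubeF 4 N p, esc P (tubeF 4 N p) a * (1 / (1002 * p))
      ≤ ∑ k ∈ Finset.range (N + 2 * p + 1), esc P (tubeF 4 N p) a * f4 (a - v k) := fun a ha => by
    rw [← Finset.mul_sum]
    refine mul_le_mul_of_nonneg_left ?_ (esc_nonneg _ _)
    rw [mem_tubeF] at ha
    have hx0 := ha 0
    rw [if_pos (by decide)] at hx0
    obtain ⟨n₀, hn₀⟩ := Int.eq_ofNat_of_zero_le hx0.1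
    have hn : n₀ ≤ N := by omega
    have h3 := sum_window_le (f := fun k => f4 (a - v k)) (fun k => (f4_pos _).le) (m := p) hn
    have h4 : p * (1 / (2004 * (p : ℝ) ^ 2))
        ≤ ∑ i ∈ Finset.range p, f4 (a - v (n₀ + p + 1 + i)) := by
      rw [← nsmul_eq_mul, ← Finset.card_range p, ← Finset.sum_const, Finset.card_range]
      refine Finset.sum_le_sum fun i hi => le_f4_sub_axis hp ha ?_
      have := Finset.mem_range.1 hi
      rw [hn₀, abs_le]
      push_cast
      constructor <;> omega
    have h5 : p * (1 / (2004 * (p : ℝ) ^ 2))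
        ≤ ∑ i ∈ Finset.range p, f4 (a - v (n₀ + p - 1 - i)) := by
      rw [← nsmul_eq_mul, ← Finset.card_range p, ← Finset.sum_const, Finset.card_range]
      refine Finset.sum_le_sum fun i hi => le_f4_sub_axis hp ha ?_
      have := Finset.mem_range.1 hi
      rw [hn₀, abs_le]
      constructor <;> omega
    have h6 : (1 : ℝ) / (1002 * p) = p * (1 / (2004 * (p : ℝ) ^ 2)) + p * (1 / (2004 * (p : ℝ) ^ 2)) := by
      field_simp
      norm_num
    linarith
  have h3 := (Finset.sum_le_sum h2).trans h1
  rw [← Finset.sum_mul] at h3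
  change capF P _ * _ ≤ _ at h3
  rw [mul_one_div, div_le_iff₀ (by positivity)] at h3
  refine h3.trans ?_
  have h7 : (N + 2 * p + 1 : ℝ) * D₀ ≤ (4 * N) * D₀ := by gcongr; linarith
  calc (N + 2 * p + 1 : ℝ) * D₀ * (1002 * p) ≤ (4 * N) * D₀ * (1002 * p) := by gcongr
    _ = 4008 * D₀ * N * p := by ring
    _ ≤ _ := by gcongr; linarith

lemma sum_inv_sq_range_le (M : ℕ) : ∑ i ∈ Finset.range M, 1 / (i : ℝ) ^ 2 ≤ 2 := by
  have h : ∀ M : ℕ, ∑ i ∈ Finset.range (M + 2), 1 / (i : ℝ) ^ 2 ≤ 2 - 1 / ((M : ℝ) + 1) := by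
    intro M
    induction M with
    | zero => norm_num [Finset.sum_range_succ]
    | succ M ih =>
      rw [Finset.sum_range_succ]
      have : 1 / (((M + 2 : ℕ) : ℝ)) ^ 2 ≤ 1 / ((M : ℝ) + 1) - 1 / ((M : ℝ) + 2) := by
        rw [div_sub_div _ _ (by positivity) (by positivity), div_le_div_iff₀ (by positivity) (by positivity)]
        push_cast
        nlinarith
      have e : (((M + 1 : ℕ) : ℝ)) + 1 = M + 2 := by push_cast; ring
      rw [e]
      linarith
  refine (Finset.sum_le_sum_of_subset_of_nonneg (Finset.range_subset_range.2 (Nat.le_add_right M 2))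
    fun _ _ _ => by positivity).trans ((h M).trans ?_)
  have : (0 : ℝ) ≤ 1 / ((M : ℝ) + 1) := by positivity
  linarith

lemma exists_scale4 {K R₀ : ℝ} (hK : 0 ≤ K) : ∃ A : ℝ, 4 + 4 * R₀ ≤ A ∧ 4 ≤ A ∧
    ∀ p : ℕ, 1 ≤ p → K * p * Real.log (A * p * max 1 (Real.log p)) < A * p * max 1 (Real.log p) := by
  have h1 : ∀ᶠ A : ℝ in atTop, Real.log A ≤ 1 / (4 * (K + 1)) * A := by
    have := (Real.isLittleO_log_id_atTop).bound (show 0 < 1 / (4 * (K + 1)) by positivity)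
    filter_upwards [this, eventually_ge_atTop 1] with A hA hA1
    rw [Real.norm_of_nonneg (Real.log_nonneg hA1), id, Real.norm_of_nonneg (by linarith)] at hA
    exact hA
  obtain ⟨A, hA1, hA2, hA3, hA4⟩ := (h1.and ((eventually_ge_atTop (4 + 4 * R₀)).and
    ((eventually_ge_atTop 4).and (eventually_ge_atTop (8 * (K + 1)))))).exists
  refine ⟨A, hA2, hA3, fun p hp => ?_⟩
  have hp1 : (1 : ℝ) ≤ p := by exact_mod_cast hp
  set l : ℝ := max 1 (Real.log p) with hl
  have hl1 : 1 ≤ l := le_max_left _ _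
  have hl2 : Real.log p ≤ l := le_max_right _ _
  have h2 : Real.log (A * p * l) ≤ (Real.log A + 2) * l := by
    rw [Real.log_mul (by positivity) (by positivity), Real.log_mul (by positivity) (by positivity)]
    have h3 : Real.log l ≤ l := (Real.log_le_sub_one_of_pos (by positivity)).trans (by linarith)
    have h4 : 0 ≤ Real.log A := Real.log_nonneg (by linarith)
    nlinarith
  have h5 : (K + 1) * (Real.log A + 2) ≤ A / 2 := by
    have h6 : (K + 1) * Real.log A ≤ (K + 1) * (1 / (4 * (K + 1)) * A) := by gcongr
    have h7 : (K + 1) * (1 / (4 * (K + 1)) * A) = A / 4 := by field_simp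
    linarith
  have h8 : 0 ≤ Real.log A + 2 := by linarith [Real.log_nonneg (show 1 ≤ A by linarith)]
  calc K * p * Real.log (A * p * l) ≤ K * p * ((Real.log A + 2) * l) := by gcongr
    _ ≤ (K + 1) * p * ((Real.log A + 2) * l) := by gcongr; linarith
    _ = (K + 1) * (Real.log A + 2) * (p * l) := by ring
    _ ≤ A / 2 * (p * l) := by gcongr
    _ < A * p * l := by
      have : 0 < A * p * l := by positivity
      linarith

lemma exists_upper4 : ∃ c C : ℝ, 0 < c ∧ 0 < C ∧
    ∀ P : Zd 4 → Measure (ℕ → Zd 4), WalkLaw 4 P → ∀ N p : ℕ, 1 ≤ p → p ≤ N →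
      P 0 {ω | capF P (visF 0 N ω) ≤ capF P (tubeF 4 N p)}
        ≤ ENNReal.ofReal (C * Real.exp (-(c * N / (p * (max 1 (Real.log p)) ^ 2)))) := by
  obtain ⟨D, hD, htube⟩ := exists_capF_tube4_le
  obtain ⟨Cg, hCg, hgreen⟩ := exists_green_le_f4
  obtain ⟨κ, hκ, R₀, hR₀, hpiece⟩ := exists_piece4 (Real.exp_pos (-(2 / (1 / 2))))
    (Real.exp_le_one_iff.2 (by norm_num))
  set B : ℝ := 112 / κ + 4 * Cg with hB
  obtain ⟨A, hA1, hA2, hA3⟩ := exists_scale4 (K := 4 * D * B) (R₀ := R₀) (by positivity)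
  have hA0 : 0 < A := by linarith
  refine ⟨1 / A, Real.exp 4, by positivity, by positivity, fun P hW N p hp hpN => ?_⟩
  have := hW.prob
  have hp1 : (1 : ℝ) ≤ p := by exact_mod_cast hp
  have hpN' : (p : ℝ) ≤ N := by exact_mod_cast hpN
  have hN0 : (0 : ℝ) < N := by linarith
  have hcmp := hA3 p hp
  set l : ℝ := max 1 (Real.log p) with hl
  have hl1 : 1 ≤ l := le_max_left _ _
  set s : ℝ := A * p * l with hs
  have hs0 : 0 < s := by positivity
  have hsA : A ≤ s := by
    have : 1 ≤ p * l := one_le_mul_of_one_le_of_one_le hp1 hl1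
    calc A = A * 1 := (mul_one A).symm
      _ ≤ A * (p * l) := by gcongr
      _ = s := by rw [hs]; ring
  have hs4 : 4 ≤ s := by linarith
  have hexp : 1 / A * N / (p * l ^ 2) ≤ N / s := by
    have : 1 / A * N / (p * l ^ 2) = N / (s * l) := by
      rw [hs]
      field_simp
    rw [this]
    exact div_le_div_of_nonneg_left hN0.le hs0 (le_mul_of_one_le_right hs0.le hl1)
  have hgoal : ∀ t : ℝ, N / s - 4 ≤ t → ENNReal.ofReal (Real.exp (-t))
      ≤ ENNReal.ofReal (Real.exp 4 * Real.exp (-(1 / A * N / (p * l ^ 2)))) := fun t ht => by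
    rw [← Real.exp_add]
    refine ENNReal.ofReal_le_ofReal (Real.exp_le_exp.2 ?_)
    linarith
  rcases lt_or_ge ((N : ℝ) / s) 4 with hlt | hge
  · refine (prob_le_one.trans ?_).trans (hgoal 0 (by linarith))
    simp
  set M : ℕ := ⌊(N : ℝ) / s⌋₊ - 1 with hM
  have hfl : 4 ≤ ⌊(N : ℝ) / s⌋₊ := Nat.le_floor (by exact_mod_cast hge)
  have hMf : (M : ℝ) + 1 = ⌊(N : ℝ) / s⌋₊ := by
    have : M + 1 = ⌊(N : ℝ) / s⌋₊ := by omega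
    exact_mod_cast this
  have hf1 := Nat.floor_le (show 0 ≤ (N : ℝ) / s by positivity)
  have hf2 := Nat.lt_floor_add_one ((N : ℝ) / s)
  rw [← hMf] at hf1 hf2
  have hMs1 : ((M : ℝ) + 1) * s ≤ N := (le_div_iff₀ hs0).1 hf1
  have hMs2 : (N : ℝ) ≤ (M + 2) * s := by
    have := (div_lt_iff₀ hs0).1 hf2
    linarith
  have hlog4 : 0 < Real.log (s / 4) := Real.log_pos (by linarith)
  have hlogs : Real.log (s / 4) ≤ Real.log s := Real.log_le_log (by positivity) (by linarith)
  have hlog1 : 1 ≤ Real.log s := by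
    rw [Real.le_log_iff_exp_le hs0]
    linarith [Real.exp_one_lt_d9]
  have hshell := hW.shells_cap (by norm_num) (δ := 1 / 2) (s := s)
    (κ := κ * (s / 4) ^ 2 / Real.log (s / 4)) (N := N)
    (γ := fun i => Cg / s ^ 2 * (1 / (i : ℝ) ^ 2)) (by norm_num) hs4 (by positivity)
    (hpiece P hW (s / 4) (by linarith)) (fun i => by positivity) ?_ hMs1 hMs2
  swap
  · intro i hi x hx
    have hi' : (2 : ℝ) ≤ i := by exact_mod_cast hi
    refine (hgreen x).trans ?_
    have h1 : (i * s) ^ 2 ≤ reg x := by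
      have h2 : (i * s) ^ 2 ≤ len x ^ 2 := by gcongr
      rw [len_sq] at h2
      unfold reg
      linarith
    have h3 : Cg / s ^ 2 * (1 / (i : ℝ) ^ 2) = Cg * ((i * s) ^ 2)⁻¹ := by field_simp
    rw [h3]
    unfold f4
    gcongr
  refine (measure_mono ?_).trans (hshell.trans (hgoal M (by linarith)))
  set S : ℝ := 7 / (κ * (s / 4) ^ 2 / Real.log (s / 4))
    + 2 * ∑ i ∈ Finset.range M, Cg / s ^ 2 * (1 / (i : ℝ) ^ 2) with hS
  have hS0 : 0 ≤ S := by positivity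
  have hSle : S ≤ B * Real.log s / s ^ 2 := by
    have h1 := sum_inv_sq_range_le M
    have h3 : S = (112 / κ * Real.log (s / 4)
        + 2 * Cg * ∑ i ∈ Finset.range M, 1 / (i : ℝ) ^ 2) / s ^ 2 := by
      rw [hS, ← Finset.mul_sum]
      field_simp
      norm_num
      ring
    rw [h3, hB]
    refine div_le_div_of_nonneg_right ?_ (by positivity)
    have h4 : 2 * Cg * ∑ i ∈ Finset.range M, 1 / (i : ℝ) ^ 2 ≤ 2 * Cg * 2 := by gcongr
    have h5 : 112 / κ * Real.log (s / 4) ≤ 112 / κ * Real.log s := by gcongr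
    have h6 : 4 * Cg * 1 ≤ 4 * Cg * Real.log s := by gcongr
    linarith
  have hfin : capF P (tubeF 4 N p) * S < (1 - 1 / 2) * M := by
    calc capF P (tubeF 4 N p) * S ≤ (D * N * p) * (B * Real.log s / s ^ 2) :=
          mul_le_mul (htube P hW N p hp hpN) hSle hS0 (by positivity)
      _ = (N / s) * (4 * D * B * p * Real.log s) / (4 * s) := by field_simp
      _ < (N / s) * s / (4 * s) := by gcongr
      _ = (N / s) / 4 := by field_simp
      _ ≤ _ := by linarith
  intro ω hω
  have hω' : capF P (visF 0 N ω) ≤ capF P (tubeF 4 N p) := hω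
  exact lt_of_le_of_lt (mul_le_mul_of_nonneg_right hω' hS0) hfin

section Walk

variable {P : Zd d → Measure (ℕ → Zd d)}

lemma avg_le_avg_of_nbr {f g : Zd d → ℝ} {x : Zd d}
    (h : ∀ i : Fin d, f (x + Pi.single i 1) ≤ g (x + Pi.single i 1) ∧
      f (x - Pi.single i 1) ≤ g (x - Pi.single i 1)) : avg f x ≤ avg g x := by
  unfold avg
  refine div_le_div_of_nonneg_right (Finset.sum_le_sum fun i _ => ?_) (by positivity)
  exact add_le_add (h i).1 (h i).2

/-- Trajectories which, up to time `n`, leave `U` only by jumping out of `B`. -/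
def goodExit {V : Type} (U B : Set V) (n : ℕ) : Set (ℕ → V) :=
  {ω | (∃ k ≤ n, (∀ j < k, ω j ∈ U) ∧ ω k ∉ B) ∨ ∀ j ≤ n, ω j ∈ U}

lemma measurableSet_goodExit (U B : Set (Zd d)) (n : ℕ) : MeasurableSet (goodExit U B n) := by
  refine DetBy.measurableSet (n := n) fun ω ω' h => ?_
  unfold goodExit
  refine or_congr (exists_congr fun k => and_congr_right fun hk => and_congr ?_ ?_)
    (forall₂_congr fun j hj => by rw [h j hj])
  · exact forall₂_congr fun j hj => by rw [h j (by omega)]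
  · rw [h k hk]

lemma goodExit_cons {V : Type} {U B : Set V} {x : V} (hx : x ∈ U) (n : ℕ) :
    goodExit U B n ⊆ cons x ⁻¹' goodExit U B (n + 1) := by
  rintro ω (⟨k, hk, h1, h2⟩ | h)
  · refine Or.inl ⟨k + 1, by omega, fun j hj => ?_, by simpa using h2⟩
    rcases j with _ | j
    · simpa using hx
    · simpa using h1 j (by omega)
  · refine Or.inr fun j hj => ?_
    rcases j with _ | j
    · simpa using hx
    · simpa using h j (by omega)

/-- Optional stopping for a function which is subharmonic on `U`, at most `H` near `U`, and
nonpositive at the points of `B` outside `U`. -/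
lemma WalkLaw.le_mul_goodExit (hW : WalkLaw d P) (hd : 0 < d) {U B : Set (Zd d)} {h : Zd d → ℝ}
    {H : ℝ} (hH : 0 ≤ H) (hsub : ∀ x ∈ U, h x ≤ avg h x)
    (hnbr : ∀ x ∈ U, ∀ i : Fin d, ∀ y, y = x + Pi.single i 1 ∨ y = x - Pi.single i 1 →
      h y ≤ H ∧ (y ∈ B → y ∉ U → h y ≤ 0)) (n : ℕ) :
    ∀ x, h x ≤ H → (x ∈ B → x ∉ U → h x ≤ 0) → h x ≤ H * (P x).real (goodExit U B n) := by
  have := hW.prob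
  have hone : ∀ (n : ℕ) (x : Zd d), h x ≤ H → x ∉ B → h x ≤ H * (P x).real (goodExit U B n) := by
    intro n x hx hxB
    have : (P x).real (goodExit U B n) = 1 := by
      rw [← probReal_univ (μ := P x)]
      refine measureReal_congr (eventuallyEq_univ.2 ?_)
      filter_upwards [hW.ae_start x] with ω h0
      exact Or.inl ⟨0, Nat.zero_le _, fun j hj => absurd hj (Nat.not_lt_zero j), by rwa [h0]⟩
    rwa [this, mul_one]
  induction n with
  | zero =>
    intro x hx hxB
    by_cases hB : x ∈ B
    · by_cases hU : x ∈ U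
      · have : (P x).real (goodExit U B 0) = 1 := by
          rw [← probReal_univ (μ := P x)]
          refine measureReal_congr (eventuallyEq_univ.2 ?_)
          filter_upwards [hW.ae_start x] with ω h0
          refine Or.inr fun j hj => ?_
          rw [Nat.le_zero.1 hj, h0]
          exact hU
        rwa [this, mul_one]
      · exact (hxB hB hU).trans (by positivity)
    · exact hone 0 x hx hB
  | succ n ih =>
    intro x hx hxB
    by_cases hU : x ∈ U
    · rw [hW.real_one_step hd x (measurableSet_goodExit _ _ _), ← congrFun (avg_const_mul H _) x]
      refine (hsub x hU).trans (avg_le_avg_of_nbr fun i => ?_)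
      have key : ∀ y, y = x + Pi.single i 1 ∨ y = x - Pi.single i 1 →
          h y ≤ H * (P y).real (cons x ⁻¹' goodExit U B (n + 1)) := fun y hy => by
        refine (ih y (hnbr x hU i y hy).1 (hnbr x hU i y hy).2).trans ?_
        exact mul_le_mul_of_nonneg_left (measureReal_mono (goodExit_cons hU n)) hH
      exact ⟨key _ (Or.inl rfl), key _ (Or.inr rfl)⟩
    · by_cases hB : x ∈ B
      · exact (hxB hB hU).trans (by positivity)
      · exact hone _ x hx hB

lemma WalkLaw.tendsto_stay (hW : WalkLaw d P) (hd : 3 ≤ d) (A : Finset (Zd d)) (x : Zd d) :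
    Tendsto (fun n : ℕ => (P x).real {ω | ∀ j ≤ n, ω j ∈ A}) atTop (𝓝 0) := by
  have := hW.prob
  have hm : ∀ n : ℕ, MeasurableSet {ω : ℕ → Zd d | ∀ j ≤ n, ω j ∈ A} := fun n =>
    DetBy.measurableSet (n := n) fun ω ω' h => forall₂_congr fun j hj => by rw [h j hj]
  have h0 : P x (⋂ n : ℕ, {ω | ∀ j ≤ n, ω j ∈ A}) = 0 := by
    have h1 := hW.ae_eventually_notMem hd A x
    rw [← compl_compl (⋂ n : ℕ, _), ← mem_ae_iff]
    filter_upwards [h1] with ω hev hω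
    obtain ⟨n, hn⟩ := hev.exists
    exact hn (Set.mem_iInter.1 hω n n le_rfl)
  have h2 := tendsto_measure_iInter_atTop (μ := P x) (fun n => (hm n).nullMeasurableSet)
    (fun n m hnm ω hω j hj => hω j (hj.trans hnm)) ⟨0, measure_ne_top _ _⟩
  rw [h0] at h2
  have h3 := (ENNReal.tendsto_toReal ENNReal.zero_ne_top).comp h2
  exact h3

/-- Lower bound for the probability that the range is thin, from a test function on a translated
tube. -/
lemma WalkLaw.le_prob_thin (hW : WalkLaw d P) (hd : 3 ≤ d) {N p : ℕ} (v : Zd d) {h : Zd d → ℝ}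
    {H : ℝ} (hH : 0 < H)
    (hsub : ∀ x, x + v ∈ tube d N p → h x ≤ avg h x)
    (hnbr : ∀ x, x + v ∈ tube d N p → ∀ i : Fin d, ∀ y, y = x + Pi.single i 1 ∨ y = x - Pi.single i 1 →
      h y ≤ H ∧ (len y ≤ N → y + v ∉ tube d N p → h y ≤ 0))
    (hv : v ∈ tube d N p) (h0 : h 0 ≤ H) :
    ENNReal.ofReal (h 0 / H) ≤ P 0 {ω | capF P (visF 0 N ω) ≤ capF P (tubeF d N p)} := by
  have := hW.prob
  set E := {ω | capF P (visF 0 N ω) ≤ capF P (tubeF d N p)} with hE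
  set B : Set (Zd d) := ballZ 0 N with hB
  set U : Set (Zd d) := {x | x + v ∈ tube d N p} ∩ B with hU
  set A : Finset (Zd d) := (finite_ballZ (0 : Zd d) (N : ℝ)).toFinset with hA
  have h0U : (0 : Zd d) ∈ U := by
    refine ⟨show 0 + v ∈ tube d N p by simpa using hv, ?_⟩
    rw [hB, mem_ballZ_zero]
    simp [len]
  have hkey : ∀ n : ℕ, h 0 / H ≤ (P 0).real E + (P 0).real {ω | ∀ j ≤ n, ω j ∈ A} := fun n => by
    have h1 := hW.le_mul_goodExit (by omega) (U := U) (B := B) hH.le (fun x hx => hsub x hx.1)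
      (fun x hx i y hy => ⟨(hnbr x hx.1 i y hy).1, fun hyB hyU =>
        (hnbr x hx.1 i y hy).2 (mem_ballZ_zero.1 hyB) fun hyv => hyU ⟨hyv, hyB⟩⟩) n 0 h0
      (fun _ hn => absurd h0U hn)
    rw [div_le_iff₀' hH]
    refine h1.trans (mul_le_mul_of_nonneg_left ?_ hH.le)
    refine le_trans (measureReal_mono ?_) (measureReal_union_le _ _)
    rintro ω (⟨k, -, hk1, hk2⟩ | hs)
    · left
      refine (hW.capF_translate_le hd _ v).trans (hW.capF_mono hd fun y hy => ?_)
      obtain ⟨z, hz, rfl⟩ := Finset.mem_image.1 hy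
      obtain ⟨m, hm1, rfl⟩ := mem_visF.1 hz
      rw [mem_tubeF]
      exact (hk1 m (by by_contra hc; exact hk2 (hm1 k (by omega)))).1
    · right
      exact fun j hj => (Set.Finite.mem_toFinset _).2 (hs j hj).2
  have hlim := (hW.tendsto_stay hd A 0).const_add ((P 0).real E)
  rw [add_zero] at hlim
  have hfin := ge_of_tendsto' hlim hkey
  rw [← ENNReal.ofReal_toReal (measure_ne_top (P 0) E)]
  exact ENNReal.ofReal_le_ofReal hfin

end Walk

lemma avg_prod {g : Fin d → ℤ → ℝ} {c : Fin d → ℝ}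
    (hg : ∀ i t, g i (t + 1) + g i (t - 1) = 2 * c i * g i t) (x : Zd d) :
    avg (fun x => ∏ i, g i (x i)) x = (∑ i, c i) / d * ∏ i, g i (x i) := by
  have h : ∀ i : Fin d, (∏ j, g j ((x + Pi.single i 1 : Zd d) j))
      + ∏ j, g j ((x - Pi.single i 1 : Zd d) j) = 2 * c i * ∏ j, g j (x j) := fun i => by
    have e : ∀ z : Zd d, (∀ j, j ≠ i → z j = x j) →
        ∏ j, g j (z j) = g i (z i) * ∏ j ∈ Finset.univ.erase i, g j (x j) := fun z hz => by
      rw [← Finset.mul_prod_erase _ _ (Finset.mem_univ i)]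
      congr 1
      exact Finset.prod_congr rfl fun j hj => by rw [hz j (Finset.ne_of_mem_erase hj)]
    rw [e (x + Pi.single i 1) fun j hj => by simp [hj], e (x - Pi.single i 1) fun j hj => by simp [hj],
      e x fun j _ => rfl, ← add_mul, Pi.add_apply, Pi.sub_apply, Pi.single_eq_same, hg]
    ring
  unfold avg
  rw [Finset.sum_congr rfl fun i _ => h i, ← Finset.sum_mul, ← Finset.mul_sum]
  rcases Nat.eq_zero_or_pos d with rfl | hd
  · simp
  · field_simp

/-- A product of one-dimensional profiles: `A` along the first axis, `B` along the second one and
`C` along the remaining ones. -/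
def profile (A B C : ℤ → ℝ) (x : Zd d) : ℝ :=
  ∏ i : Fin d, (if (i : ℕ) = 0 then A else if (i : ℕ) = 1 then B else C) (x i)

lemma avg_profile (hd : 3 ≤ d) {A B C : ℤ → ℝ} {a b c : ℝ}
    (hA : ∀ t, A (t + 1) + A (t - 1) = 2 * a * A t) (hB : ∀ t, B (t + 1) + B (t - 1) = 2 * b * B t)
    (hC : ∀ t, C (t + 1) + C (t - 1) = 2 * c * C t) (hs : a + b + (d - 2) * c = d) (x : Zd d) :
    avg (profile A B C) x = profile A B C x := by
  have h := avg_prod (g := fun i : Fin d => if (i : ℕ) = 0 then A else if (i : ℕ) = 1 then B else C)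
    (c := fun i : Fin d => if (i : ℕ) = 0 then a else if (i : ℕ) = 1 then b else c)
    (fun i t => by split_ifs <;> simp only [hA, hB, hC]) x
  have hsum : (∑ i : Fin d, if (i : ℕ) = 0 then a else if (i : ℕ) = 1 then b else c) = d := by
    obtain ⟨n, rfl⟩ : ∃ n, d = n + 2 := ⟨d - 2, by omega⟩
    rw [Fin.sum_univ_succ, Fin.sum_univ_succ]
    push_cast at hs
    simp
    linarith
  have hd0 : (d : ℝ) ≠ 0 := by
    have : 0 < d := by omega
    positivity
  rw [hsum, div_self hd0, one_mul] at h
  exact h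

lemma profile_eq (hd : 3 ≤ d) (A B C : ℤ → ℝ) (x : Zd d) :
    profile A B C x = A (x ⟨0, by omega⟩) * B (x ⟨1, by omega⟩)
      * ∏ i ∈ Finset.univ.filter (fun i : Fin d => 2 ≤ (i : ℕ)), C (x i) := by
  have h1 : ∏ i ∈ Finset.univ.filter (fun i : Fin d => 2 ≤ (i : ℕ)), C (x i)
      = ∏ i : Fin d, if 2 ≤ (i : ℕ) then C (x i) else 1 := Finset.prod_filter _ _
  rw [h1]
  obtain ⟨n, rfl⟩ : ∃ n, d = n + 2 := ⟨d - 2, by omega⟩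
  unfold profile
  rw [Fin.prod_univ_succ, Fin.prod_univ_succ, Fin.prod_univ_succ (n := n + 1),
    Fin.prod_univ_succ (n := n)]
  simp [mul_assoc]

lemma sinh_recurrence (θ s : ℝ) (t : ℤ) :
    Real.sinh (θ * (((t + 1 : ℤ) : ℝ) + s)) + Real.sinh (θ * (((t - 1 : ℤ) : ℝ) + s))
      = 2 * Real.cosh θ * Real.sinh (θ * (t + s)) := by
  push_cast
  rw [show θ * ((t : ℝ) + 1 + s) = θ * (t + s) + θ by ring,
    show θ * ((t : ℝ) - 1 + s) = θ * (t + s) - θ by ring, Real.sinh_add, Real.sinh_sub]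
  ring

lemma cos_recurrence (φ s : ℝ) (t : ℤ) :
    Real.cos (φ * (((t + 1 : ℤ) : ℝ) - s)) + Real.cos (φ * (((t - 1 : ℤ) : ℝ) - s))
      = 2 * Real.cos φ * Real.cos (φ * (t - s)) := by
  push_cast
  rw [show φ * ((t : ℝ) + 1 - s) = φ * (t - s) + φ by ring,
    show φ * ((t : ℝ) - 1 - s) = φ * (t - s) - φ by ring, Real.cos_add, Real.cos_sub]
  ring

lemma cos_mul_sin_recurrence (φ s : ℝ) (t : ℤ) :
    Real.cos (φ * (((t + 1 : ℤ) : ℝ) - s)) * Real.sin (φ * (((t + 1 : ℤ) : ℝ) - s))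
      + Real.cos (φ * (((t - 1 : ℤ) : ℝ) - s)) * Real.sin (φ * (((t - 1 : ℤ) : ℝ) - s))
      = 2 * Real.cos (2 * φ) * (Real.cos (φ * (t - s)) * Real.sin (φ * (t - s))) := by
  have h : ∀ u : ℝ, Real.cos u * Real.sin u = Real.sin (2 * u) / 2 := fun u => by
    rw [Real.sin_two_mul]; ring
  simp only [h]
  push_cast
  rw [show 2 * (φ * ((t : ℝ) + 1 - s)) = 2 * (φ * (t - s)) + 2 * φ by ring,
    show 2 * (φ * ((t : ℝ) - 1 - s)) = 2 * (φ * (t - s)) - 2 * φ by ring, Real.sin_add, Real.sin_sub]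
  ring

/-- The harmonic function on a tube used to force the walk through it. -/
def tubeFun (φ θ₁ θ₂ β : ℝ) (a b : ℕ) (x : Zd d) : ℝ :=
  profile (fun t => Real.sinh (θ₁ * (t + (a + 1)))) (fun t => Real.cos (φ * (t - b)))
      (fun t => Real.cos (φ * (t - 0))) x
    + β * profile (fun t => Real.sinh (θ₂ * (t + (a + 1))))
      (fun t => Real.cos (φ * (t - b)) * Real.sin (φ * (t - b))) (fun t => Real.cos (φ * (t - 0))) x

lemma avg_tubeFun (hd : 3 ≤ d) {φ θ₁ θ₂ : ℝ} (h₁ : Real.cosh θ₁ = d - (d - 1) * Real.cos φ)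
    (h₂ : Real.cosh θ₂ = d - Real.cos (2 * φ) - (d - 2) * Real.cos φ) (β : ℝ) (a b : ℕ) (x : Zd d) :
    avg (tubeFun φ θ₁ θ₂ β a b) x = tubeFun φ θ₁ θ₂ β a b x := by
  unfold tubeFun
  rw [congrFun (avg_add _ _) x, congrFun (avg_const_mul β _) x,
    avg_profile hd (sinh_recurrence θ₁ _) (cos_recurrence φ _) (cos_recurrence φ _)
      (by rw [h₁]; ring),
    avg_profile hd (sinh_recurrence θ₂ _) (cos_mul_sin_recurrence φ _) (cos_recurrence φ _)
      (by rw [h₂]; ring)]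

lemma tubeFun_eq (hd : 3 ≤ d) (φ θ₁ θ₂ β : ℝ) (a b : ℕ) (x : Zd d) :
    tubeFun φ θ₁ θ₂ β a b x = (Real.cos (φ * (x ⟨1, by omega⟩ - b))
      * ∏ i ∈ Finset.univ.filter (fun i : Fin d => 2 ≤ (i : ℕ)), Real.cos (φ * (x i - 0)))
      * (Real.sinh (θ₁ * (x ⟨0, by omega⟩ + (a + 1)))
        + β * Real.sinh (θ₂ * (x ⟨0, by omega⟩ + (a + 1))) * Real.sin (φ * (x ⟨1, by omega⟩ - b))) := by
  unfold tubeFun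
  rw [profile_eq hd, profile_eq hd]
  ring

/-- The vector translating the off-centre tube onto `ℛ_{N,p}`. -/
def tubeShift (a b : ℕ) : Zd d := fun i => if (i : ℕ) = 0 then (a : ℤ) else if (i : ℕ) = 1 then -b else 0

lemma cos_mul_nonneg {p : ℕ} {φ : ℝ} (hφ : φ = Real.pi / (2 * (p + 1))) {t : ℝ} (ht : |t| ≤ p + 1) :
    0 ≤ Real.cos (φ * t) := by
  have h1 : φ * (p + 1) = Real.pi / 2 := by rw [hφ]; field_simp
  have hφ0 : 0 ≤ φ := by rw [hφ]; have := Real.pi_pos; positivity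
  have h2 := abs_le.1 ht
  refine Real.cos_nonneg_of_mem_Icc ⟨?_, ?_⟩
  · nlinarith
  · nlinarith

lemma cos_mul_eq_zero {p : ℕ} {φ : ℝ} (hφ : φ = Real.pi / (2 * (p + 1))) {t : ℝ} (ht : |t| = p + 1) :
    Real.cos (φ * t) = 0 := by
  have h1 : φ * (p + 1) = Real.pi / 2 := by rw [hφ]; field_simp
  have hφ0 : 0 ≤ φ := by rw [hφ]; have := Real.pi_pos; positivity
  rw [← Real.cos_abs, abs_mul, abs_of_nonneg hφ0, ht, h1, Real.cos_pi_div_two]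

lemma nbr_tubeShift {N p a b : ℕ} {x y : Zd d} (hx : x + tubeShift a b ∈ tube d N p) {i : Fin d}
    (hy : y = x + Pi.single i 1 ∨ y = x - Pi.single i 1) (j : Fin d) :
    if (j : ℕ) = 0 then 0 ≤ y j + a + 1 ∧ y j + a + 1 ≤ N + 2
      else if (j : ℕ) = 1 then |y j - b| ≤ p + 1 else |y j| ≤ p + 1 := by
  have h1 := hx j
  have h2 : |y j - x j| ≤ 1 := by
    rcases hy with rfl | rfl <;> by_cases hij : j = i
    · subst hij; simp
    · simp [hij]
    · subst hij; simp
    · simp [hij]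
  rw [Pi.add_apply, tubeShift] at h1
  have h3 := abs_le.1 h2
  split_ifs at h1 ⊢
  · omega
  · rw [abs_le] at h1 ⊢; omega
  · rw [abs_le] at h1 ⊢; omega

lemma WalkLaw.le_prob_of_tubeFun {P : Zd d → Measure (ℕ → Zd d)} (hW : WalkLaw d P) (hd : 3 ≤ d)
    {N p a b : ℕ} (ha : a ≤ N) (hb : b ≤ p) {φ θ₁ θ₂ β H : ℝ}
    (hφ : φ = Real.pi / (2 * (p + 1))) (h₁ : Real.cosh θ₁ = d - (d - 1) * Real.cos φ)
    (h₂ : Real.cosh θ₂ = d - Real.cos (2 * φ) - (d - 2) * Real.cos φ)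
    (hθ₁ : 0 ≤ θ₁) (hθ₂ : 0 ≤ θ₂) (hβ : 0 ≤ β) (hH0 : 0 < H)
    (hH : Real.sinh (θ₁ * (N + 2)) + β * Real.sinh (θ₂ * (N + 2)) ≤ H)
    (htop : ∀ y : ℤ, |y| ≤ p → ((y : ℝ) + b) ^ 2 + ((N : ℝ) - a + 1) ^ 2 ≤ N ^ 2 →
      Real.sinh (θ₁ * (N + 2)) + β * Real.sinh (θ₂ * (N + 2)) * Real.sin (φ * y) ≤ 0) :
    ENNReal.ofReal (Real.cos (φ * b) * (Real.sinh (θ₁ * (a + 1))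
        - β * Real.sinh (θ₂ * (a + 1)) * Real.sin (φ * b)) / H)
      ≤ P 0 {ω | capF P (visF 0 N ω) ≤ capF P (tubeF d N p)} := by
  obtain ⟨i₀, hi₀⟩ : ∃ i : Fin d, i = ⟨0, by omega⟩ := ⟨_, rfl⟩
  obtain ⟨i₁, hi₁⟩ : ∃ i : Fin d, i = ⟨1, by omega⟩ := ⟨_, rfl⟩
  have hi₀v : (i₀ : ℕ) = 0 := by rw [hi₀]
  have hi₁v : (i₁ : ℕ) = 1 := by rw [hi₁]
  have hval := tubeFun_eq hd φ θ₁ θ₂ β a b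
  rw [← hi₀, ← hi₁] at hval
  set W : Zd d → ℝ := fun x =>
    ∏ i ∈ Finset.univ.filter (fun i : Fin d => 2 ≤ (i : ℕ)), Real.cos (φ * (x i - 0)) with hWdef
  have hbound : ∀ x : Zd d, 0 ≤ (x i₀ : ℝ) + (a + 1) → (x i₀ : ℝ) + (a + 1) ≤ N + 2 →
      |(x i₁ : ℝ) - b| ≤ p + 1 → (∀ i : Fin d, 2 ≤ (i : ℕ) → |(x i : ℝ) - 0| ≤ p + 1) →
      tubeFun φ θ₁ θ₂ β a b x ≤ H := by
    intro x hx1 hx2 hx3 hx4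
    have hWx0 : 0 ≤ W x := Finset.prod_nonneg fun i hi =>
      cos_mul_nonneg hφ (hx4 i (Finset.mem_filter.1 hi).2)
    have hWx1 : W x ≤ 1 := Finset.prod_le_one (fun i hi =>
      cos_mul_nonneg hφ (hx4 i (Finset.mem_filter.1 hi).2)) fun i _ => Real.cos_le_one _
    have hc0 := cos_mul_nonneg hφ hx3
    have hc : Real.cos (φ * (x i₁ - b)) * W x ≤ 1 := mul_le_one₀ (Real.cos_le_one _) hWx0 hWx1
    have hs1 : Real.sinh (θ₁ * (x i₀ + (a + 1))) ≤ Real.sinh (θ₁ * (N + 2)) :=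
      Real.sinh_le_sinh.2 (mul_le_mul_of_nonneg_left hx2 hθ₁)
    have hs2 : Real.sinh (θ₂ * (x i₀ + (a + 1))) ≤ Real.sinh (θ₂ * (N + 2)) :=
      Real.sinh_le_sinh.2 (mul_le_mul_of_nonneg_left hx2 hθ₂)
    have hs20 : 0 ≤ Real.sinh (θ₂ * (x i₀ + (a + 1))) := Real.sinh_nonneg_iff.2 (mul_nonneg hθ₂ hx1)
    have hbr : Real.sinh (θ₁ * (x i₀ + (a + 1)))
        + β * Real.sinh (θ₂ * (x i₀ + (a + 1))) * Real.sin (φ * (x i₁ - b)) ≤ H := by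
      have h1 : β * Real.sinh (θ₂ * (x i₀ + (a + 1))) * Real.sin (φ * (x i₁ - b))
          ≤ β * Real.sinh (θ₂ * (x i₀ + (a + 1))) :=
        mul_le_of_le_one_right (mul_nonneg hβ hs20) (Real.sin_le_one _)
      have h2 := mul_le_mul_of_nonneg_left hs2 hβ
      linarith
    rw [hval]
    calc _ ≤ Real.cos (φ * (x i₁ - b)) * W x * H :=
          mul_le_mul_of_nonneg_left hbr (mul_nonneg hc0 hWx0)
      _ ≤ 1 * H := by gcongr
      _ = H := one_mul H
  have h0 : tubeFun φ θ₁ θ₂ β a b (0 : Zd d) = Real.cos (φ * b) * (Real.sinh (θ₁ * (a + 1))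
        - β * Real.sinh (θ₂ * (a + 1)) * Real.sin (φ * b)) := by
    rw [hval]
    simp
    ring_nf
    simp
  rw [← h0]
  have hb' : (b : ℝ) ≤ p := by exact_mod_cast hb
  have ha' : (a : ℝ) ≤ N := by exact_mod_cast ha
  refine hW.le_prob_thin hd (tubeShift a b) hH0 (fun x _ => (avg_tubeFun hd h₁ h₂ β a b x).ge) ?_ ?_ ?_
  · intro x hx i y hy
    have hn := nbr_tubeShift hx hy
    have n0 := hn i₀
    rw [if_pos hi₀v] at n0
    have n1 := hn i₁
    rw [if_neg (by omega), if_pos hi₁v] at n1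
    have n2 : ∀ j : Fin d, 2 ≤ (j : ℕ) → |y j| ≤ p + 1 := fun j hj => by
      have := hn j
      rwa [if_neg (by omega), if_neg (by omega)] at this
    have r0 : 0 ≤ (y i₀ : ℝ) + (a + 1) := by
      have : (0 : ℝ) ≤ ((y i₀ + a + 1 : ℤ) : ℝ) := by exact_mod_cast n0.1
      push_cast at this
      linarith
    have r0' : (y i₀ : ℝ) + (a + 1) ≤ N + 2 := by
      have : ((y i₀ + a + 1 : ℤ) : ℝ) ≤ ((N + 2 : ℤ) : ℝ) := by exact_mod_cast n0.2
      push_cast at this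
      linarith
    have r1 : |(y i₁ : ℝ) - b| ≤ p + 1 := by exact_mod_cast n1
    have r2 : ∀ j : Fin d, 2 ≤ (j : ℕ) → |(y j : ℝ) - 0| ≤ p + 1 := fun j hj => by
      rw [sub_zero]
      exact_mod_cast n2 j hj
    refine ⟨hbound y r0 r0' r1 r2, fun hlen hyt => ?_⟩
    have hyt' : ∃ j : Fin d, ¬ (if (j : ℕ) = 0 then 0 ≤ (y + tubeShift a b : Zd d) j ∧ (y + tubeShift a b : Zd d) j ≤ N
        else |(y + tubeShift a b : Zd d) j| ≤ p) := by
      exact not_forall.1 fun hc => hyt hc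
    rw [hval]
    by_cases hb1 : |y i₁ - b| ≤ p
    swap
    · have : |(y i₁ : ℝ) - b| = p + 1 := by
        have h1 : |y i₁ - b| = p + 1 := by omega
        exact_mod_cast h1
      rw [cos_mul_eq_zero hφ this]
      simp
    obtain ⟨j, hj⟩ := hyt'
    rw [Pi.add_apply, tubeShift] at hj
    by_cases hj2 : 2 ≤ (j : ℕ)
    · rw [if_neg (by omega), if_neg (by omega), if_neg (by omega), add_zero] at hj
      have h3 : |(y j : ℝ) - 0| = p + 1 := by
        have h1 := n2 j hj2
        have h2 : |y j| = p + 1 := by omega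
        rw [sub_zero]
        exact_mod_cast h2
      have h4 : W y = 0 := Finset.prod_eq_zero (Finset.mem_filter.2 ⟨Finset.mem_univ j, hj2⟩)
        (cos_mul_eq_zero hφ h3)
      change Real.cos (φ * (y i₁ - b)) * W y * _ ≤ 0
      rw [h4]
      simp
    by_cases hj1 : (j : ℕ) = 1
    · rw [if_neg (by omega), if_neg (by omega), if_pos hj1] at hj
      have : j = i₁ := Fin.ext (by omega)
      rw [this] at hj
      exact absurd hb1 (by rwa [sub_eq_add_neg])
    have hj0 : (j : ℕ) = 0 := by omega
    have hji : j = i₀ := Fin.ext (by omega)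
    rw [if_pos hj0, if_pos hj0, hji] at hj
    have hWy0 : 0 ≤ W y := Finset.prod_nonneg fun i hi =>
      cos_mul_nonneg hφ (r2 i (Finset.mem_filter.1 hi).2)
    have hcW := mul_nonneg (cos_mul_nonneg hφ r1) hWy0
    refine mul_nonpos_of_nonneg_of_nonpos hcW ?_
    rcases (show y i₀ + a + 1 = 0 ∨ y i₀ + a + 1 = N + 2 by omega) with e | e
    · have e' : (y i₀ : ℝ) + (a + 1) = 0 := by
        have : ((y i₀ + a + 1 : ℤ) : ℝ) = 0 := by exact_mod_cast e
        push_cast at this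
        linarith
      rw [e']
      simp
    · have e' : (y i₀ : ℝ) + (a + 1) = N + 2 := by
        have : ((y i₀ + a + 1 : ℤ) : ℝ) = ((N + 2 : ℤ) : ℝ) := by exact_mod_cast e
        push_cast at this
        linarith
      rw [e']
      have h5 := htop (y i₁ - b) hb1 ?_
      · push_cast at h5
        exact h5
      · have h6 : nsq y ≤ (N : ℝ) ^ 2 := by
          rw [← len_sq]
          have := len_nonneg y
          gcongr
        refine le_trans ?_ h6
        have hne : i₀ ≠ i₁ := fun h => by rw [h] at hi₀v; omega
        have h7 : ∑ i ∈ ({i₀, i₁} : Finset (Fin d)), (y i : ℝ) ^ 2 ≤ nsq y :=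
          Finset.sum_le_sum_of_subset_of_nonneg (Finset.subset_univ _) fun _ _ _ => sq_nonneg _
        rw [Finset.sum_pair hne] at h7
        have h8 : (N : ℝ) - a + 1 = y i₀ := by linarith
        rw [h8]
        push_cast
        calc _ = (y i₀ : ℝ) ^ 2 + (y i₁ : ℝ) ^ 2 := by ring
          _ ≤ _ := h7
  · intro i
    unfold tubeShift
    split_ifs
    · omega
    · rw [abs_neg]; simpa using hb
    · simp
  · refine hbound 0 ?_ ?_ ?_ ?_
    · simp; positivity
    · simp; linarith
    · simp; linarith
    · intro i _
      simp
      positivity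

lemma one_add_sq_le_cosh {x : ℝ} (hx : 0 ≤ x) : 1 + x ^ 2 / 2 ≤ Real.cosh x := by
  have h1 : Real.cosh x = 1 + 2 * Real.sinh (x / 2) ^ 2 := by
    rw [show x = 2 * (x / 2) by ring, Real.cosh_two_mul, Real.cosh_sq]
    ring_nf
  have h2 : x / 2 ≤ Real.sinh (x / 2) := Real.self_le_sinh_iff.2 (by linarith)
  have h3 : (x / 2) ^ 2 ≤ Real.sinh (x / 2) ^ 2 := by gcongr
  linarith

lemma cosh_le_of_sq_le {x : ℝ} (hx : x ^ 2 ≤ 2) : Real.cosh x ≤ 1 + x ^ 2 / 2 * (1 + x ^ 2 / 2) := by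
  have h1 := Real.cosh_le_exp_half_sq x
  have h2 := Real.abs_exp_sub_one_sub_id_le (x := x ^ 2 / 2)
    (by rw [abs_of_nonneg (by positivity)]; linarith)
  have h3 := (abs_le.1 h2).2
  nlinarith

lemma le_of_cosh_le {x y : ℝ} (hx : 0 ≤ x) (hy : 0 ≤ y) (h : Real.cosh x ≤ Real.cosh y) : x ≤ y := by
  have := Real.cosh_le_cosh.1 h
  rwa [abs_of_nonneg hx, abs_of_nonneg hy] at this

lemma le_theta {D φ θ : ℝ} (hD : 3 ≤ D) (hφ0 : 0 ≤ φ) (hφ1 : φ ≤ 1) (hθ : 0 ≤ θ)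
    (h : Real.cosh θ = D - (D - 1) * Real.cos φ) : φ ≤ θ := by
  refine le_of_cosh_le hφ0 hθ ?_
  have hsq : φ ^ 2 ≤ 1 := pow_le_one₀ hφ0 hφ1
  have h1 := cosh_le_of_sq_le (x := φ) (by linarith)
  have h2 := (abs_le.1 (Real.cos_bound (x := φ) (by rwa [abs_of_nonneg hφ0]))).2
  rw [abs_of_nonneg hφ0] at h2
  have h3 := Real.cos_le_one φ
  have h4 : φ ^ 4 ≤ φ ^ 2 := by nlinarith [sq_nonneg φ]
  rw [h]
  nlinarith

lemma theta_le {D φ θ : ℝ} (hD : 3 ≤ D) (hφ0 : 0 ≤ φ) (hθ : 0 ≤ θ)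
    (h : Real.cosh θ = D - (D - 1) * Real.cos φ) : θ ≤ D * φ := by
  refine le_of_cosh_le hθ (by positivity) ?_
  refine le_trans ?_ (one_add_sq_le_cosh (by positivity))
  have h1 := Real.one_sub_sq_div_two_le_cos (x := φ)
  rw [h]
  have h2 : (D - 1) * (1 - φ ^ 2 / 2) ≤ (D - 1) * Real.cos φ :=
    mul_le_mul_of_nonneg_left h1 (by linarith)
  nlinarith [sq_nonneg φ, mul_nonneg (sq_nonneg φ) (by nlinarith : 0 ≤ D ^ 2 - D + 1)]

lemma cosh_theta_two {D φ θ₂ : ℝ} (h : Real.cosh θ₂ = D - Real.cos (2 * φ) - (D - 2) * Real.cos φ) :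
    Real.cosh θ₂ = 1 + (D + 2 * Real.cos φ) * (1 - Real.cos φ) := by
  rw [h, Real.cos_two_mul]
  ring

lemma theta_two_le {D φ θ₂ : ℝ} (hD : 3 ≤ D) (hφ0 : 0 ≤ φ) (hθ : 0 ≤ θ₂)
    (h : Real.cosh θ₂ = D - Real.cos (2 * φ) - (D - 2) * Real.cos φ) : θ₂ ≤ 2 * D * φ := by
  refine le_of_cosh_le hθ (by positivity) ?_
  refine le_trans ?_ (one_add_sq_le_cosh (by positivity))
  rw [cosh_theta_two h]
  have h1 := Real.one_sub_sq_div_two_le_cos (x := φ)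
  have h2 := Real.cos_le_one φ
  have h3 : (D + 2 * Real.cos φ) * (1 - Real.cos φ) ≤ (D + 2) * (φ ^ 2 / 2) :=
    mul_le_mul (by linarith) (by linarith) (by linarith) (by linarith)
  nlinarith [sq_nonneg φ, mul_nonneg (sq_nonneg φ) (by nlinarith : 0 ≤ 4 * D ^ 2 - (D + 2))]

lemma theta_gap {D φ θ₁ θ₂ : ℝ} (hD : 3 ≤ D) (hφ0 : 0 ≤ φ) (hφ1 : φ ≤ 1) (hφD : (D * φ) ^ 2 ≤ 1 / (4 * D))
    (hθ₁ : 0 ≤ θ₁) (hθ₂ : 0 ≤ θ₂) (h₁ : Real.cosh θ₁ = D - (D - 1) * Real.cos φ)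
    (h₂ : Real.cosh θ₂ = D - Real.cos (2 * φ) - (D - 2) * Real.cos φ) :
    (1 + 1 / (4 * D)) * θ₁ ≤ θ₂ := by
  set c : ℝ := 1 / (4 * D) with hc
  have hc0 : 0 < c := by positivity
  have hc1 : c ≤ 1 / 12 := by
    rw [hc]
    exact one_div_le_one_div_of_le (by norm_num) (by linarith)
  have hx : θ₁ ^ 2 ≤ c := by
    refine le_trans ?_ hφD
    have := theta_le hD hφ0 hθ₁ h₁
    gcongr
  refine le_of_cosh_le (by positivity) hθ₂ ?_
  have hc2 : (1 + c) ^ 2 ≤ 1 + 3 * c := by nlinarith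
  have hy : ((1 + c) * θ₁) ^ 2 ≤ (1 + 3 * c) * θ₁ ^ 2 := by
    rw [mul_pow]
    gcongr
  have hy2 : ((1 + c) * θ₁) ^ 2 ≤ 2 * c := by nlinarith [sq_nonneg θ₁]
  have h3 := cosh_le_of_sq_le (x := (1 + c) * θ₁) (by linarith)
  have h4 := one_add_sq_le_cosh hθ₁
  have hcos : 1 / 2 ≤ Real.cos φ := by
    have := Real.one_sub_sq_div_two_le_cos (x := φ)
    have hsq : φ ^ 2 ≤ 1 := pow_le_one₀ hφ0 hφ1
    linarith
  have hcos1 := Real.cos_le_one φ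
  rw [cosh_theta_two h₂]
  have h5 : ((1 + c) * θ₁) ^ 2 / 2 * (1 + ((1 + c) * θ₁) ^ 2 / 2)
      ≤ (1 + 3 * c) * θ₁ ^ 2 / 2 * (1 + c) := by
    gcongr
    linarith
  have h6 : (1 + 3 * c) * (1 + c) ≤ 1 + 5 * c := by nlinarith
  have h7 : θ₁ ^ 2 / 2 ≤ (D - 1) * (1 - Real.cos φ) := by linarith
  have h8 : (1 + 3 * c) * θ₁ ^ 2 / 2 * (1 + c) ≤ (1 + 5 * c) * ((D - 1) * (1 - Real.cos φ)) := by
    calc (1 + 3 * c) * θ₁ ^ 2 / 2 * (1 + c) = (1 + 3 * c) * (1 + c) * (θ₁ ^ 2 / 2) := by ring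
      _ ≤ _ := mul_le_mul h6 h7 (by positivity) (by positivity)
  have h9 : (1 + 5 * c) * (D - 1) ≤ D + 1 := by
    have : c * D = 1 / 4 := by rw [hc]; field_simp
    nlinarith
  have h10 : (1 + 5 * c) * ((D - 1) * (1 - Real.cos φ)) ≤ (D + 2 * Real.cos φ) * (1 - Real.cos φ) := by
    rw [← mul_assoc]
    refine mul_le_mul_of_nonneg_right ?_ (by linarith)
    linarith
  linarith

lemma sinh_le_mul_exp (x : ℝ) : Real.sinh x ≤ x * Real.exp x := by
  have h1 := Real.add_one_le_exp (-(2 * x))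
  have h2 : Real.exp (-x) = Real.exp x * Real.exp (-(2 * x)) := by
    rw [← Real.exp_add]
    congr 1
    ring
  rw [Real.sinh_eq, h2]
  nlinarith [Real.exp_pos x]

lemma sinh_ratio_gap {θ₁ θ₂ c Y Z : ℝ} (hθ₁ : 0 < θ₁) (hc0 : 0 < c) (hc1 : c ≤ 1)
    (hθ : (1 + c) * θ₁ ≤ θ₂) (hY : 0 ≤ Y) (hZ : 3 / 2 ≤ θ₁ * Z)
    (hexp : Real.exp (θ₂ * Y) ≤ 1 + c / 8) :
    Real.sinh (θ₁ * Z) * Real.sinh (θ₂ * Y)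
      ≤ (1 - c / 8) * (Real.sinh (θ₁ * Y) * Real.sinh (θ₂ * Z)) := by
  obtain ⟨q, hq⟩ : ∃ q, q = θ₂ / θ₁ := ⟨_, rfl⟩
  have hqθ : θ₂ = q * θ₁ := by rw [hq]; field_simp
  have hq1 : 1 + c ≤ q := by rw [hq, le_div_iff₀ hθ₁]; exact hθ
  have hs1 : 0 < Real.sinh (θ₁ * Z) := Real.sinh_pos_iff.2 (by linarith)
  have h1 : q * (1 + c / 2) * Real.sinh (θ₁ * Z) ≤ Real.sinh (θ₂ * Z) := by
    have e : θ₂ * Z = θ₁ * Z + (q - 1) * (θ₁ * Z) := by rw [hqθ]; ring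
    have h2 : Real.sinh (θ₁ * Z) * Real.exp ((q - 1) * (θ₁ * Z)) ≤ Real.sinh (θ₂ * Z) := by
      rw [e, Real.sinh_add, ← Real.cosh_add_sinh]
      have h3 : Real.sinh (θ₁ * Z) ≤ Real.cosh (θ₁ * Z) := (Real.sinh_lt_cosh _).le
      have h4 : 0 ≤ Real.sinh ((q - 1) * (θ₁ * Z)) :=
        Real.sinh_nonneg_iff.2 (mul_nonneg (by linarith) (by linarith))
      nlinarith
    refine le_trans ?_ h2
    rw [mul_comm]
    refine mul_le_mul_of_nonneg_left ?_ hs1.le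
    have h5 : Real.exp (q - 1) * Real.exp ((q - 1) / 2) ≤ Real.exp ((q - 1) * (θ₁ * Z)) := by
      rw [← Real.exp_add]
      exact Real.exp_le_exp.2 (by nlinarith)
    refine le_trans (mul_le_mul ?_ ?_ (by positivity) (by positivity)) h5
    · linarith [Real.add_one_le_exp (q - 1)]
    · linarith [Real.add_one_le_exp ((q - 1) / 2)]
  have h6 : Real.sinh (θ₂ * Y) ≤ θ₂ * Y * (1 + c / 8) :=
    (sinh_le_mul_exp _).trans (mul_le_mul_of_nonneg_left hexp
      (mul_nonneg (by rw [hqθ]; exact mul_nonneg (by linarith) hθ₁.le) hY))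
  have h7 : θ₁ * Y ≤ Real.sinh (θ₁ * Y) := Real.self_le_sinh_iff.2 (mul_nonneg hθ₁.le hY)
  have hq0 : 0 ≤ q := by linarith
  calc Real.sinh (θ₁ * Z) * Real.sinh (θ₂ * Y)
      ≤ Real.sinh (θ₁ * Z) * (θ₂ * Y * (1 + c / 8)) := mul_le_mul_of_nonneg_left h6 hs1.le
    _ = (1 + c / 8) * (θ₁ * Y * (q * Real.sinh (θ₁ * Z))) := by rw [hqθ]; ring
    _ ≤ ((1 - c / 8) * (1 + c / 2)) * (θ₁ * Y * (q * Real.sinh (θ₁ * Z))) := by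
        refine mul_le_mul_of_nonneg_right (by nlinarith) (by positivity)
    _ = (1 - c / 8) * (θ₁ * Y * (q * (1 + c / 2) * Real.sinh (θ₁ * Z))) := by ring
    _ ≤ _ := by
        refine mul_le_mul_of_nonneg_left ?_ (by linarith)
        exact mul_le_mul h7 h1 (by positivity) (Real.sinh_nonneg_iff.2 (by positivity))

lemma angle_bounds {p φ : ℝ} (hp : 1 ≤ p) (hφ : φ = Real.pi / (2 * (p + 1))) :
    3 / (4 * p) ≤ φ ∧ φ ≤ 2 / p ∧ φ ≤ 1 ∧ 3 / 2 ≤ φ * (p + 1) ∧ φ * (2 * (p + 1)) = Real.pi := by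
  have e : φ * (2 * (p + 1)) = Real.pi := by rw [hφ]; field_simp
  have h3 := Real.pi_gt_three
  have h4 := Real.pi_le_four
  have hφ0 : 0 < φ := by rw [hφ]; positivity
  refine ⟨?_, ?_, ?_, by nlinarith, e⟩
  · rw [div_le_iff₀ (by positivity)]
    nlinarith
  · rw [le_div_iff₀ (by positivity)]
    nlinarith
  · nlinarith

lemma exp_le_mul_div_sinh {D ε φ θ N p A : ℝ} (hD : 3 ≤ D) (hε : 0 < ε) (hp : 1 ≤ p) (hpN : p ≤ N)
    (hφ : φ = Real.pi / (2 * (p + 1))) (h₁ : φ ≤ θ) (h₂ : θ ≤ D * φ) (hA : ε * p ^ 2 ≤ A * N) :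
    3 * ε / 4 * Real.exp (-((6 * D + 1) * N / p)) ≤ θ * A / Real.sinh (θ * (N + 2)) := by
  obtain ⟨hφl, hφu, -, -, -⟩ := angle_bounds hp hφ
  have hp0 : 0 < p := by linarith
  have hN0 : 0 < N := by linarith
  have hφ0 : 0 < φ := lt_of_lt_of_le (by positivity) hφl
  have hθ0 : 0 < θ := by linarith
  have hs0 : 0 < Real.sinh (θ * (N + 2)) := Real.sinh_pos_iff.2 (by positivity)
  have hA' : ε * p ^ 2 / N ≤ A := by rwa [div_le_iff₀ hN0]
  have hx : θ * (N + 2) ≤ 6 * D * (N / p) := by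
    calc θ * (N + 2) ≤ (D * (2 / p)) * (3 * N) := by
          refine mul_le_mul (h₂.trans ?_) (by linarith) (by linarith) (by positivity)
          exact mul_le_mul_of_nonneg_left hφu (by linarith)
      _ = _ := by ring
  have hsinh : Real.sinh (θ * (N + 2)) ≤ Real.exp (6 * D * (N / p)) := by
    refine le_trans ?_ (Real.exp_le_exp.2 hx)
    rw [Real.sinh_eq]
    linarith [Real.exp_pos (θ * (N + 2)), Real.exp_pos (-(θ * (N + 2)))]
  have hpn : Real.exp (-(N / p)) ≤ p / N := by
    rw [Real.exp_neg, inv_le_comm₀ (Real.exp_pos _) (by positivity), inv_div]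
    linarith [Real.add_one_le_exp (N / p)]
  have hθA : 3 * ε / 4 * (p / N) ≤ θ * A := by
    calc 3 * ε / 4 * (p / N) = 3 / (4 * p) * (ε * p ^ 2 / N) := by field_simp
      _ ≤ θ * A := mul_le_mul (hφl.trans h₁) hA' (by positivity) hθ0.le
  rw [le_div_iff₀ hs0]
  calc 3 * ε / 4 * Real.exp (-((6 * D + 1) * N / p)) * Real.sinh (θ * (N + 2))
      ≤ 3 * ε / 4 * Real.exp (-((6 * D + 1) * N / p)) * Real.exp (6 * D * (N / p)) := by gcongr
    _ = 3 * ε / 4 * Real.exp (-(N / p)) := by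
        rw [mul_assoc, ← Real.exp_add]
        congr 2
        ring
    _ ≤ 3 * ε / 4 * (p / N) := by gcongr
    _ ≤ θ * A := hθA

lemma half_angle_bounds {p b : ℕ} (hp : 2 ≤ p) (hb : b = (p + 1) / 2) {φ : ℝ}
    (hφ : φ = Real.pi / (2 * (p + 1))) :
    1 / 2 ≤ Real.sin (φ * b) ∧ 1 / 2 ≤ Real.cos (φ * b) ∧ φ * b ≤ Real.pi / 4 := by
  have e := (angle_bounds (p := (p : ℝ)) (by exact_mod_cast (by omega : 1 ≤ p)) hφ).2.2.2.2
  have hφ0 : 0 < φ := by rw [hφ]; positivity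
  have hπ := Real.pi_pos
  have h1 : (p : ℝ) + 1 ≤ 3 * b := by exact_mod_cast (by omega : p + 1 ≤ 3 * b)
  have h2 : 2 * (b : ℝ) ≤ p + 1 := by exact_mod_cast (by omega : 2 * b ≤ p + 1)
  have hl : Real.pi / 6 ≤ φ * b := by nlinarith
  have hu : φ * b ≤ Real.pi / 4 := by nlinarith
  refine ⟨?_, ?_, hu⟩
  · rw [← Real.sin_pi_div_six]
    exact Real.sin_le_sin_of_le_of_le_pi_div_two (by linarith) (by linarith) hl
  · rw [← Real.cos_pi_div_three]
    exact Real.cos_le_cos_of_nonneg_of_le_pi (by linarith) (by linarith) (by linarith)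

lemma sin_le_neg_of_le {p b : ℕ} (hp : 2 ≤ p) (hb : b = (p + 1) / 2) {φ τ y : ℝ}
    (hφ : φ = Real.pi / (2 * (p + 1))) (hτ : 0 ≤ τ) (hτ1 : τ ≤ 1 / 8) (hy : |y| ≤ p)
    (hyb : y + b ≤ τ * p) : Real.sin (φ * y) ≤ -(Real.sin (φ * b) - 2 * τ) := by
  obtain ⟨-, hφu, -, -, e⟩ := angle_bounds (p := (p : ℝ)) (by exact_mod_cast (by omega : 1 ≤ p)) hφ
  obtain ⟨-, -, hu⟩ := half_angle_bounds hp hb hφ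
  have hφ0 : 0 < φ := by rw [hφ]; positivity
  have hp0 : (0 : ℝ) < p := by exact_mod_cast (by omega : 0 < p)
  have hb0 : (0 : ℝ) ≤ φ * b := by positivity
  have hφp : φ * p ≤ 2 := by rwa [le_div_iff₀ hp0] at hφu
  have h1 : φ * y ≤ -(φ * b) + 2 * τ := by nlinarith
  have h2 : -(Real.pi / 2) ≤ φ * y := by
    have := (abs_le.1 hy).1
    nlinarith
  have h3 := Real.pi_gt_three
  have h4 : Real.sin (φ * y) ≤ Real.sin (-(φ * b) + 2 * τ) :=
    Real.sin_le_sin_of_le_of_le_pi_div_two h2 (by linarith) h1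
  have h5 := Real.lipschitzWith_sin.dist_le_mul (-(φ * b) + 2 * τ) (-(φ * b))
  rw [Real.dist_eq, Real.dist_eq, NNReal.coe_one, one_mul, add_sub_cancel_left,
    abs_of_nonneg (by positivity : 0 ≤ 2 * τ), Real.sin_neg] at h5
  linarith [(abs_le.1 h5).2]

lemma WalkLaw.le_prob_of_thin {P : Zd d → Measure (ℕ → Zd d)} (hW : WalkLaw d P) (hd : 3 ≤ d)
    {N p : ℕ} (hp : 1 ≤ p) (hpN : p ≤ N) {ε : ℝ} (hε : 0 < ε) (hN : ε * (p : ℝ) ^ 2 ≤ N) :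
    ENNReal.ofReal (3 * ε / 4 * Real.exp (-((6 * d + 1) * N / p)))
      ≤ P 0 {ω | capF P (visF 0 N ω) ≤ capF P (tubeF d N p)} := by
  have hD : (3 : ℝ) ≤ d := by exact_mod_cast hd
  have hp' : (1 : ℝ) ≤ p := by exact_mod_cast hp
  have hpN' : (p : ℝ) ≤ N := by exact_mod_cast hpN
  obtain ⟨φ, hφ⟩ : ∃ φ : ℝ, φ = Real.pi / (2 * (p + 1)) := ⟨_, rfl⟩
  have hφ0 : 0 < φ := by rw [hφ]; positivity
  have hφ1 := (angle_bounds hp' hφ).2.2.1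
  obtain ⟨θ₁, hθ₁, h₁⟩ : ∃ θ : ℝ, 0 ≤ θ ∧ Real.cosh θ = d - (d - 1) * Real.cos φ := by
    have : (1 : ℝ) ≤ d - (d - 1) * Real.cos φ := by nlinarith [Real.cos_le_one φ]
    exact ⟨_, Real.arcosh_nonneg this, Real.cosh_arcosh this⟩
  obtain ⟨θ₂, hθ₂, h₂⟩ : ∃ θ : ℝ, 0 ≤ θ ∧
      Real.cosh θ = d - Real.cos (2 * φ) - (d - 2) * Real.cos φ := by
    have : (1 : ℝ) ≤ d - Real.cos (2 * φ) - (d - 2) * Real.cos φ := by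
      nlinarith [Real.cos_le_one φ, Real.cos_le_one (2 * φ)]
    exact ⟨_, Real.arcosh_nonneg this, Real.cosh_arcosh this⟩
  have hle := le_theta hD hφ0.le hφ1 hθ₁ h₁
  have hs0 : 0 < Real.sinh (θ₁ * (N + 2)) :=
    Real.sinh_pos_iff.2 (mul_pos (by linarith) (by positivity))
  refine le_trans (ENNReal.ofReal_le_ofReal ?_) (hW.le_prob_of_tubeFun hd (Nat.zero_le N)
    (Nat.zero_le p) (β := 0) hφ h₁ h₂ hθ₁ hθ₂ le_rfl hs0 (by simp) ?_)
  · refine (exp_le_mul_div_sinh (A := 1) hD hε hp' hpN' hφ hle (theta_le hD hφ0.le hθ₁ h₁)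
      (by simpa using hN)).trans ?_
    refine div_le_div_of_nonneg_right ?_ hs0.le
    simpa using Real.self_le_sinh_iff.2 hθ₁
  · intro y _ hy
    exfalso
    push_cast at hy
    nlinarith [sq_nonneg ((y : ℝ) + 0)]

set_option maxHeartbeats 1000000 in
lemma WalkLaw.le_prob_of_thick {P : Zd d → Measure (ℕ → Zd d)} (hW : WalkLaw d P) (hd : 3 ≤ d)
    {N p : ℕ} (hp : 1 ≤ p) (hpN : p ≤ N) {τ : ℝ} (hτ : d * τ = 1 / 512)
    (hN : (N : ℝ) ≤ τ ^ 2 / 2 * (p : ℝ) ^ 2) :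
    ENNReal.ofReal (4 * τ / 5 * (3 * (τ ^ 2 / 2) / 4 * Real.exp (-((6 * d + 1) * N / p))))
      ≤ P 0 {ω | capF P (visF 0 N ω) ≤ capF P (tubeF d N p)} := by
  have hD : (3 : ℝ) ≤ d := by exact_mod_cast hd
  have hp' : (1 : ℝ) ≤ p := by exact_mod_cast hp
  have hpN' : (p : ℝ) ≤ N := by exact_mod_cast hpN
  have hp0 : (0 : ℝ) < p := by linarith
  have hN0 : (0 : ℝ) < N := by linarith
  have hτ0 : 0 < τ := by
    by_contra h
    push Not at h
    nlinarith
  have hτ1 : τ ≤ 1 / 1536 := by nlinarith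
  have hεp : 1 ≤ τ ^ 2 / 2 * p := by
    have : 1 * (p : ℝ) ≤ τ ^ 2 / 2 * p * p := by nlinarith
    exact le_of_mul_le_mul_right this hp0
  have hτ2 : τ ^ 2 / 2 ≤ 1 / 2 := by nlinarith
  have hp2 : 2 ≤ p := by
    have : (2 : ℝ) ≤ p := by nlinarith
    exact_mod_cast this
  obtain ⟨φ, hφ⟩ : ∃ φ : ℝ, φ = Real.pi / (2 * (p + 1)) := ⟨_, rfl⟩
  have hφ0 : 0 < φ := by rw [hφ]; positivity
  obtain ⟨-, hφu, hφ1, hφp1, -⟩ := angle_bounds hp' hφ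
  have hφp : φ * p ≤ 2 := by rwa [le_div_iff₀ hp0] at hφu
  have hφε : φ ≤ τ ^ 2 := by nlinarith
  obtain ⟨θ₁, hθ₁, h₁⟩ : ∃ θ : ℝ, 0 ≤ θ ∧ Real.cosh θ = d - (d - 1) * Real.cos φ := by
    have : (1 : ℝ) ≤ d - (d - 1) * Real.cos φ := by nlinarith [Real.cos_le_one φ]
    exact ⟨_, Real.arcosh_nonneg this, Real.cosh_arcosh this⟩
  obtain ⟨θ₂, hθ₂, h₂⟩ : ∃ θ : ℝ, 0 ≤ θ ∧
      Real.cosh θ = d - Real.cos (2 * φ) - (d - 2) * Real.cos φ := by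
    have : (1 : ℝ) ≤ d - Real.cos (2 * φ) - (d - 2) * Real.cos φ := by
      nlinarith [Real.cos_le_one φ, Real.cos_le_one (2 * φ)]
    exact ⟨_, Real.arcosh_nonneg this, Real.cosh_arcosh this⟩
  have hle := le_theta hD hφ0.le hφ1 hθ₁ h₁
  have hθ₁0 : 0 < θ₁ := by linarith
  have hc : 1 / (4 * (d : ℝ)) = 128 * τ := by
    rw [div_eq_iff (by positivity)]
    linarith
  have hDφ : d * φ ≤ τ := by nlinarith
  have hgap := theta_gap hD hφ0.le hφ1
    (by rw [hc]; nlinarith [mul_nonneg (by linarith : (0 : ℝ) ≤ d) hφ0.le]) hθ₁ hθ₂ h₁ h₂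
  have hθ₂0 : 0 < θ₂ := lt_of_lt_of_le (by positivity) hgap
  have hθ₂u := theta_two_le hD hφ0.le hθ₂ h₂
  obtain ⟨a, ha⟩ : ∃ a, a = ⌊τ ^ 2 / 2 * (p : ℝ) ^ 2 / N⌋₊ := ⟨_, rfl⟩
  have hau : (a : ℝ) ≤ τ ^ 2 / 2 * (p : ℝ) ^ 2 / N := by
    rw [ha]; exact Nat.floor_le (by positivity)
  have hal : τ ^ 2 / 2 * (p : ℝ) ^ 2 / N ≤ a + 1 := by
    rw [ha]; exact (Nat.lt_floor_add_one _).le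
  rw [le_div_iff₀ hN0] at hau
  rw [div_le_iff₀ hN0] at hal
  have hap : (a : ℝ) ≤ τ ^ 2 / 2 * p := by
    have h : (a : ℝ) * p ≤ τ ^ 2 / 2 * p * p :=
      le_trans (mul_le_mul_of_nonneg_left hpN' (Nat.cast_nonneg a)) (by linarith)
    exact le_of_mul_le_mul_right h hp0
  have haN : a ≤ N := by
    have : (a : ℝ) ≤ N := by nlinarith
    exact_mod_cast this
  obtain ⟨b, hb⟩ : ∃ b, b = (p + 1) / 2 := ⟨_, rfl⟩
  obtain ⟨hsin, hcos, -⟩ := half_angle_bounds hp2 hb hφ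
  have hZ : 3 / 2 ≤ θ₁ * (N + 2) :=
    hφp1.trans (mul_le_mul hle (by linarith) (by linarith) hθ₁)
  have hZ1 : 0 < Real.sinh (θ₁ * (N + 2)) := Real.sinh_pos_iff.2 (by linarith)
  have hZ2 : 0 < Real.sinh (θ₂ * (N + 2)) := Real.sinh_pos_iff.2 (by positivity)
  have hY1 : θ₁ * (a + 1) ≤ Real.sinh (θ₁ * (a + 1)) := Real.self_le_sinh_iff.2 (by positivity)
  have hexp : Real.exp (θ₂ * (a + 1)) ≤ 1 + 128 * τ / 8 := by
    have h1 : θ₂ * (a + 1) ≤ 4 * τ := by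
      calc θ₂ * (a + 1) ≤ 2 * d * φ * (τ ^ 2 * p) :=
            mul_le_mul hθ₂u (by linarith) (by positivity) (by positivity)
        _ = 2 * (d * τ) * τ * (φ * p) := by ring
        _ ≤ 2 * (d * τ) * τ * 2 := by gcongr
        _ ≤ 4 * τ := by rw [hτ]; linarith
    refine (Real.exp_le_exp.2 h1).trans ?_
    have h2 := (abs_le.1 (Real.abs_exp_sub_one_sub_id_le (x := 4 * τ)
      (by rw [abs_of_nonneg (by positivity)]; linarith))).2
    nlinarith
  rw [hc] at hgap
  have hratio := sinh_ratio_gap hθ₁0 (by positivity : 0 < 128 * τ) (by linarith) hgap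
    (by positivity : (0 : ℝ) ≤ a + 1) hZ hexp
  obtain ⟨s, hs⟩ : ∃ s, s = Real.sin (φ * b) - 2 * τ := ⟨_, rfl⟩
  have hs4 : 1 / 4 ≤ s := by rw [hs]; linarith
  obtain ⟨β, hβ⟩ : ∃ β, β = Real.sinh (θ₁ * (N + 2)) / (Real.sinh (θ₂ * (N + 2)) * s) := ⟨_, rfl⟩
  have hβ0 : 0 ≤ β := by rw [hβ]; positivity
  have hβs : β * Real.sinh (θ₂ * (N + 2)) * s = Real.sinh (θ₁ * (N + 2)) := by
    rw [hβ]; field_simp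
  refine le_trans (ENNReal.ofReal_le_ofReal ?_) (hW.le_prob_of_tubeFun hd haN
    (by omega : b ≤ p) (β := β) (H := 5 * Real.sinh (θ₁ * (N + 2))) hφ h₁ h₂ hθ₁ hθ₂ hβ0
    (by positivity) ?_ ?_)
  · have hY2 : s * (β * Real.sinh (θ₂ * (a + 1)))
        ≤ (1 - 16 * τ) * Real.sinh (θ₁ * (a + 1)) := by
      have h : Real.sinh (θ₂ * (N + 2)) * (s * (β * Real.sinh (θ₂ * (a + 1))))
          ≤ Real.sinh (θ₂ * (N + 2)) * ((1 - 16 * τ) * Real.sinh (θ₁ * (a + 1))) := by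
        calc _ = β * Real.sinh (θ₂ * (N + 2)) * s * Real.sinh (θ₂ * (a + 1)) := by ring
          _ = Real.sinh (θ₁ * (N + 2)) * Real.sinh (θ₂ * (a + 1)) := by rw [hβs]
          _ ≤ _ := hratio
          _ = _ := by ring
      exact le_of_mul_le_mul_left h hZ2
    have hσ : Real.sin (φ * b) ≤ (1 + 8 * τ) * s := by rw [hs]; nlinarith
    have hY20 : 0 ≤ β * Real.sinh (θ₂ * (a + 1)) :=
      mul_nonneg hβ0 (Real.sinh_nonneg_iff.2 (by positivity))
    have hY10 : 0 ≤ Real.sinh (θ₁ * (a + 1)) := Real.sinh_nonneg_iff.2 (by positivity)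
    have hsub : β * Real.sinh (θ₂ * (a + 1)) * Real.sin (φ * b)
        ≤ (1 - 8 * τ) * Real.sinh (θ₁ * (a + 1)) := by
      calc _ ≤ β * Real.sinh (θ₂ * (a + 1)) * ((1 + 8 * τ) * s) :=
            mul_le_mul_of_nonneg_left hσ hY20
        _ = (1 + 8 * τ) * (s * (β * Real.sinh (θ₂ * (a + 1)))) := by ring
        _ ≤ (1 + 8 * τ) * ((1 - 16 * τ) * Real.sinh (θ₁ * (a + 1))) := by gcongr
        _ = ((1 + 8 * τ) * (1 - 16 * τ)) * Real.sinh (θ₁ * (a + 1)) := by ring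
        _ ≤ _ := mul_le_mul_of_nonneg_right (by nlinarith) hY10
    have hnum : 4 * τ * (θ₁ * (a + 1)) ≤ Real.cos (φ * b) * (Real.sinh (θ₁ * (a + 1))
        - β * Real.sinh (θ₂ * (a + 1)) * Real.sin (φ * b)) := by
      calc 4 * τ * (θ₁ * (a + 1)) ≤ 4 * τ * Real.sinh (θ₁ * (a + 1)) := by gcongr
        _ = 1 / 2 * (8 * τ * Real.sinh (θ₁ * (a + 1))) := by ring
        _ ≤ _ := mul_le_mul hcos (by linarith) (by positivity) (by linarith)
    have hdec := exp_le_mul_div_sinh (A := a + 1) hD (by positivity : 0 < τ ^ 2 / 2) hp' hpN' hφ hle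
      (theta_le hD hφ0.le hθ₁ h₁) hal
    calc _ ≤ 4 * τ / 5 * (θ₁ * (a + 1) / Real.sinh (θ₁ * (N + 2))) := by gcongr
      _ = 4 * τ * (θ₁ * (a + 1)) / (5 * Real.sinh (θ₁ * (N + 2))) := by field_simp
      _ ≤ _ := div_le_div_of_nonneg_right hnum (by positivity)
  · have : 1 / 4 * (β * Real.sinh (θ₂ * (N + 2))) ≤ s * (β * Real.sinh (θ₂ * (N + 2))) :=
      mul_le_mul_of_nonneg_right hs4 (by positivity)
    linarith
  · intro y hy hyN
    have hyb : (y : ℝ) + b ≤ τ * p := by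
      refine le_of_sq_le_sq ?_ (by positivity)
      have : (a : ℝ) ≤ N := by exact_mod_cast haN
      nlinarith
    have := sin_le_neg_of_le hp2 hb hφ hτ0.le (by linarith) (by exact_mod_cast hy) hyb
    rw [← hs] at this
    have h2 := mul_le_mul_of_nonneg_left this (by positivity : 0 ≤ β * Real.sinh (θ₂ * (N + 2)))
    linarith

theorem exists_lower (hd : 3 ≤ d) : ∃ c C : ℝ, 0 < c ∧ 0 < C ∧
    ∀ P : Zd d → Measure (ℕ → Zd d), WalkLaw d P → ∀ N p : ℕ, 1 ≤ p → p ≤ N →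
      ENNReal.ofReal (c * Real.exp (-(C * N / p)))
        ≤ P 0 {ω | capF P (visF 0 N ω) ≤ capF P (tubeF d N p)} := by
  have hd0 : (0 : ℝ) < d := by exact_mod_cast (by omega : 0 < d)
  obtain ⟨τ, hτ⟩ : ∃ τ : ℝ, τ = 1 / 512 / d := ⟨_, rfl⟩
  have hτ0 : 0 < τ := by rw [hτ]; positivity
  refine ⟨min (3 * (τ ^ 2 / 2) / 4) (4 * τ / 5 * (3 * (τ ^ 2 / 2) / 4)), 6 * d + 1,
    lt_min (by positivity) (by positivity), by positivity, fun P hW N p hp hpN => ?_⟩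
  rcases le_total (τ ^ 2 / 2 * (p : ℝ) ^ 2) (N : ℝ) with h | h
  · refine le_trans (ENNReal.ofReal_le_ofReal ?_)
      (hW.le_prob_of_thin hd hp hpN (by positivity) h)
    exact mul_le_mul_of_nonneg_right (min_le_left _ _) (Real.exp_pos _).le
  · refine le_trans (ENNReal.ofReal_le_ofReal ?_)
      (hW.le_prob_of_thick hd hp hpN (by rw [hτ]; field_simp) h)
    rw [← mul_assoc]
    exact mul_le_mul_of_nonneg_right (min_le_right _ _) (Real.exp_pos _).le

end

/-- Theorem `the:boundcapacityintro`: probability that the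
capacity of the range of the walk before exiting `B(N)` is at most the capacity
of the tube `ℛ_{N,p}`. -/
theorem statement1 :
    ∀ η : ℝ, η ∈ Set.Ioo (0:ℝ) 1 →
    ∀ d : ℕ, 3 ≤ d →
    ∃ c C : ℝ, 0 < c ∧ c ≤ C ∧
    ∀ (P : Zd d → Measure (ℕ → Zd d)), WalkLaw d P →
    ∀ N p : ℕ, 1 ≤ p → p ≤ N →
      ENNReal.ofReal (c * Real.exp (-(C * (N : ℝ) / (p : ℝ))))
        ≤ P 0 {ω | capZ P (visited (ballZ (0 : Zd d) (N : ℝ)) ω)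
            ≤ capZ P (tube d (N : ℤ) (p : ℤ))} ∧
      (d = 3 →
        P 0 {ω | capZ P (visited (ballZ (0 : Zd d) (N : ℝ)) ω)
            ≤ capZ P (tube d (N : ℤ) (p : ℤ))}
          ≤ ENNReal.ofReal (C * Real.exp (-(c * (N : ℝ) / (p : ℝ)) ^ (1 - η)))) ∧
      (d = 4 →
        P 0 {ω | capZ P (visited (ballZ (0 : Zd d) (N : ℝ)) ω)
            ≤ capZ P (tube d (N : ℤ) (p : ℤ))}
          ≤ ENNReal.ofReal (C * Real.exp
              (-(c * (N : ℝ) / ((p : ℝ) * (max 1 (Real.log (p : ℝ))) ^ 2))))) := by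
  intro η hη d hd
  obtain ⟨c₁, C₁, hc₁, -, hlow⟩ := exists_lower hd
  obtain ⟨C₃, -, h3⟩ := exists_upper3 hη.1 hη.2
  obtain ⟨c₄, C₄, hc₄, -, h4⟩ := exists_upper4
  have hc1 : min 1 (min c₁ c₄) ≤ 1 := min_le_left _ _
  have hcc₁ : min 1 (min c₁ c₄) ≤ c₁ := (min_le_right _ _).trans (min_le_left _ _)
  have hcc₄ : min 1 (min c₁ c₄) ≤ c₄ := (min_le_right _ _).trans (min_le_right _ _)
  have hc0 : 0 < min 1 (min c₁ c₄) := lt_min one_pos (lt_min hc₁ hc₄)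
  have hC1 : 1 ≤ max (max 1 C₁) (max C₃ C₄) := (le_max_left _ _).trans (le_max_left _ _)
  have hCC₁ : C₁ ≤ max (max 1 C₁) (max C₃ C₄) := (le_max_right _ _).trans (le_max_left _ _)
  have hCC₃ : C₃ ≤ max (max 1 C₁) (max C₃ C₄) := (le_max_left _ _).trans (le_max_right _ _)
  have hCC₄ : C₄ ≤ max (max 1 C₁) (max C₃ C₄) := (le_max_right _ _).trans (le_max_right _ _)
  generalize min 1 (min c₁ c₄) = c at *
  generalize max (max 1 C₁) (max C₃ C₄) = C at *
  refine ⟨c, C, hc0, hc1.trans hC1, fun P hW N p hp hpN => ?_⟩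
  have hp0 : (0 : ℝ) < p := by exact_mod_cast hp
  rw [WalkLaw.event_eq (by omega) N p]
  refine ⟨le_trans (ENNReal.ofReal_le_ofReal ?_) (hlow P hW N p hp hpN), ?_, ?_⟩
  · refine mul_le_mul hcc₁ (Real.exp_le_exp.2 (neg_le_neg ?_)) (Real.exp_pos _).le hc₁.le
    gcongr
  · rintro rfl
    refine (h3 P hW N p hp hpN).trans (ENNReal.ofReal_le_ofReal ?_)
    refine mul_le_mul hCC₃ (Real.exp_le_exp.2 (neg_le_neg ?_)) (Real.exp_pos _).le (by linarith)
    refine Real.rpow_le_rpow (by positivity) ?_ (by linarith [hη.2])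
    gcongr
    exact mul_le_of_le_one_left (Nat.cast_nonneg N) hc1
  · rintro rfl
    refine (h4 P hW N p hp hpN).trans (ENNReal.ofReal_le_ofReal ?_)
    refine mul_le_mul hCC₄ (Real.exp_le_exp.2 (neg_le_neg ?_)) (Real.exp_pos _).le (by linarith)
    gcongr

end Paper
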